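/- Let A be a unital separable simple C*-algebra with TR(A) = 0, and let α be an automorphism of A with the tracial Rokhlin property such that α^r is approximately inner for some integer r ≥ 1. Let C be a unital simple C*-algebra with the SP-property containing A as a C*-subalgebra with the same unit, and suppose u ∈ C is a unitary with u a u* = α(a) for all a ∈ A and C is generated as a C*-algebra by A ∪ {u}. Then TR(C) = 0. (This is the tracial-rank-zero case of the theorem that TR(A ⋊_α ℤ) = 0 when TR(A) = 0, α has the tracial Rokhlin property, and α^r is approximately inner, with the crossed product replaced by the properties of it that are used.) -/

import Mathlib

open Filter Topology

/-- A projection in a C*-algebra: a self-adjoint idempotent. -/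
def IsProjection {A : Type*} [Mul A] [Star A] (p : A) : Prop :=
  IsSelfAdjoint p ∧ IsIdempotentElem p

/-- A positive element of a C*-algebra (one of the standard equivalent definitions). -/
def IsPos {A : Type*} [Mul A] [Star A] (a : A) : Prop :=
  ∃ b : A, a = star b * b

/-- A central sequence: asymptotically commutes with every element. -/
def IsCentralSeq {A : Type*} [CStarAlgebra A] (x : ℕ → A) : Prop :=
  ∀ a : A, Tendsto (fun n => ‖x n * a - a * x n‖) atTop (nhds 0)

/-- An approximately inner map: on every finite set it is approximated by `a ↦ v* a v`
for unitaries `v`. -/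
def ApproxInner {A : Type*} [CStarAlgebra A] (f : A → A) : Prop :=
  ∀ (F : Finset A) (ε : ℝ), 0 < ε →
    ∃ v : A, v ∈ unitary A ∧ ∀ a ∈ F, ‖f a - star v * a * v‖ < ε

/-- Murray–von Neumann equivalence of projections. -/
def MvNEquiv {A : Type*} [CStarAlgebra A] (p q : A) : Prop :=
  ∃ w : A, star w * w = p ∧ w * star w = q

/-- `[a] ≤ [b]`: there is `x` with `a = x*x` and `xx*` in the closure of `bAb`. -/
def CuntzLE {A : Type*} [CStarAlgebra A] (a b : A) : Prop :=
  ∃ x : A, a = star x * x ∧ x * star x ∈ closure (Set.range fun c => b * c * b)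

/-- A simple C*-algebra: the only closed two-sided ideals are trivial. -/
def IsSimpleCStar (A : Type*) [CStarAlgebra A] : Prop :=
  ∀ I : TwoSidedIdeal A, IsClosed (I : Set A) →
    (I : Set A) = {0} ∨ (I : Set A) = Set.univ

/-- A tracial state on a unital C*-algebra. -/
def IsTracialState {A : Type*} [CStarAlgebra A] (τ : A →ₗ[ℂ] ℂ) : Prop :=
  (∀ a : A, ∃ r : ℝ, 0 ≤ r ∧ τ (star a * a) = (r : ℂ)) ∧
  τ 1 = 1 ∧ ∀ a b : A, τ (a * b) = τ (b * a)

/-- The SP-property: every hereditary subalgebra `\overline{aAa}` (`a` positive nonzero)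
contains a nonzero projection. -/
def SPProperty (A : Type*) [CStarAlgebra A] : Prop :=
  ∀ a : A, IsPos a → a ≠ 0 →
    ∃ p : A, IsProjection p ∧ p ≠ 0 ∧ p ∈ closure (Set.range fun c => a * c * a)

/-- Stable rank one: invertibles are dense. -/
def StableRankOne (A : Type*) [CStarAlgebra A] : Prop :=
  Dense {x : A | IsUnit x}

/-- The Fundamental Comparison Property. -/
def FundamentalComparison (A : Type*) [CStarAlgebra A] : Prop :=
  ∀ p q : A, IsProjection p → IsProjection q →
    (∀ τ : A →ₗ[ℂ] ℂ, IsTracialState τ → (τ p).re < (τ q).re) →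
    ∃ q' : A, IsProjection q' ∧ q' * q = q' ∧ q * q' = q' ∧ MvNEquiv p q'

/-- Tracial (topological) rank zero for a simple unital C*-algebra. -/
def TracialRankZero (A : Type*) [CStarAlgebra A] : Prop :=
  ∀ (F : Finset A) (ε : ℝ), 0 < ε → ∀ a : A, IsPos a → a ≠ 0 →
    ∃ (B : NonUnitalStarSubalgebra ℂ A) (p : A),
      FiniteDimensional ℂ B ∧ IsProjection p ∧ p ∈ B ∧
      (∀ b ∈ B, p * b = b ∧ b * p = b) ∧
      (∀ x ∈ F, ‖x * p - p * x‖ < ε) ∧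
      (∀ x ∈ F, ∃ b ∈ B, ‖p * x * p - b‖ < ε) ∧
      CuntzLE (1 - p) a

/-- The tracial Rokhlin property for an automorphism. -/
def TracialRokhlin {A : Type*} [CStarAlgebra A] (α : A ≃⋆ₐ[ℂ] A) : Prop :=
  ∀ (F : Finset A) (ε : ℝ), 0 < ε → ∀ n : ℕ, ∀ x : A, IsPos x → x ≠ 0 →
    ∃ e : Fin (n + 1) → A,
      (∀ j, IsProjection (e j)) ∧
      (∀ i j, i ≠ j → e i * e j = 0) ∧
      (∀ j : Fin (n + 1), (j : ℕ) < n → ‖α (e j) - e (j + 1)‖ < ε) ∧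
      (∀ j, ∀ a ∈ F, ‖e j * a - a * e j‖ < ε) ∧
      CuntzLE (1 - ∑ j, e j) x

/-- The tracial cyclic Rokhlin property for an automorphism: as the tracial
Rokhlin property, but with the cyclic condition `‖α(e n) - e 0‖ < ε` included
(in `Fin (n+1)`, `j + 1` wraps around, so `e (n + 1) = e 0`). -/
def TracialCyclicRokhlin {A : Type*} [CStarAlgebra A] (α : A ≃⋆ₐ[ℂ] A) : Prop :=
  ∀ (F : Finset A) (ε : ℝ), 0 < ε → ∀ n : ℕ, ∀ x : A, IsPos x → x ≠ 0 →
    ∃ e : Fin (n + 1) → A,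
      (∀ j, IsProjection (e j)) ∧
      (∀ i j, i ≠ j → e i * e j = 0) ∧
      (∀ j : Fin (n + 1), ‖α (e j) - e (j + 1)‖ < ε) ∧
      (∀ j, ∀ a ∈ F, ‖e j * a - a * e j‖ < ε) ∧
      CuntzLE (1 - ∑ j, e j) x

/-- Integer powers of an automorphism, as a function. -/
def autZPow {A : Type*} [CStarAlgebra A] (α : A ≃⋆ₐ[ℂ] A) (m : ℤ) : A → A :=
  if 0 ≤ m then (⇑α)^[m.toNat] else (⇑α.symm)^[(-m).toNat]

/-- A uniformly outer map. -/
def UniformlyOuter {A : Type*} [CStarAlgebra A] (f : A → A) : Prop :=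
  ∀ (a p : A), IsProjection p → ∀ ε : ℝ, 0 < ε →
    ∃ (n : ℕ) (q : Fin n → A),
      (∀ i, IsProjection (q i)) ∧ (∑ i, q i) = p ∧
      ∀ i, ‖q i * a * f (q i)‖ < ε


section domsec
variable {A : Type*} [CStarAlgebra A] [PartialOrder A] [StarOrderedRing A]

/-- comparison of positive elements by conjugation -/
def Dom (a b : A) : Prop := ∃ x : A, a ≤ star x * b * x


lemma Dom.trans {a b c : A} (h1 : Dom a b) (h2 : Dom b c) : Dom a c := by
  obtain ⟨x, hx⟩ := h1
  obtain ⟨y, hy⟩ := h2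
  refine ⟨y * x, hx.trans ?_⟩
  have := star_left_conjugate_le_conjugate hy x
  simpa [mul_assoc] using this

lemma Dom.of_le {a b : A} (h : a ≤ b) : Dom a b := ⟨1, by simpa using h⟩

lemma Dom.conj (a x : A) : Dom (star x * a * x) a := ⟨x, le_rfl⟩

lemma Dom.smul {r : ℝ} (hr : 0 ≤ r) (b : A) : Dom (r • b) b := by
  refine ⟨(Real.sqrt r) • (1 : A), le_of_eq ?_⟩
  simp [smul_smul, Real.mul_self_sqrt hr]

lemma Dom.of_le_smul {a b : A} {r : ℝ} (hr : 0 ≤ r) (h : a ≤ r • b) : Dom a b :=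
  (Dom.of_le h).trans (Dom.smul hr b)

lemma Dom.sq {h : A} (hh : 0 ≤ h) : Dom (h * h) h := by
  have h1 := CStarAlgebra.star_left_conjugate_le_norm_smul (a := CFC.sqrt h) (b := h) (hb := hh.isSelfAdjoint)
  have h2 : star (CFC.sqrt h) = CFC.sqrt h := (CFC.sqrt_nonneg h).isSelfAdjoint.star_eq
  have h3 := CFC.sqrt_mul_sqrt_self h
  refine Dom.of_le_smul (norm_nonneg h) (le_trans (le_of_eq ?_) (h1.trans (le_of_eq ?_)))
  · rw [h2]
    have : ∀ s : A, s * s * (s * s) = s * (s * s) * s := fun s => by simp only [mul_assoc]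
    have h4 := this (CFC.sqrt h)
    rwa [h3] at h4
  · rw [h2, h3]

lemma Dom.sandwich {g c : A} (hg : 0 ≤ g) (hc : IsSelfAdjoint c) : Dom (g * c * g) g := by
  have h1 := CStarAlgebra.star_left_conjugate_le_norm_smul (a := g) (b := c) (hb := hc)
  rw [hg.isSelfAdjoint.star_eq] at h1
  exact (Dom.of_le_smul (norm_nonneg c) h1).trans (Dom.sq hg)

lemma Dom.mono_conj {a b : A} (h : Dom a b) (y : A) : Dom (star y * a * y) b :=
  (Dom.conj a y).trans h

lemma exists_isqrt {M : A} (hM : IsStrictlyPositive M) :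
    ∃ S : A, IsSelfAdjoint S ∧ 0 ≤ S ∧ S * M * S = 1 ∧ S * S * M = 1 ∧
      (∀ b, Commute M b → Commute S b) := by
  have hS : IsSelfAdjoint (M ^ (-(1/2) : ℝ)) := (CFC.rpow_nonneg).isSelfAdjoint
  have hc : ∀ b, Commute M b → Commute (M ^ (-(1/2) : ℝ)) b := by
    intro b hb
    rw [CFC.rpow_def]
    exact hb.cfc_nnreal _
  have h1 := CFC.conjugate_rpow_neg_one_half M hM
  refine ⟨M ^ (-(1/2) : ℝ), hS, CFC.rpow_nonneg, h1, ?_, hc⟩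
  have := (hc M (Commute.refl M)).eq
  rw [mul_assoc, this, ← mul_assoc, h1]

lemma isProj_nonneg {P : A} (hP : IsProjection P) : 0 ≤ P := by
  have := star_mul_self_nonneg P
  rwa [hP.1.star_eq, hP.2.eq] at this

lemma isProj_compl {P : A} (hP : IsProjection P) : IsProjection (1 - P) :=
  ⟨(IsSelfAdjoint.one A).sub hP.1, hP.2.one_sub⟩

lemma isProj_le_one {P : A} (hP : IsProjection P) : P ≤ 1 :=
  sub_nonneg.1 (isProj_nonneg (isProj_compl hP))

lemma isProj_norm_le {P : A} (hP : IsProjection P) : ‖P‖ ≤ 1 :=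
  (CStarAlgebra.norm_le_one_iff_of_nonneg P (isProj_nonneg hP)).2 (isProj_le_one hP)

/-- key inversion in a corner -/
lemma corner_isqrt {P y : A} (hP : IsProjection P) (hyP : y * P = y) (hPy : P * y = y)
    {r : ℝ} (hr : 0 < r) (hle : r • P ≤ y) :
    ∃ S : A, IsSelfAdjoint S ∧ S * P = S ∧ P * S = S ∧ S * y * S = P ∧ S * S * y = P ∧
      (∀ b, Commute y b → Commute P b → Commute S b) := by
  set r' := min r 1
  have hr' : 0 < r' := lt_min hr one_pos
  have hM : IsStrictlyPositive (y + (1 - P)) := by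
    refine IsStrictlyPositive.of_le (a := algebraMap ℝ A r') ?_ ?_
    · exact ⟨algebraMap_nonneg A hr'.le, (isUnit_iff_ne_zero.2 hr'.ne').map (algebraMap ℝ A)⟩
    · have h1 : r' • P ≤ y := (smul_le_smul_of_nonneg_right (min_le_left r 1) (isProj_nonneg hP)).trans hle
      have h2 : r' • (1 - P) ≤ 1 - P := by
        have := smul_le_smul_of_nonneg_right (min_le_right r 1) (isProj_nonneg (isProj_compl hP))
        simpa using this
      calc algebraMap ℝ A r' = r' • P + r' • (1 - P) := by
            rw [Algebra.algebraMap_eq_smul_one, ← smul_add]; simp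
        _ ≤ _ := add_le_add h1 h2
  obtain ⟨S, hS, -, h1, h2, hc⟩ := exists_isqrt hM
  have hPS : Commute S P := hc P (by
    show (y + (1 - P)) * P = P * (y + (1 - P))
    simp [add_mul, mul_add, sub_mul, mul_sub, hyP, hPy, hP.2.eq])
  have hMP : (y + (1 - P)) * P = y := by simp [add_mul, sub_mul, hyP, hP.2.eq]
  have hPP := hP.2.eq
  have e1 : P * S * P = S * P := by rw [← hPS.eq, mul_assoc, hPP]
  refine ⟨S * P, ?_, by rw [mul_assoc, hPP], by rw [← mul_assoc, e1], ?_, ?_, ?_⟩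
  · rw [IsSelfAdjoint, star_mul, hS.star_eq, hP.1.star_eq, hPS.eq]
  · calc S * P * y * (S * P) = S * (P * y) * (P * S) := by rw [← hPS.eq]; simp only [mul_assoc]
      _ = S * ((y + (1 - P)) * P) * (P * S) := by rw [hPy, hMP]
      _ = S * (y + (1 - P)) * (P * P * S) := by simp only [mul_assoc]
      _ = S * (y + (1 - P)) * S * P := by rw [hPP, ← hPS.eq]; simp only [mul_assoc]
      _ = P := by rw [h1, one_mul]
  · calc S * P * (S * P) * y = S * (P * S) * (P * y) := by simp only [mul_assoc]
      _ = S * S * (P * P * y) := by rw [← hPS.eq]; simp only [mul_assoc]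
      _ = S * S * (y + (1 - P)) * P := by rw [hPP, hPy, mul_assoc _ _ P, hMP]
      _ = P := by rw [h2, one_mul]
  · intro b hb1 hb2
    refine Commute.mul_left (hc b ?_) hb2
    exact hb1.add_left ((Commute.one_left b).sub_left hb2)

lemma Dom.proj_eq {P b : A} (hP : IsProjection P) (h : Dom P b) :
    ∃ W, P = star W * b * W := by
  obtain ⟨x, hx⟩ := h
  have hPP := hP.2.eq
  have hPs := hP.1.star_eq
  have h1 := star_left_conjugate_le_conjugate hx P
  rw [hPs, hPP, hPP] at h1
  obtain ⟨S, hS, hSP, hPS, h2, -, -⟩ := corner_isqrt (y := P * (star x * b * x) * P) hP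
    (by rw [mul_assoc, hPP]) (by rw [← mul_assoc, ← mul_assoc, hPP]) one_pos (by simpa using h1)
  refine ⟨x * P * S, ?_⟩
  rw [star_mul, star_mul, hS.star_eq, hPs]
  refine h2.symm.trans ?_
  simp only [mul_assoc]

lemma le_of_norm_sub_le {a b : A} (ha : IsSelfAdjoint a) (hb : IsSelfAdjoint b) {η : ℝ}
    (h : ‖a - b‖ ≤ η) : a ≤ b + algebraMap ℝ A η := by
  have h1 := (ha.sub hb).le_algebraMap_norm_self
  have h2 : algebraMap ℝ A ‖a - b‖ ≤ algebraMap ℝ A η := algebraMap_mono A h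
  have := h1.trans h2
  rw [sub_le_iff_le_add] at this
  rwa [add_comm]

lemma Dom.of_norm_lt {P b x : A} (hP : IsProjection P) (hb : IsSelfAdjoint b)
    (h : ‖P - star x * b * x‖ ≤ 1 / 2) : Dom P b := by
  have hPP := hP.2.eq
  have hPs := hP.1.star_eq
  have h1 := le_of_norm_sub_le hP.1 (hb.conjugate' x) h
  have h2 := star_left_conjugate_le_conjugate h1 P
  rw [hPs, hPP, hPP, mul_add, add_mul, Algebra.algebraMap_eq_smul_one] at h2
  simp only [mul_smul_comm, mul_one, smul_mul_assoc, hPP] at h2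
  have h3 : (1/2 : ℝ) • P ≤ P * (star x * b * x) * P := by
    have h4 : P - (1/2 : ℝ) • P ≤ P * (star x * b * x) * P := sub_le_iff_le_add.2 h2
    have : P - (1/2 : ℝ) • P = (1/2 : ℝ) • P := by
      nth_rw 1 [← one_smul ℝ P]; rw [← sub_smul]; norm_num
    rwa [this] at h4
  have h5 := smul_le_smul_of_nonneg_left h3 (show (0:ℝ) ≤ 2 by norm_num)
  rw [smul_smul] at h5
  norm_num at h5
  refine Dom.of_le_smul (r := 2) (by norm_num) (h5.trans ?_) |>.trans (Dom.conj b (x * P))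
  rw [star_mul, hPs]
  simp only [mul_assoc, le_refl]

end domsec


section domsec2
variable {A : Type*} [CStarAlgebra A] [PartialOrder A] [StarOrderedRing A]

lemma CuntzLE.dom {P b : A} (hP : IsProjection P) (hb : IsSelfAdjoint b) (h : CuntzLE P b) :
    Dom P (b * b) := by
  obtain ⟨x, hx, hcl⟩ := h
  have hcont : Continuous (fun y : A => ‖P - star x * (star y * y) * x‖) := by fun_prop
  have h0 : P - star x * (star (x * star x) * (x * star x)) * x = 0 := by
    have : star x * (star (x * star x) * (x * star x)) * x = P * P * P := by
      rw [hx]; simp only [star_mul, star_star, mul_assoc]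
    rw [this, hP.2.eq, hP.2.eq, sub_self]
  have hopen : IsOpen {y : A | ‖P - star x * (star y * y) * x‖ < 1 / 2} :=
    isOpen_lt hcont continuous_const
  obtain ⟨y, hy1, c, hc⟩ := mem_closure_iff.1 hcl _ hopen (by
    show ‖P - star x * (star (x * star x) * (x * star x)) * x‖ < 1 / 2
    rw [h0]; norm_num)
  refine Dom.of_norm_lt (x := c * b * x) hP ?_ ?_
  · nth_rw 1 [← hb.star_eq]; exact IsSelfAdjoint.star_mul_self b
  · have hy1' : ‖P - star x * (star y * y) * x‖ < 1 / 2 := hy1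
    have : star (c * b * x) * (b * b) * (c * b * x) = star x * (star y * y) * x := by
      rw [← hc]; simp only [star_mul, hb.star_eq, mul_assoc]
    rw [this]; exact hy1'.le

lemma Dom.cuntzLE {P a : A} (hP : IsProjection P) (ha : IsSelfAdjoint a) (h : Dom P (a * a)) :
    CuntzLE P a := by
  obtain ⟨W, hW⟩ := h.proj_eq hP
  refine ⟨a * W, ?_, subset_closure ⟨W * star W, ?_⟩⟩
  · rw [hW]; simp only [star_mul, ha.star_eq, mul_assoc]
  · simp only [star_mul, ha.star_eq, mul_assoc]

lemma Dom.sum_orth {κ : Type*} (s : Finset κ) (P g : κ → A)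
    (hg : ∀ i ∈ s, IsSelfAdjoint (g i)) (horth : ∀ i ∈ s, ∀ j ∈ s, i ≠ j → g i * g j = 0)
    (h : ∀ i ∈ s, Dom (P i) (g i * g i * g i)) : Dom (∑ i ∈ s, P i) (∑ i ∈ s, g i) := by
  classical
  choose! X hX using h
  refine ⟨∑ i ∈ s, g i * X i, ?_⟩
  have : star (∑ i ∈ s, g i * X i) * (∑ i ∈ s, g i) * (∑ i ∈ s, g i * X i)
      = ∑ i ∈ s, star (X i) * (g i * g i * g i) * X i := by
    have h1 : (∑ i ∈ s, g i) * (∑ i ∈ s, g i * X i) = ∑ i ∈ s, g i * (g i * X i) := by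
      rw [Finset.sum_mul]
      refine Finset.sum_congr rfl fun i hi => ?_
      rw [Finset.mul_sum]
      refine Finset.sum_eq_single_of_mem i hi fun j hj hne => ?_
      rw [← mul_assoc, horth i hi j hj hne.symm, zero_mul]
    rw [mul_assoc, h1, star_sum, Finset.sum_mul]
    refine Finset.sum_congr rfl fun i hi => ?_
    rw [Finset.mul_sum, Finset.sum_eq_single_of_mem i hi]
    · simp only [star_mul, (hg i hi).star_eq, mul_assoc]
    · intro j hj hne
      simp only [star_mul, (hg i hi).star_eq, mul_assoc]
      rw [← mul_assoc (g i) (g j), horth i hi j hj hne.symm]; simp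
  rw [this]
  exact Finset.sum_le_sum hX

lemma ror {b d : A} (hb : 0 ≤ b) (hd : IsSelfAdjoint d) {η : ℝ} (hη : 0 < η)
    (h : ‖d - b‖ ≤ η) :
    ∃ k : A, k = cfc (fun t : ℝ => max (t - 2 * η) 0) d ∧
      0 ≤ k ∧ Dom (k * k) b ∧ ‖d - k‖ ≤ 2 * η ∧ ∀ c, Commute d c → Commute k c := by
  let f : ℝ → ℝ := fun t => max (t - 2 * η) 0
  have hf : Continuous f := by fun_prop
  have hk0 : 0 ≤ cfc f d := cfc_nonneg fun x _ => le_max_right _ _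
  have hks : star (cfc f d) = cfc f d := hk0.isSelfAdjoint.star_eq
  have hge : ∀ t ∈ spectrum ℝ d, -η ≤ t := by
    have h1 : algebraMap ℝ A (-η) ≤ d := by
      have h2 := le_of_norm_sub_le hb.isSelfAdjoint hd (η := η) (by rwa [norm_sub_rev] at h)
      have h3 := hb.trans h2
      rw [map_neg]
      exact neg_le_iff_add_nonneg.2 h3
    exact (algebraMap_le_iff_le_spectrum hd).1 h1
  refine ⟨cfc f d, rfl, hk0, ?_, ?_, fun c hc => hc.cfc_real f⟩
  · have h1 : d ≤ b + algebraMap ℝ A η := le_of_norm_sub_le hd hb.isSelfAdjoint h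
    have h2 := star_left_conjugate_le_conjugate (sub_le_iff_le_add.2 h1) (cfc f d)
    rw [hks] at h2
    have hd' : d - algebraMap ℝ A η = cfc (fun t : ℝ => t - η) d := by
      rw [cfc_sub (fun t : ℝ => t) (fun _ => η) d, cfc_id' ℝ d, cfc_const η d]
    have h3 : η • (cfc f d * cfc f d) ≤ cfc f d * (d - algebraMap ℝ A η) * cfc f d := by
      rw [hd', ← cfc_mul f f d, ← cfc_smul η _ d, ← cfc_mul f _ d, ← cfc_mul _ f d]
      refine cfc_mono fun t _ => ?_
      simp only [smul_eq_mul]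
      by_cases ht : t - 2 * η ≤ 0
      · have : f t = 0 := max_eq_right ht
        simp [this]
      · have hft : f t = t - 2 * η := max_eq_left (by linarith)
        rw [hft]; push Not at ht
        nlinarith [mul_nonneg ht.le (mul_nonneg ht.le ht.le)]
    have h4 := smul_le_smul_of_nonneg_left (h3.trans h2) (inv_nonneg.2 hη.le)
    rw [smul_smul, inv_mul_cancel₀ hη.ne', one_smul] at h4
    refine (Dom.of_le_smul (inv_nonneg.2 hη.le) h4).trans ?_
    have := Dom.conj b (cfc f d)
    rwa [hks] at this
  · have : d - cfc f d = cfc (fun t : ℝ => t - f t) d := by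
      rw [cfc_sub (fun t : ℝ => t) f d, cfc_id' ℝ d]
    rw [this]
    refine norm_cfc_le (by linarith) fun t ht => ?_
    have := hge t ht
    rw [Real.norm_eq_abs, abs_le]
    simp only [f]
    rcases le_total (t - 2 * η) 0 with h0 | h0
    · rw [max_eq_right h0]; constructor <;> linarith
    · rw [max_eq_left h0]; constructor <;> linarith

lemma polar {e X : A} (he : IsProjection e) (hX : X * e = X) (h : ‖star X * X - e‖ ≤ 1 / 2) :
    ∃ T : A, star (X * T) * (X * T) = e ∧ X * T * e = X * T ∧
      ‖X * T - X‖ ≤ ‖X‖ * (2 * ‖star X * X - e‖) := by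
  set y := star X * X with hy
  have hye : y * e = y := by rw [hy, mul_assoc, hX]
  have hey : e * y = y := by
    have := congrArg star hye
    rw [star_mul, he.1.star_eq] at this
    rwa [(IsSelfAdjoint.star_mul_self X).star_eq] at this
  have hysa : IsSelfAdjoint y := IsSelfAdjoint.star_mul_self X
  set M := y + (1 - e) with hMdef
  have hMsa : IsSelfAdjoint M := hysa.add (isProj_compl he).1
  set δ := ‖y - e‖
  have hM1 : M - 1 = y - e := by rw [hMdef]; abel
  have hspec : ∀ t ∈ spectrum ℝ M, |t - 1| ≤ δ := by
    have hn : ‖M - 1‖ ≤ δ := le_of_eq (by rw [hM1])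
    have h1 : M ≤ algebraMap ℝ A (1 + δ) := by
      have := le_of_norm_sub_le hMsa (IsSelfAdjoint.one A) hn
      rwa [map_add, map_one]
    have h2 : algebraMap ℝ A (1 - δ) ≤ M := by
      have := le_of_norm_sub_le (IsSelfAdjoint.one A) hMsa (η := δ) (by rwa [norm_sub_rev] at hn)
      rw [map_sub, map_one]
      exact sub_le_iff_le_add.2 this
    intro t ht
    have h3 := (le_algebraMap_iff_spectrum_le hMsa).1 h1 t ht
    have h4 := (algebraMap_le_iff_le_spectrum hMsa).1 h2 t ht
    rw [abs_le]; constructor <;> linarith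
  let f : ℝ → ℝ := fun t => (Real.sqrt t)⁻¹
  have hpos : ∀ t ∈ spectrum ℝ M, 1 / 2 ≤ t := fun t ht => by
    have := (abs_le.1 (hspec t ht)).1; linarith
  have hfc : ContinuousOn f (spectrum ℝ M) := by
    refine ContinuousOn.inv₀ (Real.continuous_sqrt.continuousOn) fun t ht => ?_
    have := hpos t ht
    exact (Real.sqrt_pos.2 (by linarith)).ne'
  have hfm : cfc f M * M * cfc f M = 1 := by
    nth_rw 2 [← cfc_id' ℝ M]
    rw [← cfc_mul f (fun x => x) M hfc, ← cfc_mul (fun x => f x * x) f M (hfc.mul continuousOn_id) hfc, ← cfc_one ℝ M]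
    refine cfc_congr fun t ht => ?_
    have := hpos t ht
    have h0 : 0 < Real.sqrt t := Real.sqrt_pos.2 (by linarith)
    have hs := Real.mul_self_sqrt (show 0 ≤ t by linarith)
    simp only [f, Pi.one_apply]
    field_simp
    rw [sq]; linarith
  have hcomm : Commute (cfc f M) e := by
    refine Commute.cfc_real ?_ f
    show (y + (1 - e)) * e = e * (y + (1 - e))
    simp [add_mul, mul_add, sub_mul, mul_sub, hye, hey, he.2.eq]
  have hsa : star (cfc f M) = cfc f M := (cfc_predicate f M : IsSelfAdjoint _).star_eq
  have hMe : M * e = y := by simp [hMdef, add_mul, sub_mul, hye, he.2.eq]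
  refine ⟨cfc f M, ?_, ?_, ?_⟩
  · calc star (X * cfc f M) * (X * cfc f M) = cfc f M * (star X * X) * cfc f M := by
          rw [star_mul, hsa]; simp only [mul_assoc]
      _ = cfc f M * (M * e) * cfc f M := by rw [hMe]
      _ = cfc f M * M * cfc f M * e := by
          rw [mul_assoc _ _ e, hcomm.eq]; simp only [mul_assoc]
      _ = e := by rw [hfm, one_mul]
  · rw [mul_assoc, hcomm.eq, ← mul_assoc, hX]
  · have : X * cfc f M - X = X * (cfc f M - 1) := by rw [mul_sub, mul_one]
    rw [this]
    refine (norm_mul_le _ _).trans (mul_le_mul_of_nonneg_left ?_ (norm_nonneg _))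
    have h1 : cfc f M - 1 = cfc (fun t => f t - 1) M := by
      rw [cfc_sub f (fun _ => 1) M hfc, cfc_const_one ℝ M]
    rw [h1]
    refine norm_cfc_le (by positivity) fun t ht => ?_
    have ht0 := hpos t ht
    have ht1 := hspec t ht
    have h0 : 0 < Real.sqrt t := Real.sqrt_pos.2 (by linarith)
    have hs := Real.mul_self_sqrt (show 0 ≤ t by linarith)
    have e1 : f t - 1 = (1 - t) * ((Real.sqrt t) * (1 + Real.sqrt t))⁻¹ := by
      simp only [f]; field_simp; nlinarith [hs]
    rw [e1, norm_mul, norm_inv, Real.norm_eq_abs, Real.norm_eq_abs, abs_sub_comm,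
      abs_of_pos (by positivity : 0 < Real.sqrt t * (1 + Real.sqrt t)), mul_comm]
    refine mul_le_mul ?_ ht1 (abs_nonneg _) (by norm_num)
    rw [inv_le_comm₀ (by positivity) (by norm_num)]
    nlinarith

lemma isProj_mul_star {z e : A} (he : IsProjection e) (h : star z * z = e) (hz : z * e = z) :
    IsProjection (z * star z) := by
  refine ⟨IsSelfAdjoint.mul_star_self z, ?_⟩
  show z * star z * (z * star z) = z * star z
  calc z * star z * (z * star z) = z * (star z * z) * star z := by simp only [mul_assoc]
    _ = _ := by rw [h, hz]

lemma isProj_eq_zero {p : A} (hp : IsProjection p) (h : ‖p‖ < 1) : p = 0 := by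
  have h1 : ‖p‖ = ‖p‖ * ‖p‖ := by
    have := CStarRing.norm_star_mul_self (x := p)
    rwa [hp.1.star_eq, hp.2.eq] at this
  have h2 : ‖p‖ = 0 := by
    by_contra h0
    have : ‖p‖ = 1 := by
      have := mul_left_cancel₀ h0 (show ‖p‖ * ‖p‖ = ‖p‖ * 1 by rw [← h1, mul_one])
      exact this
    linarith
  exact norm_eq_zero.1 h2

lemma isProj_eq_of_le {p q : A} (hp : IsProjection p) (hq : IsProjection q) (h : q * p = p)
    (hn : ‖q - p‖ < 1) : p = q := by
  have h' : p * q = p := by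
    have := congrArg star h
    rwa [star_mul, hp.1.star_eq, hq.1.star_eq] at this
  have : IsProjection (q - p) := ⟨hq.1.sub hp.1, by
    show (q - p) * (q - p) = q - p
    simp [mul_sub, sub_mul, h, h', hq.2.eq, hp.2.eq]⟩
  exact (sub_eq_zero.1 (isProj_eq_zero this hn)).symm

lemma simple_sum (hA : IsSimpleCStar A) {c : A} (hc : c ≠ 0) :
    ∃ (n : ℕ) (x y : Fin n → A), 1 = ∑ i, x i * c * y i := by
  let S : AddSubgroup A :=
    { carrier := {s | ∃ (n : ℕ) (x y : Fin n → A), s = ∑ i, x i * c * y i}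
      zero_mem' := ⟨0, fun _ => 0, fun _ => 0, by simp⟩
      add_mem' := by
        rintro _ _ ⟨n, x, y, rfl⟩ ⟨m, x', y', rfl⟩
        refine ⟨n + m, Fin.append x x', Fin.append y y', ?_⟩
        rw [Fin.sum_univ_add]; simp
      neg_mem' := by
        rintro _ ⟨n, x, y, rfl⟩
        exact ⟨n, fun i => - x i, y, by simp⟩ }
  have hmulL : ∀ a s, s ∈ S → a * s ∈ S := by
    rintro a _ ⟨n, x, y, rfl⟩
    exact ⟨n, fun i => a * x i, y, by simp [Finset.mul_sum, mul_assoc]⟩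
  have hmulR : ∀ a s, s ∈ S → s * a ∈ S := by
    rintro a _ ⟨n, x, y, rfl⟩
    exact ⟨n, x, fun i => y i * a, by simp [Finset.sum_mul, mul_assoc]⟩
  let I : TwoSidedIdeal A := TwoSidedIdeal.mk' (S.topologicalClosure : Set A)
    (zero_mem _) (fun h1 h2 => add_mem h1 h2) (fun h => neg_mem h)
    (fun {a s} hs => map_mem_closure (continuous_const_mul a) hs (fun s hs => hmulL a s hs))
    (fun {s a} hs => map_mem_closure (f := fun t => t * a) (continuous_mul_const a) hs
      (fun s hs => hmulR a s hs))
  have hI : (I : Set A) = (S.topologicalClosure : Set A) := TwoSidedIdeal.coe_mk' ..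
  rcases hA I (by rw [hI]; exact S.isClosed_topologicalClosure) with h | h
  · exfalso
    apply hc
    have : c ∈ (I : Set A) := by
      rw [hI]
      exact S.le_topologicalClosure ⟨1, fun _ => 1, fun _ => 1, by simp⟩
    rw [h] at this; exact this
  · have h1 : (1 : A) ∈ closure (S : Set A) := by
      have : (1 : A) ∈ (I : Set A) := by rw [h]; trivial
      rw [hI] at this; exact this
    obtain ⟨s, hs, hd⟩ := Metric.mem_closure_iff.1 h1 1 one_pos
    rw [dist_eq_norm] at hd
    have hu : IsUnit s := by
      have := isUnit_one_sub_of_norm_lt_one hd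
      simpa using this
    obtain ⟨v, rfl⟩ := hu
    have := hmulR (↑v⁻¹) _ hs
    rw [Units.mul_inv] at this
    exact this

lemma simple_sum_pos (hA : IsSimpleCStar A) {g : A} (hg : 0 ≤ g) (hg0 : g ≠ 0) :
    ∃ (n : ℕ) (c : Fin n → A), 1 = ∑ i, star (c i) * g * c i := by
  obtain ⟨n, x, y, h⟩ := simple_sum hA hg0
  let d : Fin (n + n) → A := Fin.append (fun i => star (x i)) y
  have hgs := hg.isSelfAdjoint.star_eq
  have hZ : ∑ i, star (d i) * g * d i = ∑ i, (x i * g * star (x i) + star (y i) * g * y i) := by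
    rw [Fin.sum_univ_add, Finset.sum_add_distrib]
    simp only [d, Fin.append_left, Fin.append_right, star_star]
  have hle : ∀ i, x i * g * y i + star (x i * g * y i) ≤
      x i * g * star (x i) + star (y i) * g * y i := by
    intro i
    have := star_left_conjugate_nonneg hg (star (x i) - y i)
    rw [← sub_nonneg]
    refine this.trans (le_of_eq ?_)
    simp only [star_sub, star_star, star_mul, hgs, mul_sub, sub_mul, mul_assoc]
    abel
  have h1 : (1 : A) ≤ ∑ i, star (d i) * g * d i := by
    rw [hZ]
    have h2 : (1 : A) ≤ 1 + star 1 := by simp [zero_le_one]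
    refine h2.trans ?_
    conv_lhs => rw [h]
    rw [star_sum, ← Finset.sum_add_distrib]
    exact Finset.sum_le_sum fun i _ => hle i
  obtain ⟨S, hS, -, h2, -, -⟩ := exists_isqrt
    ((isStrictlyPositive_one (A := A)).of_le h1)
  refine ⟨n + n, fun i => d i * S, ?_⟩
  rw [← h2, Finset.mul_sum, Finset.sum_mul]
  refine Finset.sum_congr rfl fun i _ => ?_
  simp only [star_mul, hS.star_eq, mul_assoc]

lemma star_mul_self_ne_zero' {z : A} (hz : z ≠ 0) : star z * z ≠ 0 := by
  intro h; exact hz (CStarRing.star_mul_self_eq_zero_iff z |>.1 h)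

lemma exists_common_dom (hA : IsSimpleCStar A) [Nontrivial A] {κ : Type*} (s : Finset κ) (h : κ → A)
    (hh : ∀ i ∈ s, 0 ≤ h i ∧ h i ≠ 0) :
    ∃ g : A, 0 ≤ g ∧ g ≠ 0 ∧ ∀ i ∈ s, Dom g (h i) := by
  classical
  induction s using Finset.induction_on with
  | empty => exact ⟨1, zero_le_one, one_ne_zero, by simp⟩
  | insert a s ha ih =>
    obtain ⟨g, hg, hg0, hgd⟩ := ih fun i hi => hh i (Finset.mem_insert_of_mem hi)
    obtain ⟨h1, h2⟩ := hh a (Finset.mem_insert_self _ _)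
    have : ∃ y, h a * y * g ≠ 0 := by
      by_contra! hcon
      obtain ⟨n, x, y, hxy⟩ := simple_sum hA h2
      apply hg0
      rw [← one_mul g, hxy, Finset.sum_mul]
      refine Finset.sum_eq_zero fun i _ => ?_
      have := hcon (y i)
      rw [mul_assoc] at this
      rw [mul_assoc, mul_assoc, this, mul_zero]
    obtain ⟨y, hy⟩ := this
    refine ⟨star (h a * y * g) * (h a * y * g), star_mul_self_nonneg _,
      star_mul_self_ne_zero' hy, fun i hi => ?_⟩
    rcases Finset.mem_insert.1 hi with rfl | hi
    · have := (Dom.conj (h i * h i) (y * g)).trans (Dom.sq h1)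
      simpa [star_mul, h1.isSelfAdjoint.star_eq, mul_assoc] using this
    · refine Dom.trans ?_ (hgd i hi)
      have := Dom.sandwich hg (IsSelfAdjoint.star_mul_self (h a * y))
      simpa [star_mul, hg.isSelfAdjoint.star_eq, mul_assoc] using this

lemma exists_pos_test {g : A} (hg : 0 ≤ g) (hg0 : g ≠ 0) :
    ∃ b : A, IsPos b ∧ b ≠ 0 ∧ ∀ P, IsProjection P → CuntzLE P b → Dom P g := by
  have h3 := CFC.sqrt_mul_sqrt_self g
  have h4 := CFC.sqrt_nonneg g
  refine ⟨CFC.sqrt g, CStarAlgebra.nonneg_iff_eq_star_mul_self.1 h4, ?_, ?_⟩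
  · rintro h; apply hg0; rw [← h3, h, zero_mul]
  · intro P hP h
    have := h.dom hP h4.isSelfAdjoint
    rwa [h3] at this

lemma isPos_nonneg {a : A} (h : IsPos a) : 0 ≤ a := CStarAlgebra.nonneg_iff_eq_star_mul_self.2 h

lemma isPos_of_nonneg {a : A} (h : 0 ≤ a) : IsPos a := CStarAlgebra.nonneg_iff_eq_star_mul_self.1 h

lemma cube_nonneg {g : A} (hg : 0 ≤ g) : 0 ≤ g * g * g := by
  have := star_left_conjugate_nonneg hg g
  rwa [hg.isSelfAdjoint.star_eq] at this

lemma sq_ne_zero' {g : A} (hg : IsSelfAdjoint g) (h0 : g ≠ 0) : g * g ≠ 0 := by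
  have := star_mul_self_ne_zero' h0
  rwa [hg.star_eq] at this

lemma cube_ne_zero {g : A} (hg : 0 ≤ g) (h0 : g ≠ 0) : g * g * g ≠ 0 := by
  intro h
  apply sq_ne_zero' (g := g * g) _ (sq_ne_zero' hg.isSelfAdjoint h0)
  · rw [← mul_assoc, h, zero_mul]
  · nth_rw 1 [← hg.isSelfAdjoint.star_eq]; exact IsSelfAdjoint.star_mul_self g

end domsec2


section tower
variable {A : Type*} [CStarAlgebra A]

lemma tower_nat {α : A ≃⋆ₐ[ℂ] A} (hα : TracialRokhlin α) (F : Finset A) {ε : ℝ} (hε : 0 < ε)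
    (n : ℕ) {x : A} (hx : IsPos x) (hx0 : x ≠ 0) :
    ∃ e : ℕ → A, (∀ j, IsProjection (e j)) ∧ (∀ i j, i ≠ j → e i * e j = 0) ∧
      (∀ j, j < n → ‖α (e j) - e (j + 1)‖ < ε) ∧
      (∀ j, ∀ a ∈ F, ‖e j * a - a * e j‖ < ε) ∧
      CuntzLE (1 - ∑ j ∈ Finset.range (n + 1), e j) x := by
  obtain ⟨e, h1, h2, h3, h4, h5⟩ := hα F ε hε n x hx hx0
  have hp0 : IsProjection (0 : A) := ⟨IsSelfAdjoint.zero A, by simp [IsIdempotentElem]⟩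
  refine ⟨fun j => if h : j < n + 1 then e ⟨j, h⟩ else 0, ?_, ?_, ?_, ?_, ?_⟩
  · intro j; by_cases h : j < n + 1
    · simp only [h, dite_true]; exact h1 _
    · simp only [h, dite_false]; exact hp0
  · intro i j hij
    by_cases h : j < n + 1 <;> by_cases h' : i < n + 1 <;> simp only [h, h', dite_true, dite_false, mul_zero, zero_mul]
    exact h2 _ _ (by simpa using hij)
  · intro j hj
    have ha : j < n + 1 := by omega
    have hb : j + 1 < n + 1 := by omega
    simp only [ha, hb, dite_true]
    have := h3 ⟨j, ha⟩ hj
    have he : (⟨j, ha⟩ + 1 : Fin (n + 1)) = ⟨j + 1, hb⟩ := by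
      apply Fin.ext
      rw [Fin.val_add_one_of_lt]
      simp [Fin.lt_def]; exact hj
    rwa [he] at this
  · intro j a ha; by_cases h : j < n + 1
    · simp only [h, dite_true]; exact h4 _ a ha
    · simp only [h, dite_false]; simpa using hε
  · rw [Finset.sum_range]
    have : ∀ i : Fin (n + 1), (if h : (i : ℕ) < n + 1 then e ⟨i, h⟩ else 0) = e i := fun i => by
      simp only [i.2, dite_true]
    simpa only [this] using h5

lemma iter_isometry (α : A ≃⋆ₐ[ℂ] A) (a b : A) : ‖α a - α b‖ = ‖a - b‖ := by
  rw [← map_sub]; exact (StarAlgEquiv.norm_map α _)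

lemma tower_iter {α : A ≃⋆ₐ[ℂ] A} {e : ℕ → A} {n : ℕ} {ε : ℝ}
    (h3 : ∀ j, j < n → ‖α (e j) - e (j + 1)‖ < ε) (k j : ℕ) (hjk : j + k ≤ n) :
    ‖α^[k] (e j) - e (j + k)‖ ≤ k * ε := by
  induction k with
  | zero => simp
  | succ k ih =>
    rw [Function.iterate_succ_apply']
    have h1 := ih (by omega)
    have h2 := h3 (j + k) (by omega)
    have : α (α^[k] (e j)) - e (j + (k + 1)) =
      (α (α^[k] (e j)) - α (e (j + k))) + (α (e (j + k)) - e (j + k + 1)) := by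
        rw [add_assoc]; abel
    rw [this]
    refine (norm_add_le _ _).trans ?_
    rw [iter_isometry]
    push_cast; linarith

lemma tower_nonzero {α : A ≃⋆ₐ[ℂ] A} {x0 : A} (hx0 : ¬ CuntzLE 1 x0) {e : ℕ → A} {n : ℕ} {ε : ℝ}
    (hε : ε ≤ 1)
    (h1 : ∀ j, IsProjection (e j)) (h3 : ∀ j, j < n → ‖α (e j) - e (j + 1)‖ < ε)
    (h5 : CuntzLE (1 - ∑ j ∈ Finset.range (n + 1), e j) x0) (j : ℕ) (hj : j ≤ n) : e j ≠ 0 := by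
  let _ := CStarAlgebra.spectralOrder A
  let _ := CStarAlgebra.spectralOrderedRing A
  have hstep : ∀ i, i < n → (e i = 0 ↔ e (i + 1) = 0) := by
    intro i hi
    have := h3 i hi
    constructor
    · intro h; rw [h, map_zero, zero_sub, norm_neg] at this
      exact isProj_eq_zero (h1 _) (this.trans_le hε)
    · intro h; rw [h, sub_zero, StarAlgEquiv.norm_map] at this
      exact isProj_eq_zero (h1 _) (this.trans_le hε)
  have hall : ∀ i, i ≤ n → (e i = 0 ↔ e 0 = 0) := by
    intro i
    induction i with
    | zero => simp
    | succ i ih => intro hi; rw [← hstep i (by omega)]; exact ih (by omega)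
  intro h
  have h0 := (hall j hj).1 h
  apply hx0
  have : ∑ j ∈ Finset.range (n + 1), e j = 0 :=
    Finset.sum_eq_zero fun i hi => (hall i (by simpa [Nat.lt_succ_iff] using hi)).2 h0
  rwa [this, sub_zero] at h5

lemma isProj_norm_one {p : A} (hp : IsProjection p) (h : p ≠ 0) : ‖p‖ = 1 := by
  let _ := CStarAlgebra.spectralOrder A
  let _ := CStarAlgebra.spectralOrderedRing A
  refine le_antisymm (isProj_norm_le hp) ?_
  by_contra hc; exact h (isProj_eq_zero hp (not_le.1 hc))

end tower

section cross
variable {A C : Type*} [CStarAlgebra A] [CStarAlgebra C]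

/-- integer powers of the implementing unitary -/
noncomputable def uz {u : C} (hu : u ∈ unitary C) (k : ℤ) : C := ((⟨u, hu⟩ : unitary C) ^ k : unitary C)

lemma uz_add {u : C} (hu : u ∈ unitary C) (k l : ℤ) : uz hu (k + l) = uz hu k * uz hu l := by
  simp [uz, zpow_add]

lemma uz_star {u : C} (hu : u ∈ unitary C) (k : ℤ) : star (uz hu k) = uz hu (-k) := by
  unfold uz
  rw [zpow_neg, ← Unitary.star_eq_inv, Unitary.coe_star]

lemma uz_zero {u : C} (hu : u ∈ unitary C) : uz hu 0 = 1 := by simp [uz]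
lemma uz_one {u : C} (hu : u ∈ unitary C) : uz hu 1 = u := by simp [uz]
lemma uz_nat {u : C} (hu : u ∈ unitary C) (k : ℕ) : uz hu k = u ^ k := by simp [uz]
lemma uz_mem {u : C} (hu : u ∈ unitary C) (k : ℤ) : uz hu k ∈ unitary C := by
  unfold uz; exact Subtype.property _

lemma uz_cov {α : A ≃⋆ₐ[ℂ] A} {ι : A →⋆ₐ[ℂ] C} {u : C} (hu : u ∈ unitary C)
    (hcov : ∀ a : A, u * ι a * star u = ι (α a)) (k : ℕ) (a : A) :
    uz hu k * ι a = ι (α^[k] a) * uz hu k := by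
  induction k generalizing a with
  | zero => simp [uz_zero]
  | succ k ih =>
    have h1 : u * ι a = ι (α a) * u := by
      rw [← hcov, mul_assoc, Unitary.star_mul_self_of_mem hu, mul_one]
    push_cast
    rw [uz_add, uz_one, mul_assoc, h1, ← mul_assoc, ih, Function.iterate_succ_apply, mul_assoc]

lemma uz_cov_neg {α : A ≃⋆ₐ[ℂ] A} {ι : A →⋆ₐ[ℂ] C} {u : C} (hu : u ∈ unitary C)
    (hcov : ∀ a : A, u * ι a * star u = ι (α a)) (k : ℕ) (a : A) :
    uz hu (-k) * ι a = ι (α.symm^[k] a) * uz hu (-k) := by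
  have h1 := uz_cov hu hcov k (α.symm^[k] a)
  have h2 : α^[k] (α.symm^[k] a) = a :=
    (Function.LeftInverse.iterate (g := α) (f := α.symm) (fun x => α.apply_symm_apply x) k) a
  rw [h2] at h1
  have e1 : uz hu (-k) * uz hu k = 1 := by rw [← uz_add]; simp [uz_zero]
  have e2 : uz hu k * uz hu (-k) = 1 := by rw [← uz_add]; simp [uz_zero]
  calc uz hu (-k) * ι a = uz hu (-k) * (ι a * uz hu k) * uz hu (-k) := by
        rw [mul_assoc, mul_assoc, e2, mul_one]
    _ = _ := by rw [← h1, ← mul_assoc, e1, one_mul]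

lemma uz_cov_ex {α : A ≃⋆ₐ[ℂ] A} {ι : A →⋆ₐ[ℂ] C} {u : C} (hu : u ∈ unitary C)
    (hcov : ∀ a : A, u * ι a * star u = ι (α a)) (k : ℤ) (a : A) :
    ∃ a', uz hu k * ι a = ι a' * uz hu k := by
  obtain ⟨n, rfl | rfl⟩ := k.eq_nat_or_neg
  · exact ⟨_, uz_cov hu hcov n a⟩
  · exact ⟨_, uz_cov_neg hu hcov n a⟩

lemma cross_induction {α : A ≃⋆ₐ[ℂ] A} {ι : A →⋆ₐ[ℂ] C} {u : C} (hu : u ∈ unitary C)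
    (hcov : ∀ a : A, u * ι a * star u = ι (α a))
    (hgen : (StarAlgebra.adjoin ℂ (Set.range ι ∪ {u})).topologicalClosure = ⊤)
    (P : C → Prop) (hmono : ∀ a k, P (ι a * uz hu k)) (hadd : ∀ b c, P b → P c → P (b + c))
    (hlim : ∀ c, (∀ η : ℝ, 0 < η → ∃ c', ‖c - c'‖ < η ∧ P c') → P c) (c : C) : P c := by
  let S : Set C := {x | ∃ a, ∃ k : ℤ, x = ι a * uz hu k}
  let M : AddSubmonoid C := AddSubmonoid.closure S
  have hmul1 : ∀ x ∈ S, ∀ y ∈ S, x * y ∈ S := by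
    rintro _ ⟨a, k, rfl⟩ _ ⟨b, l, rfl⟩
    obtain ⟨b', hb'⟩ := uz_cov_ex hu hcov k b
    refine ⟨a * b', k + l, ?_⟩
    rw [map_mul, uz_add, mul_assoc, ← mul_assoc (uz hu k), hb']
    simp only [mul_assoc]
  have hstar1 : ∀ x ∈ S, star x ∈ S := by
    rintro _ ⟨a, k, rfl⟩
    obtain ⟨b', hb'⟩ := uz_cov_ex hu hcov (-k) (star a)
    exact ⟨b', -k, by rw [star_mul, uz_star, ← map_star, hb']⟩
  have hmul : ∀ x ∈ M, ∀ y ∈ M, x * y ∈ M := by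
    intro x hx y hy
    induction hx using AddSubmonoid.closure_induction with
    | mem x hx =>
      induction hy using AddSubmonoid.closure_induction with
      | mem y hy => exact AddSubmonoid.subset_closure (hmul1 x hx y hy)
      | zero => simp
      | add y z _ _ h1 h2 => rw [mul_add]; exact add_mem h1 h2
    | zero => simp
    | add y z _ _ h1 h2 => rw [add_mul]; exact add_mem h1 h2
  have hstar : ∀ x ∈ M, star x ∈ M := by
    intro x hx
    induction hx using AddSubmonoid.closure_induction with
    | mem x hx => exact AddSubmonoid.subset_closure (hstar1 x hx)
    | zero => simp
    | add y z _ _ h1 h2 => rw [star_add]; exact add_mem h1 h2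
  let T : StarSubalgebra ℂ C :=
    { carrier := M
      mul_mem' := fun {a b} ha hb => hmul a ha b hb
      add_mem' := fun ha hb => add_mem ha hb
      algebraMap_mem' := fun r => AddSubmonoid.subset_closure
        ⟨algebraMap ℂ A r, 0, by rw [uz_zero, mul_one]; exact (AlgHomClass.commutes ι r).symm⟩
      star_mem' := fun {a} ha => hstar a ha }
  have hT : StarAlgebra.adjoin ℂ (Set.range ι ∪ {u}) ≤ T := by
    rw [StarAlgebra.adjoin_le_iff]
    rintro x (⟨a, rfl⟩ | hx)
    · exact AddSubmonoid.subset_closure ⟨a, 0, by rw [uz_zero, mul_one]⟩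
    · rw [Set.mem_singleton_iff] at hx
      exact AddSubmonoid.subset_closure ⟨1, 1, by rw [uz_one, map_one, one_mul, hx]⟩
  have hM : ∀ x ∈ M, P x := by
    intro x hx
    induction hx using AddSubmonoid.closure_induction with
    | mem x hx => obtain ⟨a, k, rfl⟩ := hx; exact hmono a k
    | zero => have := hmono 0 0; simpa using this
    | add y z _ _ h1 h2 => exact hadd _ _ h1 h2
  have hc : c ∈ closure (StarAlgebra.adjoin ℂ (Set.range ι ∪ {u}) : Set C) := by
    rw [← StarSubalgebra.topologicalClosure_coe, hgen]; trivial
  refine hlim c fun η hη => ?_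
  obtain ⟨c', hc', hd⟩ := Metric.mem_closure_iff.1 hc η hη
  exact ⟨c', by rwa [dist_eq_norm] at hd, hM c' (hT hc')⟩

end cross


section rokseq
variable {A : Type*} [CStarAlgebra A]

lemma iter_map_star (α : A ≃⋆ₐ[ℂ] A) (k : ℕ) (a : A) : α^[k] (star a) = star (α^[k] a) := by
  induction k generalizing a with
  | zero => rfl
  | succ k ih => rw [Function.iterate_succ_apply, Function.iterate_succ_apply, map_star, ih]

lemma rok_seq [TopologicalSpace.SeparableSpace A] {α : A ≃⋆ₐ[ℂ] A} (hα : TracialRokhlin α)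
    {x0 : A} (hx : IsPos x0) (hx0 : x0 ≠ 0) (hn : ¬ CuntzLE 1 x0) :
    ∃ e : ℕ → A, (∀ i, IsProjection (e i)) ∧ (∀ i, e i ≠ 0) ∧
      (∀ a, Tendsto (fun i => ‖e i * a - a * e i‖) atTop (𝓝 0)) ∧
      (∀ k : ℕ, 1 ≤ k → Tendsto (fun i => ‖α^[k] (e i) * e i‖) atTop (𝓝 0)) := by
  classical
  let _ := CStarAlgebra.spectralOrder A
  let _ := CStarAlgebra.spectralOrderedRing A
  let d := TopologicalSpace.denseSeq A
  have hpos : ∀ i : ℕ, (0 : ℝ) < 1 / ((i : ℝ) + 1) := fun i => by positivity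
  choose e h1 h2 h3 h4 h5 using fun i : ℕ =>
    tower_nat hα ((Finset.range (i + 1)).image d) (hpos i) i hx hx0
  have hle1 : ∀ i : ℕ, (1 : ℝ) / ((i : ℝ) + 1) ≤ 1 := fun i => by
    rw [div_le_one (by positivity)]; linarith [(Nat.cast_nonneg i : (0:ℝ) ≤ i)]
  refine ⟨fun i => e i 0, fun i => h1 i 0,
    fun i => tower_nonzero hn (hle1 i) (h1 i) (h3 i) (h5 i) 0 (Nat.zero_le _), ?_, ?_⟩
  · intro a
    rw [Metric.tendsto_atTop]
    intro η hη
    obtain ⟨m, hm⟩ := (TopologicalSpace.denseRange_denseSeq A).exists_dist_lt a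
      (show 0 < η / 4 by positivity)
    obtain ⟨N, hN⟩ := exists_nat_one_div_lt (show 0 < η / 4 by positivity)
    refine ⟨max m N, fun i hi => ?_⟩
    have hmi : m ≤ i := (le_max_left _ _).trans hi
    have hNi : N ≤ i := (le_max_right _ _).trans hi
    have hd := h4 i 0 (d m) (Finset.mem_image_of_mem d (by simpa using Nat.lt_succ_of_le hmi))
    have hε : (1 : ℝ) / (i + 1) < η / 4 := lt_of_le_of_lt (by
      apply one_div_le_one_div_of_le (by positivity); gcongr) hN
    rw [dist_eq_norm] at hm
    have hp := isProj_norm_le (h1 i 0)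
    rw [dist_zero_right, norm_norm]
    have : e i 0 * a - a * e i 0 = e i 0 * (a - d m) + (e i 0 * d m - d m * e i 0)
      - (a - d m) * e i 0 := by noncomm_ring
    rw [this]
    have b1 : ‖e i 0 * (a - d m)‖ ≤ η / 4 := (norm_mul_le _ _).trans (by
      nlinarith [norm_nonneg (a - d m), norm_nonneg (e i 0)])
    have b2 : ‖(a - d m) * e i 0‖ ≤ η / 4 := (norm_mul_le _ _).trans (by
      nlinarith [norm_nonneg (a - d m), norm_nonneg (e i 0)])
    calc _ ≤ ‖e i 0 * (a - d m)‖ + ‖e i 0 * d m - d m * e i 0‖ + ‖(a - d m) * e i 0‖ :=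
          (norm_sub_le _ _).trans (add_le_add (norm_add_le _ _) le_rfl)
      _ < η := by linarith
  · intro k hk
    have hlim : Tendsto (fun i : ℕ => (k : ℝ) * (1 / ((i : ℝ) + 1))) atTop (𝓝 0) := by
      simpa using (tendsto_one_div_add_atTop_nhds_zero_nat (𝕜 := ℝ)).const_mul (k : ℝ)
    refine tendsto_of_tendsto_of_tendsto_of_le_of_le' tendsto_const_nhds hlim
      (Eventually.of_forall fun i => norm_nonneg _) ?_
    filter_upwards [eventually_ge_atTop k] with i hi
    have h6 := tower_iter (h3 i) k 0 (by omega)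
    rw [Nat.zero_add] at h6
    have : α^[k] (e i 0) * e i 0 = (α^[k] (e i 0) - e i k) * e i 0 := by
      rw [sub_mul, h2 i k 0 (by omega), sub_zero]
    rw [this]
    refine (norm_mul_le _ _).trans ?_
    have hp := isProj_norm_le (h1 i 0)
    nlinarith [norm_nonneg (α^[k] (e i 0) - e i k)]

end rokseq

section step1
variable {A C : Type*} [CStarAlgebra A] [CStarAlgebra C]

lemma proj_map {ι : A →⋆ₐ[ℂ] C} {p : A} (hp : IsProjection p) : IsProjection (ι p) :=
  ⟨hp.1.map ι, hp.2.map ι⟩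

lemma uz_offdiag {α : A ≃⋆ₐ[ℂ] A} {ι : A →⋆ₐ[ℂ] C} (hι : Isometry ι) {u : C} (hu : u ∈ unitary C)
    (hcov : ∀ a : A, u * ι a * star u = ι (α a)) {e : ℕ → A} (he : ∀ i, IsProjection (e i))
    (hek : ∀ k : ℕ, 1 ≤ k → Tendsto (fun i => ‖α^[k] (e i) * e i‖) atTop (𝓝 0)) {k : ℤ} (hk : k ≠ 0) :
    Tendsto (fun i => ‖ι (e i) * uz hu k * ι (e i)‖) atTop (𝓝 0) := by
  have hnat : ∀ n : ℕ, 1 ≤ n → Tendsto (fun i => ‖ι (e i) * uz hu n * ι (e i)‖) atTop (𝓝 0) := by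
    intro n hn
    refine (hek n hn).congr fun i => ?_
    rw [mul_assoc, uz_cov hu hcov, ← mul_assoc, CStarRing.norm_mul_mem_unitary _ (uz_mem hu _),
      ← map_mul, hι.norm_map_of_map_zero (map_zero ι), ← norm_star (e i * _), star_mul,
      (he i).1.star_eq, ← iter_map_star, (he i).1.star_eq]
  obtain ⟨n, rfl | rfl⟩ := k.eq_nat_or_neg
  · exact hnat n (by omega)
  · refine (hnat n (by omega)).congr fun i => ?_
    rw [← norm_star, star_mul, star_mul, uz_star, ((he i).1.map ι).star_eq, mul_assoc]

lemma compress {α : A ≃⋆ₐ[ℂ] A} {ι : A →⋆ₐ[ℂ] C} (hι : Isometry ι) {u : C} (hu : u ∈ unitary C)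
    (hcov : ∀ a : A, u * ι a * star u = ι (α a))
    (hgen : (StarAlgebra.adjoin ℂ (Set.range ι ∪ {u})).topologicalClosure = ⊤)
    {e : ℕ → A} (he : ∀ i, IsProjection (e i))
    (hec : ∀ a, Tendsto (fun i => ‖e i * a - a * e i‖) atTop (𝓝 0))
    (hek : ∀ k : ℕ, 1 ≤ k → Tendsto (fun i => ‖α^[k] (e i) * e i‖) atTop (𝓝 0)) (b : C) :
    ∀ η : ℝ, 0 < η → ∀ᶠ i in atTop, ∃ a : A, ‖ι (e i) * b * ι (e i) - ι a‖ < η := by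
  let _ := CStarAlgebra.spectralOrder C
  let _ := CStarAlgebra.spectralOrderedRing C
  refine cross_induction hu hcov hgen
    (fun b => ∀ η : ℝ, 0 < η → ∀ᶠ i in atTop, ∃ a : A, ‖ι (e i) * b * ι (e i) - ι a‖ < η) ?_ ?_ ?_ b
  · intro a k η hη
    by_cases hk : k = 0
    · subst hk
      refine Eventually.of_forall fun i => ⟨e i * a * e i, ?_⟩
      simpa [uz_zero] using hη
    · have h1 := (hec a).add ((uz_offdiag hι hu hcov he hek hk).const_mul ‖a‖)
      rw [mul_zero, add_zero] at h1
      filter_upwards [h1.eventually (gt_mem_nhds hη)] with i hi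
      refine ⟨0, lt_of_le_of_lt ?_ hi⟩
      rw [map_zero, sub_zero]
      have : ι (e i) * (ι a * uz hu k) * ι (e i) = ι (e i * a - a * e i) * uz hu k * ι (e i)
        + ι a * (ι (e i) * uz hu k * ι (e i)) := by
        simp only [map_sub, map_mul]; noncomm_ring
      rw [this]
      refine (norm_add_le _ _).trans (add_le_add ?_ ?_)
      · refine (norm_mul_le _ _).trans ?_
        rw [CStarRing.norm_mul_mem_unitary _ (uz_mem hu _), hι.norm_map_of_map_zero (map_zero ι)]
        have := isProj_norm_le (proj_map (ι := ι) (he i))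
        nlinarith [norm_nonneg (e i * a - a * e i)]
      · refine (norm_mul_le _ _).trans ?_
        rw [hι.norm_map_of_map_zero (map_zero ι)]
  · intro b c hb hc η hη
    filter_upwards [hb (η / 2) (by positivity), hc (η / 2) (by positivity)] with i ⟨a, ha⟩ ⟨a', ha'⟩
    refine ⟨a + a', ?_⟩
    have : ι (e i) * (b + c) * ι (e i) - ι (a + a') = (ι (e i) * b * ι (e i) - ι a) +
      (ι (e i) * c * ι (e i) - ι a') := by rw [map_add]; noncomm_ring
    rw [this]
    exact (norm_add_le _ _).trans_lt (by linarith)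
  · intro c hc η hη
    obtain ⟨c', h1, h2⟩ := hc (η / 2) (by positivity)
    filter_upwards [h2 (η / 2) (by positivity)] with i ⟨a, ha⟩
    refine ⟨a, ?_⟩
    have : ι (e i) * c * ι (e i) - ι a = ι (e i) * (c - c') * ι (e i) +
      (ι (e i) * c' * ι (e i) - ι a) := by noncomm_ring
    rw [this]
    refine (norm_add_le _ _).trans_lt ?_
    have hp := isProj_norm_le (proj_map (ι := ι) (he i))
    have h3 : ‖ι (e i) * (c - c') * ι (e i)‖ ≤ ‖c - c'‖ := by
      refine (norm_mul_le _ _).trans ?_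
      have h4 := norm_mul_le (ι (e i)) (c - c')
      nlinarith [norm_nonneg (c - c'), norm_nonneg (ι (e i)), norm_nonneg (ι (e i) * (c - c'))]
    linarith

/-- if `1 = ∑ x i * c * y i`, any norm-one element is seen by some `c * y i`. -/
lemma exists_big {n : ℕ} {x y : Fin n → C} {c : C} (h : 1 = ∑ i, x i * c * y i) {t : C}
    (ht : ‖t‖ = 1) : ∃ i, 1 / (1 + ∑ i, ‖x i‖) ≤ ‖c * y i * t‖ := by
  by_contra! hcon
  have hS : 0 ≤ ∑ i, ‖x i‖ := Finset.sum_nonneg fun i _ => norm_nonneg _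
  have h1 : ‖t‖ ≤ ∑ i, ‖x i‖ * (1 / (1 + ∑ i, ‖x i‖)) := by
    calc ‖t‖ = ‖∑ i, x i * (c * y i * t)‖ := by
          conv_lhs => rw [← one_mul t, h, Finset.sum_mul]
          simp only [mul_assoc]
      _ ≤ ∑ i, ‖x i * (c * y i * t)‖ := norm_sum_le _ _
      _ ≤ _ := Finset.sum_le_sum fun i _ => (norm_mul_le _ _).trans
          (mul_le_mul_of_nonneg_left (hcon i).le (norm_nonneg _))
  rw [← Finset.sum_mul, ht, mul_one_div, le_div_iff₀ (by positivity)] at h1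
  linarith

lemma step1 [TopologicalSpace.SeparableSpace A] [PartialOrder A] [StarOrderedRing A]
    [PartialOrder C] [StarOrderedRing C]
    {α : A ≃⋆ₐ[ℂ] A} (hα : TracialRokhlin α)
    {x0 : A} (hx : IsPos x0) (hx0 : x0 ≠ 0) (hn : ¬ CuntzLE 1 x0)
    {ι : A →⋆ₐ[ℂ] C} (hι : Isometry ι) {u : C} (hu : u ∈ unitary C)
    (hcov : ∀ a : A, u * ι a * star u = ι (α a))
    (hgen : (StarAlgebra.adjoin ℂ (Set.range ι ∪ {u})).topologicalClosure = ⊤)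
    (hC : IsSimpleCStar C) {a : C} (ha : 0 ≤ a) (ha0 : a ≠ 0) :
    ∃ g : A, 0 ≤ g ∧ g ≠ 0 ∧ Dom (ι g) a := by
  obtain ⟨e, he, hene, hec, hek⟩ := rok_seq hα hx hx0 hn
  obtain ⟨c, hc⟩ := CStarAlgebra.nonneg_iff_eq_star_mul_self.1 ha
  have hc0 : c ≠ 0 := by rintro rfl; simp at hc; exact ha0 hc
  obtain ⟨n, x, y, hxy⟩ := simple_sum hC hc0
  set δ : ℝ := 1 / (1 + ∑ i, ‖x i‖) with hδ
  have hδ0 : 0 < δ := by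
    have hS : 0 ≤ ∑ i, ‖x i‖ := Finset.sum_nonneg fun i _ => norm_nonneg _
    positivity
  have hev : ∀ᶠ m in atTop, ∀ i, ∃ a' : A,
      ‖ι (e m) * (star (y i) * a * y i) * ι (e m) - ι a'‖ < δ ^ 2 / 8 :=
    eventually_all.2 fun i => compress hι hu hcov hgen he hec hek _ _ (by positivity)
  obtain ⟨m, hm⟩ := hev.exists
  have hpm := proj_map (ι := ι) (he m)
  obtain ⟨i, hi⟩ := exists_big hxy (t := ι (e m)) (by
    rw [hι.norm_map_of_map_zero (map_zero ι)]; exact isProj_norm_one (he m) (hene m))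
  obtain ⟨a', ha'⟩ := hm i
  set b := ι (e m) * (star (y i) * a * y i) * ι (e m) with hb
  have hbeq : b = star (c * y i * ι (e m)) * (c * y i * ι (e m)) := by
    rw [hb, hc]; simp only [star_mul, hpm.1.star_eq, mul_assoc]
  have hb0 : 0 ≤ b := by rw [hbeq]; exact star_mul_self_nonneg _
  have hbn : δ ^ 2 ≤ ‖b‖ := by
    rw [hbeq, CStarRing.norm_star_mul_self, sq]
    exact mul_le_mul hi hi hδ0.le (norm_nonneg _)
  -- self-adjoint part
  let d : A := (1 / 2 : ℝ) • (a' + star a')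
  have hd : IsSelfAdjoint d := by
    rw [IsSelfAdjoint]; simp only [d, star_smul, star_add, star_star, star_trivial]; rw [add_comm]
  have hdn : ‖ι d - b‖ ≤ δ ^ 2 / 8 := by
    have e1 : ι d - b = (1 / 2 : ℝ) • ((ι a' - b) + star (ι a' - b)) := by
      have : ι d = (1 / 2 : ℝ) • (ι a' + star (ι a')) := by
        simp only [d]
        rw [← map_star, ← map_add]
        exact map_real_smul ι hι.continuous _ _
      rw [this, star_sub, hb0.isSelfAdjoint.star_eq]
      have : b = (1 / 2 : ℝ) • (b + b) := by rw [← two_smul ℝ, smul_smul]; norm_num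
      nth_rw 1 [this]
      rw [← smul_sub]; congr 1; abel
    rw [e1, norm_smul]
    have : ‖(ι a' - b) + star (ι a' - b)‖ ≤ 2 * ‖ι a' - b‖ := by
      refine (norm_add_le _ _).trans ?_; rw [norm_star]; linarith
    rw [norm_sub_rev] at ha'
    rw [Real.norm_of_nonneg (by norm_num)]
    linarith
  have hidsa : IsSelfAdjoint (ι d) := hd.map ι
  obtain ⟨k, hkdef, hk0, hkdom, hkn, -⟩ := ror hb0 hidsa (show 0 < δ ^ 2 / 8 by positivity) hdn
  let f : ℝ → ℝ := fun t => max (t - 2 * (δ ^ 2 / 8)) 0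
  have hf : Continuous f := by fun_prop
  have hmap : ι (cfc f d) = k := by
    rw [hkdef]
    exact StarAlgHomClass.map_cfc ι f d hf.continuousOn hι.continuous hd hidsa
  have hg0 : 0 ≤ cfc f d := cfc_nonneg fun x _ => le_max_right _ _
  refine ⟨cfc f d * cfc f d, ?_, ?_, ?_⟩
  · have := star_mul_self_nonneg (cfc f d)
    rwa [hg0.isSelfAdjoint.star_eq] at this
  · apply sq_ne_zero' hg0.isSelfAdjoint
    intro h
    rw [h, map_zero] at hmap
    rw [← hmap, sub_zero] at hkn
    have := norm_sub_norm_le b (ι d)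
    rw [norm_sub_rev] at this
    nlinarith [sq_pos_of_pos hδ0]
  · rw [map_mul, hmap]
    refine hkdom.trans ?_
    have := Dom.conj a (y i * ι (e m))
    rw [hb]
    simpa [star_mul, hpm.1.star_eq, mul_assoc] using this

lemma split_pos [PartialOrder A] [StarOrderedRing A]
    {α : A ≃⋆ₐ[ℂ] A} (hα : TracialRokhlin α) (hA : IsSimpleCStar A)
    {x0 : A} (hx : IsPos x0) (hx0 : x0 ≠ 0) (hn : ¬ CuntzLE 1 x0)
    {g : A} (hg : 0 ≤ g) (hg0 : g ≠ 0) (K : ℕ) :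
    ∃ G : ℕ → A, (∀ j < K, 0 ≤ G j ∧ G j ≠ 0) ∧
      (∀ i < K, ∀ j < K, i ≠ j → G i * G j = 0) ∧ Dom (∑ j ∈ Finset.range K, G j) g := by
  classical
  obtain ⟨c, hc⟩ := CStarAlgebra.nonneg_iff_eq_star_mul_self.1 hg
  have hc0 : c ≠ 0 := by rintro rfl; simp at hc; exact hg0 hc
  obtain ⟨n, x, y, hxy⟩ := simple_sum hA hc0
  set δ : ℝ := 1 / (1 + ∑ i, ‖x i‖) with hδ
  have hδ0 : 0 < δ := by
    have hS : 0 ≤ ∑ i, ‖x i‖ := Finset.sum_nonneg fun i _ => norm_nonneg _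
    positivity
  set Y : ℝ := 1 + ∑ i, ‖y i‖ with hYdef
  have hYs : ∀ i, ‖y i‖ ≤ Y := fun i => by
    have := Finset.single_le_sum (f := fun i => ‖y i‖) (fun i _ => norm_nonneg _) (Finset.mem_univ i)
    linarith
  have hY1 : 1 ≤ Y := by
    have hS : 0 ≤ ∑ i, ‖y i‖ := Finset.sum_nonneg fun i _ => norm_nonneg _
    linarith
  -- lower bound
  set β : ℝ := δ / (2 * Y) with hβ
  have hβ0 : 0 < β := by positivity
  set η : ℝ := β ^ 2 / 8 with hη
  have hη0 : 0 < η := by positivity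
  set ε : ℝ := min 1 (min (δ / (2 * (1 + ‖c‖))) (η / (K ^ 2 + 1))) with hε
  have hε0 : 0 < ε := by positivity
  obtain ⟨e, h1, h2, h3, h4, h5⟩ := tower_nat hα (insert g (Finset.univ.image y)) hε0 K hx hx0
  have hne : ∀ j < K, e j ≠ 0 := fun j hj =>
    tower_nonzero hn (min_le_left _ _) h1 h3 h5 j hj.le
  have hbig : ∀ j < K, β ≤ ‖c * e j‖ := by
    intro j hj
    obtain ⟨i, hi⟩ := exists_big hxy (isProj_norm_one (h1 j) (hne j hj))
    have e1 : c * y i * e j = c * e j * y i - c * (e j * y i - y i * e j) := by noncomm_ring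
    rw [e1] at hi
    have e2 := h4 j (y i) (Finset.mem_insert_of_mem (Finset.mem_image_of_mem _ (Finset.mem_univ i)))
    have e3 : ‖c * e j * y i - c * (e j * y i - y i * e j)‖ ≤ ‖c * e j‖ * Y + ‖c‖ * ε := by
      refine (norm_sub_le _ _).trans (add_le_add ((norm_mul_le _ _).trans ?_) ((norm_mul_le _ _).trans ?_))
      · exact mul_le_mul_of_nonneg_left (hYs i) (norm_nonneg _)
      · exact mul_le_mul_of_nonneg_left e2.le (norm_nonneg _)
    have e4 : ‖c‖ * ε ≤ δ / 2 := by
      have : ε ≤ δ / (2 * (1 + ‖c‖)) := (min_le_right _ _).trans (min_le_left _ _)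
      calc ‖c‖ * ε ≤ (1 + ‖c‖) * (δ / (2 * (1 + ‖c‖))) :=
            mul_le_mul (by linarith) this hε0.le (by positivity)
        _ = δ / 2 := by field_simp
    rw [hβ, div_le_iff₀ (by positivity)]
    have := hi.trans e3
    linarith
  set p := ∑ j ∈ Finset.range K, e j with hp
  have hps : star p = p := by rw [hp, star_sum]; exact Finset.sum_congr rfl fun j _ => (h1 j).1.star_eq
  set b := p * g * p with hb
  have hb0 : 0 ≤ b := by
    have := star_left_conjugate_nonneg hg p
    rwa [hps] at this
  set d := ∑ j ∈ Finset.range K, e j * g * e j with hd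
  have hds : IsSelfAdjoint d := by
    rw [IsSelfAdjoint, hd, star_sum]
    refine Finset.sum_congr rfl fun j _ => ?_
    rw [star_mul, star_mul, (h1 j).1.star_eq, hg.isSelfAdjoint.star_eq, mul_assoc]
  have hdb : ‖d - b‖ ≤ η := by
    have e1 : d - b = ∑ i ∈ Finset.range K, ∑ j ∈ Finset.range K,
        (if i = j then e i * g * e j else 0) - ∑ i ∈ Finset.range K, ∑ j ∈ Finset.range K,
          e i * g * e j := by
      congr 1
      · rw [hd]; refine Finset.sum_congr rfl fun i hi => ?_
        rw [Finset.sum_ite_eq, if_pos hi]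
      · rw [hb, hp, Finset.sum_mul, Finset.sum_mul]
        refine Finset.sum_congr rfl fun i hi => ?_
        rw [Finset.mul_sum]
    rw [e1, ← Finset.sum_sub_distrib]
    have e2 : ∀ i ∈ Finset.range K, ‖∑ j ∈ Finset.range K, (if i = j then e i * g * e j else 0) -
        ∑ j ∈ Finset.range K, e i * g * e j‖ ≤ K * ε := by
      intro i hi
      rw [← Finset.sum_sub_distrib]
      have : ∀ j ∈ Finset.range K, ‖(if i = j then e i * g * e j else 0) - e i * g * e j‖ ≤ ε := by
        intro j hj
        by_cases hij : i = j
        · simp [hij, hε0.le]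
        · rw [if_neg hij, zero_sub, norm_neg]
          have : e i * g * e j = - (e i * (e j * g - g * e j)) := by
            rw [mul_sub, ← mul_assoc, h2 i j hij]; simp [mul_assoc]
          rw [this, norm_neg]
          have e5 := h4 j g (Finset.mem_insert_self _ _)
          have e6 := isProj_norm_le (h1 i)
          refine (norm_mul_le _ _).trans ?_
          nlinarith [norm_nonneg (e i), norm_nonneg (e j * g - g * e j)]
      refine (norm_sum_le_of_le _ this).trans ?_
      simp
    refine (norm_sum_le_of_le _ e2).trans ?_
    simp only [Finset.sum_const, Finset.card_range, nsmul_eq_mul]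
    have : ε ≤ η / (K ^ 2 + 1) := (min_le_right _ _).trans (min_le_right _ _)
    have e7 : (K : ℝ) * (K * ε) = K ^ 2 * ε := by ring
    rw [e7]
    calc (K : ℝ) ^ 2 * ε ≤ (K ^ 2 + 1) * (η / (K ^ 2 + 1)) :=
          mul_le_mul (by linarith) this hε0.le (by positivity)
      _ = η := by field_simp
  obtain ⟨k, -, hk0, hkdom, hkn, hkc⟩ := ror hb0 hds hη0 hdb
  have hks := hk0.isSelfAdjoint.star_eq
  have hcomm : ∀ j < K, Commute k (e j) := by
    intro j hj
    apply hkc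
    show d * e j = e j * d
    rw [hd, Finset.sum_mul, Finset.mul_sum]
    refine Finset.sum_congr rfl fun i _ => ?_
    by_cases hij : i = j
    · subst hij; rw [mul_assoc, (h1 i).2.eq, ← mul_assoc, ← mul_assoc, (h1 i).2.eq]
    · rw [mul_assoc, h2 i j hij, mul_zero, ← mul_assoc, ← mul_assoc, h2 j i (Ne.symm hij)]; simp
  have hGeq : ∀ j, k * e j * k = star (e j * k) * (e j * k) := fun j => by
    rw [star_mul, hks, (h1 j).1.star_eq]
    calc k * e j * k = k * (e j * e j) * k := by rw [(h1 j).2.eq]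
      _ = k * e j * (e j * k) := by simp only [mul_assoc]
  refine ⟨fun j => k * e j * k, ?_, ?_, ?_⟩
  · intro j hj
    simp only
    rw [hGeq]
    refine ⟨star_mul_self_nonneg _, star_mul_self_ne_zero' fun h => ?_⟩
    have e1 : e j * d * e j = e j * g * e j := by
      rw [hd, Finset.mul_sum, Finset.sum_mul, Finset.sum_eq_single_of_mem j (Finset.mem_range.2 hj)]
      · rw [← mul_assoc, ← mul_assoc, (h1 j).2.eq, mul_assoc _ (e j) (e j), (h1 j).2.eq]
      · intro i _ hij
        rw [← mul_assoc, ← mul_assoc, h2 j i hij.symm]; simp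
    have e2 : e j * (d - k) * e j = e j * g * e j := by
      rw [mul_sub, sub_mul, e1, h, zero_mul, sub_zero]
    have e3 : ‖e j * g * e j‖ = ‖c * e j‖ * ‖c * e j‖ := by
      rw [← CStarRing.norm_star_mul_self]
      congr 1
      rw [hc]; simp only [star_mul, (h1 j).1.star_eq, mul_assoc]
    have e4 : ‖e j * (d - k) * e j‖ ≤ ‖d - k‖ := by
      have hp := isProj_norm_le (h1 j)
      refine (norm_mul_le _ _).trans ?_
      have h4 := norm_mul_le (e j) (d - k)
      nlinarith [norm_nonneg (d - k), norm_nonneg (e j), norm_nonneg (e j * (d - k))]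
    rw [e2, e3] at e4
    have e5 := mul_le_mul (hbig j hj) (hbig j hj) hβ0.le (norm_nonneg _)
    have e6 := e4.trans hkn
    rw [hη] at e6
    nlinarith
  · intro i hi j hj hij
    have : k * e i * k * (k * e j * k) = k * k * (e i * e j) * k * k := by
      have c1 := (hcomm i hi).eq
      have c2 := (hcomm j hj).eq
      calc k * e i * k * (k * e j * k) = k * (e i * k) * ((k * e j) * k) := by simp only [mul_assoc]
        _ = k * (k * e i) * ((e j * k) * k) := by rw [c1, c2]
        _ = _ := by simp only [mul_assoc]
    rw [this, h2 i j hij]; simp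
  · refine Dom.trans ?_ (hkdom.trans ?_)
    · have e1 : ∑ j ∈ Finset.range K, k * e j * k = k * p * k := by
        rw [hp, Finset.mul_sum, Finset.sum_mul]
      rw [e1]
      apply Dom.of_le
      have hpp : IsProjection p := ⟨hps, by
        show p * p = p
        rw [hp, Finset.sum_mul]
        refine Finset.sum_congr rfl fun i hi => ?_
        rw [Finset.mul_sum, Finset.sum_eq_single_of_mem i hi]
        · exact (h1 i).2.eq
        · intro j _ hij; exact h2 i j hij.symm⟩
      have := star_left_conjugate_le_conjugate (isProj_le_one hpp) k
      rwa [hks, mul_one] at this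
    · have := Dom.conj g p
      rwa [hps] at this

end step1


section quot
open BoundedContinuousFunction

/-- the ideal of null sequences -/
def nullIdeal (C : Type*) [CStarAlgebra C] : Ideal (ℕ →ᵇ C) where
  carrier := {x | Tendsto (fun t => ‖x t‖) atTop (𝓝 0)}
  add_mem' := by
    intro a b ha hb
    have := Tendsto.add ha hb
    rw [add_zero] at this
    exact squeeze_zero (fun t => norm_nonneg _) (fun t => norm_add_le (a t) (b t)) this
  zero_mem' := by simp
  smul_mem' := by
    intro c x hx
    have := Tendsto.const_mul ‖c‖ hx
    rw [mul_zero] at this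
    refine squeeze_zero (fun t => norm_nonneg _) (fun t => ?_) this
    exact (norm_mul_le (c t) (x t)).trans
      (mul_le_mul_of_nonneg_right (c.norm_coe_le_norm t) (norm_nonneg _))

instance nullIdeal_two (C : Type*) [CStarAlgebra C] : (nullIdeal C).IsTwoSided where
  mul_mem_of_left := by
    intro x c hx
    have := Tendsto.mul_const ‖c‖ (show Tendsto (fun t => ‖x t‖) atTop (𝓝 0) from hx)
    rw [zero_mul] at this
    refine squeeze_zero (fun t => norm_nonneg _) (fun t => ?_) this
    exact (norm_mul_le (x t) (c t)).trans
      (mul_le_mul_of_nonneg_left (c.norm_coe_le_norm t) (norm_nonneg _))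

/-- bounded sequences modulo null sequences -/
def QS (C : Type*) [CStarAlgebra C] : Type _ := (ℕ →ᵇ C) ⧸ nullIdeal C

variable {C : Type*} [CStarAlgebra C]

noncomputable instance : Ring (QS C) := inferInstanceAs (Ring ((ℕ →ᵇ C) ⧸ nullIdeal C))
noncomputable instance : Algebra ℝ (QS C) :=
  inferInstanceAs (Algebra ℝ ((ℕ →ᵇ C) ⧸ nullIdeal C))

/-- quotient map -/
noncomputable def qm : (ℕ →ᵇ C) →ₐ[ℝ] QS C := Ideal.Quotient.mkₐ ℝ (nullIdeal C)

lemma qm_surj : Function.Surjective (qm : (ℕ →ᵇ C) → QS C) := Ideal.Quotient.mk_surjective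

lemma qm_eq {x y : ℕ →ᵇ C} : qm x = qm y ↔ Tendsto (fun t => ‖x t - y t‖) atTop (𝓝 0) := by
  have : qm x = qm y ↔ x - y ∈ nullIdeal C := Ideal.Quotient.eq
  rw [this]; rfl

lemma qm_star {x y : ℕ →ᵇ C} (h : qm x = qm y) : qm (star x) = qm (star y) := by
  rw [qm_eq] at h ⊢
  refine h.congr fun t => ?_
  simp only [BoundedContinuousFunction.star_apply]
  rw [← star_sub, norm_star]

noncomputable instance : Star (QS C) where
  star x := qm (star (Classical.choose (qm_surj x)))

lemma star_qm (x : ℕ →ᵇ C) : star (qm x) = qm (star x) :=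
  qm_star (Classical.choose_spec (qm_surj (qm x)))

noncomputable instance : StarRing (QS C) where
  star_involutive := by
    intro x; obtain ⟨x, rfl⟩ := qm_surj x; rw [star_qm, star_qm, star_star]
  star_mul := by
    intro x y; obtain ⟨x, rfl⟩ := qm_surj x; obtain ⟨y, rfl⟩ := qm_surj y
    rw [star_qm, star_qm, ← map_mul, ← map_mul, star_qm, star_mul]
  star_add := by
    intro x y; obtain ⟨x, rfl⟩ := qm_surj x; obtain ⟨y, rfl⟩ := qm_surj y
    rw [star_qm, star_qm, ← map_add, ← map_add, star_qm, star_add]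

noncomputable instance : StarModule ℝ (QS C) where
  star_smul := by
    intro r x; obtain ⟨x, rfl⟩ := qm_surj x
    rw [star_qm, ← map_smul, ← map_smul, star_qm]
    congr 1
    ext t
    simp [BoundedContinuousFunction.star_apply, star_smul]

/-- bounded sequence from a function and a bound -/
noncomputable def bs (f : ℕ → C) (K : ℝ) (h : ∀ t, ‖f t‖ ≤ K) : ℕ →ᵇ C :=
  BoundedContinuousFunction.ofNormedAddCommGroupDiscrete f K h

@[simp] lemma bs_apply (f : ℕ → C) (K : ℝ) (h : ∀ t, ‖f t‖ ≤ K) (t : ℕ) : bs f K h t = f t := rfl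

/-- constants -/
noncomputable def qc (c : C) : QS C := qm (BoundedContinuousFunction.const ℕ c)

lemma qc_mul (a b : C) : qc (a * b) = qc a * qc b := by
  unfold qc; rw [← map_mul]; rfl
lemma qc_one : qc (1 : C) = 1 := by
  unfold qc; rw [← map_one qm]; rfl
lemma qc_star (a : C) : qc (star a) = star (qc a) := by
  unfold qc; rw [star_qm]; rfl
lemma qc_add (a b : C) : qc (a + b) = qc a + qc b := by
  unfold qc; rw [← map_add]; rfl
lemma qc_sum {κ : Type*} (s : Finset κ) (a : κ → C) : qc (∑ i ∈ s, a i) = ∑ i ∈ s, qc (a i) := by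
  classical
  induction s using Finset.induction_on with
  | empty => unfold qc; rw [Finset.sum_empty, Finset.sum_empty, ← map_zero qm]; rfl
  | insert i s hi ih => rw [Finset.sum_insert hi, Finset.sum_insert hi, qc_add, ih]

lemma qm_eventually {x y : ℕ →ᵇ C} (h : qm x = qm y) {η : ℝ} (hη : 0 < η) :
    ∀ᶠ t in atTop, ‖x t - y t‖ < η := (qm_eq.1 h).eventually (gt_mem_nhds hη)

end quot


section frame
open BoundedContinuousFunction
variable {C : Type*} [CStarAlgebra C]

lemma polar_seq {q x : ℕ →ᵇ C} (hq : ∀ t, IsProjection (q t)) (hxq : ∀ t, x t * q t = x t)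
    (h : star (qm x) * qm x = qm q) :
    ∃ T : ℕ → C, ∃ z : ℕ →ᵇ C, (∀ t, z t = x t * T t) ∧ qm z = qm x ∧
      ∀ᶠ t in atTop, star (z t) * z t = q t ∧ z t * q t = z t := by
  classical
  let _ := CStarAlgebra.spectralOrder C
  let _ := CStarAlgebra.spectralOrderedRing C
  have hex : ∀ t, ∃ T : C, (‖star (x t) * x t - q t‖ ≤ 1 / 2 →
      star (x t * T) * (x t * T) = q t ∧ x t * T * q t = x t * T) ∧
      ‖x t * T - x t‖ ≤ ‖x t‖ * (2 * ‖star (x t) * x t - q t‖) := by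
    intro t
    by_cases hc : ‖star (x t) * x t - q t‖ ≤ 1 / 2
    · obtain ⟨T, h1, h2, h3⟩ := polar (hq t) (hxq t) hc
      exact ⟨T, fun _ => ⟨h1, h2⟩, h3⟩
    · exact ⟨1, fun h => absurd h hc, by simp; positivity⟩
  choose T hT1 hT2 using hex
  have hb1 : ∀ t, ‖star (x t) * x t - q t‖ ≤ ‖star x * x - q‖ := fun t =>
    (star x * x - q).norm_coe_le_norm t
  have hbound : ∀ t, ‖x t * T t‖ ≤ ‖x‖ + ‖x‖ * (2 * ‖star x * x - q‖) := fun t => by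
    have h1 := x.norm_coe_le_norm t
    have h2 := hT2 t
    have h3 := hb1 t
    calc ‖x t * T t‖ = ‖x t + (x t * T t - x t)‖ := by congr 1; abel
      _ ≤ ‖x t‖ + ‖x t‖ * (2 * ‖star (x t) * x t - q t‖) := (norm_add_le _ _).trans (by linarith)
      _ ≤ _ := by gcongr
  have hlim : Tendsto (fun t => ‖star (x t) * x t - q t‖) atTop (𝓝 0) := by
    rw [star_qm, ← map_mul] at h
    exact (qm_eq.1 h)
  refine ⟨T, bs (fun t => x t * T t) _ hbound, fun t => rfl, ?_, ?_⟩
  · rw [qm_eq]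
    have : Tendsto (fun t => ‖x‖ * (2 * ‖star (x t) * x t - q t‖)) atTop (𝓝 0) := by
      simpa using (hlim.const_mul 2).const_mul ‖x‖
    refine squeeze_zero (fun t => norm_nonneg _) (fun t => ?_) this
    exact (hT2 t).trans (mul_le_mul_of_nonneg_right (x.norm_coe_le_norm t) (by positivity))
  · filter_upwards [hlim.eventually (gt_mem_nhds (show (0:ℝ) < 1/2 by norm_num))] with t ht
    exact hT1 t ht.le

lemma lift_frame {q : ℕ →ᵇ C} (hq : ∀ t, IsProjection (q t)) (X : ℕ → QS C) (N : ℕ)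
    (hXq : ∀ i < N, X i * qm q = X i)
    (hX : ∀ i < N, ∀ j < N, star (X i) * X j = if i = j then qm q else 0) :
    ∃ Y : ℕ → (ℕ →ᵇ C), (∀ i < N, qm (Y i) = X i) ∧ ∀ᶠ t in atTop,
      (∀ i < N, Y i t * q t = Y i t) ∧
      ∀ i < N, ∀ j < N, star (Y i t) * Y j t = if i = j then q t else 0 := by
  classical
  induction N with
  | zero => exact ⟨fun _ => 0, by simp, by simp⟩
  | succ N ih =>
    obtain ⟨Y, hY1, hY2⟩ := ih (fun i hi => hXq i (by omega))
      (fun i hi j hj => hX i (by omega) j (by omega))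
    obtain ⟨x, hx⟩ := qm_surj (X N)
    set P : ℕ →ᵇ C := ∑ i ∈ Finset.range N, Y i * star (Y i) with hP
    set x' : ℕ →ᵇ C := (1 - P) * x * q with hx'
    have hqx' : qm x' = X N := by
      rw [hx', map_mul, map_mul, map_sub, map_one, hx, hP, map_sum]
      have : (∑ i ∈ Finset.range N, qm (Y i * star (Y i))) * X N = 0 := by
        rw [Finset.sum_mul]
        refine Finset.sum_eq_zero fun i hi => ?_
        have hi' := Finset.mem_range.1 hi
        rw [map_mul, ← star_qm, hY1 i hi', mul_assoc, hX i (by omega) N (by omega),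
          if_neg (by omega), mul_zero]
      rw [sub_mul, one_mul, this, sub_zero, hXq N (by omega)]
    obtain ⟨T, z, hz1, hz2, hz3⟩ := polar_seq (x := x') hq
      (fun t => by
        show (1 - P) t * x t * q t * q t = (1 - P) t * x t * q t
        rw [mul_assoc, (hq t).2.eq])
      (by rw [hqx', hX N (by omega) N (by omega), if_pos rfl])
    refine ⟨fun i => if i < N then Y i else z, ?_, ?_⟩
    · intro i hi
      by_cases h : i < N
      · simp only [h, if_true]; exact hY1 i h
      · have : i = N := by omega
        subst this
        simp only [lt_irrefl, if_false]; rw [hz2, hqx']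
    · filter_upwards [hY2, hz3] with t ht1 ht2
      have horth : ∀ i < N, star (Y i t) * z t = 0 := by
        intro i hi
        have e1 : star (Y i t) * (1 - P t) = 0 := by
          have : P t = ∑ i ∈ Finset.range N, Y i t * star (Y i t) := by
            rw [hP, BoundedContinuousFunction.sum_apply]; rfl
          rw [this, mul_sub, mul_one, Finset.mul_sum,
            Finset.sum_eq_single_of_mem i (Finset.mem_range.2 hi)]
          · rw [← mul_assoc, ht1.2 i hi i hi, if_pos rfl]
            have := congrArg star (ht1.1 i hi)
            rw [star_mul, (hq t).1.star_eq] at this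
            rw [this, sub_self]
          · intro j hj hne
            rw [← mul_assoc, ht1.2 i hi j (Finset.mem_range.1 hj), if_neg hne.symm, zero_mul]
        rw [hz1]
        show star (Y i t) * ((1 - P t) * x t * q t * T t) = 0
        simp only [← mul_assoc]; rw [e1]; simp
      constructor
      · intro i hi
        by_cases h : i < N
        · simp only [h, if_true]; exact ht1.1 i h
        · simp only [h, if_false]; exact ht2.2
      · intro i hi j hj
        by_cases h : i < N <;> by_cases h' : j < N
        · simp only [h, h', if_true]; exact ht1.2 i h j h'
        · simp only [h, h', if_true, if_false]; rw [if_neg (by omega)]; exact horth i h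
        · simp only [h, h', if_true, if_false]; rw [if_neg (by omega)]
          have := congrArg star (horth j h')
          rwa [star_mul, star_star, star_zero] at this
        · simp only [h, h', if_false]; rw [if_pos (by omega)]; exact ht2.1

/-- near-projections in a closed star subalgebra -/
lemma near_proj (B : NonUnitalStarSubalgebra ℂ C) (hB : FiniteDimensional ℂ B) {b : C} (hb : b ∈ B)
    (hbs : IsSelfAdjoint b) {δ : ℝ} (hδ : δ ≤ 1 / 8) (h : ‖b * b - b‖ ≤ δ) :
    ∃ q ∈ B, IsProjection q ∧ ‖q - b‖ ≤ 2 * δ := by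
  set f : ℝ → ℝ := fun t => max 0 (min 1 (3 * t - 1)) with hf
  have hfc : Continuous f := by fun_prop
  have hf0 : f 0 = 0 := by simp [hf]
  have hclosed : IsClosed (B : Set C) := by
    have : FiniteDimensional ℂ B.toNonUnitalSubalgebra.toSubmodule := hB
    exact B.toNonUnitalSubalgebra.toSubmodule.closed_of_finiteDimensional
  have hspec : ∀ t ∈ spectrum ℝ b, |t * t - t| ≤ δ := by
    intro t ht
    rcases subsingleton_or_nontrivial C with hs | hs
    · rw [spectrum.of_subsingleton] at ht; exact absurd ht (Set.notMem_empty _)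
    have h1 : t * t - t ∈ spectrum ℝ (b * b - b) := by
      have h2 : b * b - b = cfc (fun t : ℝ => t * t - t) b := by
        rw [cfc_sub (fun t : ℝ => t * t) (fun t => t) b, cfc_mul (fun t : ℝ => t) (fun t => t) b,
          cfc_id' ℝ b]
      rw [h2, cfc_map_spectrum (R := ℝ) (fun t : ℝ => t * t - t) b]
      exact ⟨t, ht, rfl⟩
    exact (spectrum.norm_le_norm_of_mem h1).trans h
  have hft : ∀ t ∈ spectrum ℝ b, f t * f t = f t ∧ |f t - t| ≤ 2 * δ := by
    intro t ht
    obtain ⟨h1, h2⟩ := abs_le.1 (hspec t ht)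
    have hd0 : 0 ≤ δ := (norm_nonneg _).trans h
    rcases le_or_gt t (1/2) with h3 | h3
    · have h4 : t ≤ 2 * δ := by nlinarith
      have h5 : -(2 * δ) ≤ t := by nlinarith
      have : f t = 0 := by
        simp only [hf]
        rw [max_eq_left]
        exact (min_le_right _ _).trans (by linarith)
      rw [this]; exact ⟨by simp, by rw [abs_le]; constructor <;> linarith⟩
    · have h4 : 1 - t ≤ 2 * δ := by nlinarith
      have h5 : -(2 * δ) ≤ 1 - t := by nlinarith
      have : f t = 1 := by
        simp only [hf]
        rw [min_eq_left (by linarith)]; simp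
      rw [this]; exact ⟨by simp, by rw [abs_le]; constructor <;> linarith⟩
  have heq : cfcₙ f b = cfc f b := cfcₙ_eq_cfc (hf := hfc.continuousOn) (hf0 := hf0)
  have hmem : cfcₙ f b ∈ B := by
    have := hclosed
    exact cfcₙ_mem (𝕜 := ℝ) (𝕜' := ℂ) f hb
  rw [heq] at hmem
  refine ⟨cfc f b, hmem, ⟨cfc_predicate f b, ?_⟩, ?_⟩
  · show cfc f b * cfc f b = cfc f b
    rw [← cfc_mul f f b hfc.continuousOn hfc.continuousOn]
    exact cfc_congr fun t ht => (hft t ht).1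
  · have : cfc f b - b = cfc (fun t => f t - t) b := by
      rw [cfc_sub f (fun t => t) b hfc.continuousOn (by fun_prop), cfc_id' ℝ b]
    rw [this]
    refine norm_cfc_le (by linarith [(norm_nonneg _).trans h]) fun t ht => ?_
    exact (hft t ht).2
end frame


section seqsys
variable {A : Type*} [CStarAlgebra A]

lemma dense_lim [TopologicalSpace.SeparableSpace A] (φ : ℕ → A → ℝ) (h0 : ∀ t a, 0 ≤ φ t a) (K : ℝ)
    (hL : ∀ t a b, φ t a ≤ φ t b + K * ‖a - b‖)
    (hd : ∀ t m, m ≤ t → φ t (TopologicalSpace.denseSeq A m) ≤ 1 / ((t : ℝ) + 1)) (a : A) :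
    Tendsto (fun t => φ t a) atTop (𝓝 0) := by
  rw [Metric.tendsto_atTop]
  intro η hη
  have hK : 0 < η / (2 * (|K| + 1)) := by positivity
  obtain ⟨m, hm⟩ := (TopologicalSpace.denseRange_denseSeq A).exists_dist_lt a hK
  obtain ⟨N, hN⟩ := exists_nat_one_div_lt (show 0 < η / 2 by positivity)
  refine ⟨max m N, fun t ht => ?_⟩
  have h1 := hd t m ((le_max_left _ _).trans ht)
  have hNt : N ≤ t := (le_max_right _ _).trans ht
  have hε : (1 : ℝ) / (t + 1) < η / 2 := lt_of_le_of_lt (by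
    apply one_div_le_one_div_of_le (by positivity); gcongr) hN
  have h2 := hL t a (TopologicalSpace.denseSeq A m)
  rw [dist_eq_norm] at hm
  rw [dist_zero_right, Real.norm_of_nonneg (h0 t a)]
  have h3 : K * ‖a - TopologicalSpace.denseSeq A m‖ ≤ η / 2 := by
    calc _ ≤ (|K| + 1) * ‖a - TopologicalSpace.denseSeq A m‖ := by
          gcongr; linarith [le_abs_self K]
      _ ≤ (|K| + 1) * (η / (2 * (|K| + 1))) := by gcongr
      _ = η / 2 := by field_simp
  linarith

lemma squeeze_one_div {φ : ℕ → ℝ} (h0 : ∀ t, 0 ≤ φ t) (h : ∀ t, φ t ≤ 1 / ((t : ℝ) + 1)) :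
    Tendsto φ atTop (𝓝 0) :=
  squeeze_zero h0 h (tendsto_one_div_add_atTop_nhds_zero_nat (𝕜 := ℝ))

lemma comm_lip {p : A} (hp : ‖p‖ ≤ 1) (a b : A) :
    ‖a * p - p * a‖ ≤ ‖b * p - p * b‖ + 2 * ‖a - b‖ := by
  have : a * p - p * a = (b * p - p * b) + ((a - b) * p - p * (a - b)) := by noncomm_ring
  rw [this]
  refine (norm_add_le _ _).trans (add_le_add le_rfl ((norm_sub_le _ _).trans ?_))
  have h1 := norm_mul_le (a - b) p
  have h2 := norm_mul_le p (a - b)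
  nlinarith [norm_nonneg (a - b)]

lemma seq_system [TopologicalSpace.SeparableSpace A] (hATR : TracialRankZero A)
    {α : A ≃⋆ₐ[ℂ] A} (hα : TracialRokhlin α) {r : ℕ} (hai : ApproxInner ((⇑α)^[r]))
    {bA b2 : A} (hbA : IsPos bA) (hbA0 : bA ≠ 0) (hb2 : IsPos b2) (hb20 : b2 ≠ 0) (L : ℕ) :
    ∃ (V : ℕ → A) (e : ℕ → ℕ → A) (p : ℕ → A) (B : ℕ → NonUnitalStarSubalgebra ℂ A),
      (∀ t, V t ∈ unitary A) ∧
      (∀ a, Tendsto (fun t => ‖α^[r] a - star (V t) * a * V t‖) atTop (𝓝 0)) ∧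
      (∀ t j, IsProjection (e t j)) ∧ (∀ t i j, i ≠ j → e t i * e t j = 0) ∧
      (∀ j < L, Tendsto (fun t => ‖α (e t j) - e t (j + 1)‖) atTop (𝓝 0)) ∧
      (∀ j a, Tendsto (fun t => ‖a * e t j - e t j * a‖) atTop (𝓝 0)) ∧
      (∀ j, Tendsto (fun t => ‖V t * e t j - e t j * V t‖) atTop (𝓝 0)) ∧
      (∀ t, CuntzLE (1 - ∑ j ∈ Finset.range (L + 1), e t j) bA) ∧
      (∀ t, FiniteDimensional ℂ (B t)) ∧ (∀ t, IsProjection (p t)) ∧ (∀ t, p t ∈ B t) ∧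
      (∀ t, ∀ b ∈ B t, p t * b = b ∧ b * p t = b) ∧
      (∀ a, Tendsto (fun t => ‖a * p t - p t * a‖) atTop (𝓝 0)) ∧
      (Tendsto (fun t => ‖V t * p t - p t * V t‖) atTop (𝓝 0)) ∧
      (Tendsto (fun t => ‖e t 0 * p t - p t * e t 0‖) atTop (𝓝 0)) ∧
      (∀ a, ∃ b : ℕ → A, (∀ t, b t ∈ B t) ∧
        Tendsto (fun t => ‖p t * a * p t - b t‖) atTop (𝓝 0)) ∧
      (∃ b : ℕ → A, (∀ t, b t ∈ B t) ∧
        Tendsto (fun t => ‖p t * V t * p t - b t‖) atTop (𝓝 0)) ∧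
      (∃ b : ℕ → A, (∀ t, b t ∈ B t) ∧
        Tendsto (fun t => ‖p t * e t 0 * p t - b t‖) atTop (𝓝 0)) ∧
      (∀ t, CuntzLE (1 - p t) b2) := by
  classical
  let _ := CStarAlgebra.spectralOrder A
  let _ := CStarAlgebra.spectralOrderedRing A
  let d := TopologicalSpace.denseSeq A
  have hpos : ∀ i : ℕ, (0 : ℝ) < 1 / ((i : ℝ) + 1) := fun i => by positivity
  choose V hV1 hV2 using fun t : ℕ => hai ((Finset.range (t + 1)).image d) _ (hpos t)
  choose e h1 h2 h3 h4 h5 using fun t : ℕ =>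
    tower_nat hα (insert (V t) ((Finset.range (t + 1)).image d)) (hpos t) L hbA hbA0
  choose B p hB1 hB2 hB3 hB4 hB5 hB6 hB7 using fun t : ℕ =>
    hATR (insert (e t 0) (insert (V t) ((Finset.range (t + 1)).image d))) _ (hpos t) b2 hb2 hb20
  have hmem : ∀ t m : ℕ, m ≤ t → d m ∈ (Finset.range (t + 1)).image d := fun t m h =>
    Finset.mem_image_of_mem d (Finset.mem_range.2 (Nat.lt_succ_of_le h))
  have hpn : ∀ t, ‖p t‖ ≤ 1 := fun t => isProj_norm_le (hB2 t)
  refine ⟨V, e, p, B, hV1, ?_, h1, h2, ?_, ?_, ?_, h5, hB1, hB2, hB3, hB4, ?_, ?_, ?_, ?_, ?_, ?_, hB7⟩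
  · refine dense_lim (fun t a => ‖α^[r] a - star (V t) * a * V t‖) (fun t a => norm_nonneg _) 2 ?_
      fun t m h => (hV2 t (d m) (hmem t m h)).le
    intro t a b
    have e1 : α^[r] a - star (V t) * a * V t = (α^[r] b - star (V t) * b * V t)
        + ((α^[r] a - α^[r] b) - star (V t) * (a - b) * V t) := by noncomm_ring
    rw [e1]
    refine (norm_add_le _ _).trans (add_le_add le_rfl ((norm_sub_le _ _).trans ?_))
    have e2 : ∀ k : ℕ, ‖α^[k] a - α^[k] b‖ = ‖a - b‖ := fun k => by
      induction k with
      | zero => rfl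
      | succ k ih => rw [Function.iterate_succ_apply', Function.iterate_succ_apply',
          iter_isometry, ih]
    have e3 : ‖star (V t) * (a - b) * V t‖ = ‖a - b‖ := by
      rw [CStarRing.norm_mul_mem_unitary _ (hV1 t),
        CStarRing.norm_mem_unitary_mul _ (Unitary.star_mem (hV1 t))]
    rw [e2, e3]; linarith
  · intro j hj
    exact squeeze_one_div (fun t => norm_nonneg _) fun t => (h3 t j hj).le
  · intro j
    refine dense_lim (fun t a => ‖a * e t j - e t j * a‖) (fun t a => norm_nonneg _) 2
      (fun t a b => comm_lip (isProj_norm_le (h1 t j)) a b) fun t m h => ?_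
    rw [norm_sub_rev]
    exact (h4 t j (d m) (Finset.mem_insert_of_mem (hmem t m h))).le
  · intro j
    refine squeeze_one_div (fun t => norm_nonneg _) fun t => ?_
    rw [norm_sub_rev]
    exact (h4 t j _ (Finset.mem_insert_self _ _)).le
  · refine dense_lim (fun t a => ‖a * p t - p t * a‖) (fun t a => norm_nonneg _) 2
      (fun t a b => comm_lip (hpn t) a b) fun t m h => ?_
    exact (hB5 t (d m) (Finset.mem_insert_of_mem (Finset.mem_insert_of_mem (hmem t m h)))).le
  · exact squeeze_one_div (fun t => norm_nonneg _) fun t =>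
      (hB5 t _ (Finset.mem_insert_of_mem (Finset.mem_insert_self _ _))).le
  · exact squeeze_one_div (fun t => norm_nonneg _) fun t =>
      (hB5 t _ (Finset.mem_insert_self _ _)).le
  · intro a
    have hne : ∀ t, (B t : Set A).Nonempty := fun t => ⟨_, hB3 t⟩
    have hlim : Tendsto (fun t => Metric.infDist (p t * a * p t) (B t : Set A)) atTop (𝓝 0) := by
      refine dense_lim (fun t a => Metric.infDist (p t * a * p t) (B t : Set A))
        (fun t a => Metric.infDist_nonneg) 1 ?_ ?_ a
      · intro t a b
        refine Metric.infDist_le_infDist_add_dist.trans (add_le_add le_rfl ?_)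
        rw [dist_eq_norm, one_mul, ← sub_mul, ← mul_sub]
        have := hpn t
        calc ‖p t * (a - b) * p t‖ ≤ ‖p t‖ * ‖a - b‖ * ‖p t‖ :=
              (norm_mul_le _ _).trans (mul_le_mul_of_nonneg_right (norm_mul_le _ _) (norm_nonneg _))
          _ ≤ 1 * ‖a - b‖ * 1 := by gcongr
          _ = _ := by ring
      · intro t m h
        obtain ⟨b, hb, hb'⟩ := hB6 t (d m)
          (Finset.mem_insert_of_mem (Finset.mem_insert_of_mem (hmem t m h)))
        refine (Metric.infDist_le_dist_of_mem hb).trans ?_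
        rw [dist_eq_norm]; exact hb'.le
    have hch : ∀ t, ∃ b ∈ (B t : Set A), dist (p t * a * p t) b <
        Metric.infDist (p t * a * p t) (B t : Set A) + 1 / ((t : ℝ) + 1) := fun t =>
      (Metric.infDist_lt_iff (hne t)).1 (by linarith [hpos t])
    choose b hb hb' using hch
    refine ⟨b, hb, ?_⟩
    have := hlim.add (tendsto_one_div_add_atTop_nhds_zero_nat (𝕜 := ℝ))
    rw [add_zero] at this
    refine squeeze_zero (fun t => norm_nonneg _) (fun t => ?_) this
    rw [← dist_eq_norm]; exact (hb' t).le
  · choose b hb hb' using fun t => hB6 t (V t)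
      (Finset.mem_insert_of_mem (Finset.mem_insert_self _ _))
    exact ⟨b, hb, squeeze_one_div (fun t => norm_nonneg _) fun t => (hb' t).le⟩
  · choose b hb hb' using fun t => hB6 t (e t 0) (Finset.mem_insert_self _ _)
    exact ⟨b, hb, squeeze_one_div (fun t => norm_nonneg _) fun t => (hb' t).le⟩

end seqsys


section qsys
open BoundedContinuousFunction
variable {A C : Type*} [CStarAlgebra A] [CStarAlgebra C]

/-- Dom is preserved by star homomorphisms -/
lemma Dom.map [PartialOrder A] [StarOrderedRing A] [PartialOrder C] [StarOrderedRing C]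
    (ι : A →⋆ₐ[ℂ] C) {a b : A} (h : Dom a b) : Dom (ι a) (ι b) := by
  obtain ⟨x, hx⟩ := h
  refine ⟨ι x, ?_⟩
  rw [← map_star, ← map_mul, ← map_mul, ← sub_nonneg, ← map_sub]
  obtain ⟨c, hc⟩ := CStarAlgebra.nonneg_iff_eq_star_mul_self.1 (sub_nonneg.2 hx)
  rw [hc, map_mul, map_star]
  exact star_mul_self_nonneg _

/-- the asymptotic system -/
structure QSys (α : A ≃⋆ₐ[ℂ] A) (ι : A →⋆ₐ[ℂ] C) (u : C) (r L : ℕ) [PartialOrder C]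
    (ga g2 : C) where
  V : ℕ →ᵇ C
  p : ℕ →ᵇ C
  q : ℕ →ᵇ C
  e : ℕ → ℕ →ᵇ C
  B : ℕ → NonUnitalStarSubalgebra ℂ C
  V1 : star (qm V) * qm V = 1
  V2 : qm V * star (qm V) = 1
  V3 : ∀ a, star (qm V) * qc (ι a) * qm V = qc (ι (α^[r] a))
  e_star : ∀ j, star (qm (e j)) = qm (e j)
  e_idem : ∀ j, qm (e j) * qm (e j) = qm (e j)
  e_orth : ∀ i j, i ≠ j → qm (e i) * qm (e j) = 0
  e_u : ∀ j < L, qc u * qm (e j) = qm (e (j + 1)) * qc u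
  e_a : ∀ j a, qc (ι a) * qm (e j) = qm (e j) * qc (ι a)
  e_V : ∀ j, qm V * qm (e j) = qm (e j) * qm V
  e_dom : ∀ t, Dom (1 - ∑ j ∈ Finset.range (L + 1), e j t) ga
  B_fd : ∀ t, FiniteDimensional ℂ (B t)
  q_proj : ∀ t, IsProjection (q t)
  q_mem : ∀ t, q t ∈ B t
  q_eq : qm q = qm (e 0) * qm p
  p_star : star (qm p) = qm p
  p_idem : qm p * qm p = qm p
  p_a : ∀ a, qc (ι a) * qm p = qm p * qc (ι a)
  p_V : qm V * qm p = qm p * qm V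
  p_e : qm (e 0) * qm p = qm p * qm (e 0)
  B_a : ∀ a, ∃ b : ℕ →ᵇ C, (∀ t, b t ∈ B t) ∧ qm b = qm p * qc (ι a) * qm p
  B_V : ∃ b : ℕ →ᵇ C, (∀ t, b t ∈ B t) ∧ qm b = qm p * qm V * qm p
  p_dom : ∀ t, Dom (1 - p t) g2

lemma exists_qsys [TopologicalSpace.SeparableSpace A]
    [PartialOrder A] [StarOrderedRing A] [PartialOrder C] [StarOrderedRing C]
    (hATR : TracialRankZero A)
    {α : A ≃⋆ₐ[ℂ] A} (hα : TracialRokhlin α) {r : ℕ} (hai : ApproxInner ((⇑α)^[r]))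
    {ι : A →⋆ₐ[ℂ] C} (hι : Isometry ι) {u : C} (hu : u ∈ unitary C)
    (hcov : ∀ a : A, u * ι a * star u = ι (α a))
    {ga g2 : A} (hga : 0 ≤ ga) (hga0 : ga ≠ 0) (hg2 : 0 ≤ g2) (hg20 : g2 ≠ 0) (L : ℕ) :
    Nonempty (QSys α ι u r L (ι ga) (ι g2)) := by
  classical
  obtain ⟨bA, hbA, hbA0, hbAD⟩ := exists_pos_test hga hga0
  obtain ⟨b2, hb2, hb20, hb2D⟩ := exists_pos_test hg2 hg20
  obtain ⟨V, e, p, B, hV1, hV2, he1, he2, he3, he4, he5, he6, hB1, hp1, hp2, hp3, hp4, hp5, hp6,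
    hb1, hb2', hb3, hp7⟩ := seq_system hATR hα hai hbA hbA0 hb2 hb20 L
  have hιn : ∀ a, ‖ι a‖ = ‖a‖ := fun a => by
    have := hι.dist_eq a 0
    rwa [map_zero, dist_zero_right, dist_zero_right] at this
  have hnV : ∀ t, ‖V t‖ ≤ 1 := fun t => by
    rcases subsingleton_or_nontrivial A with h | h
    · rw [Subsingleton.elim (V t) 0]; simp
    · exact (CStarRing.norm_of_mem_unitary (hV1 t)).le
  have hnp : ∀ t, ‖p t‖ ≤ 1 := fun t => isProj_norm_le (hp1 t)
  have hne : ∀ j t, ‖e t j‖ ≤ 1 := fun j t => isProj_norm_le (he1 t j)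
  let mkb : (f : ℕ → A) → (K : ℝ) → (∀ t, ‖f t‖ ≤ K) → (ℕ →ᵇ C) := fun f K h =>
    bs (fun t => ι (f t)) K (fun t => by rw [hιn]; exact h t)
  let Vb := mkb V 1 hnV
  let pb := mkb p 1 hnp
  let eb : ℕ → (ℕ →ᵇ C) := fun j => mkb (fun t => e t j) 1 (hne j)
  have key : ∀ {x y : ℕ →ᵇ C} (f : ℕ → A), (∀ t, x t - y t = ι (f t)) →
      Tendsto (fun t => ‖f t‖) atTop (𝓝 0) → qm x = qm y := by
    intro x y f h hf
    rw [qm_eq]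
    refine hf.congr fun t => ?_
    rw [h, hιn]
  have keye : ∀ {x y : ℕ →ᵇ C}, (∀ t, x t = y t) → qm x = qm y := by
    intro x y h
    congr 1; ext t; exact h t
  have hlift : ∀ (f : ℕ → A) (K : ℝ) (hf : ∀ t, ‖f t‖ ≤ K), (∃ b : ℕ → A, (∀ t, b t ∈ B t) ∧
        Tendsto (fun t => ‖p t * f t * p t - b t‖) atTop (𝓝 0)) →
      ∃ b : ℕ →ᵇ C, (∀ t, b t ∈ (B t).map ι) ∧ qm b = qm pb * qm (mkb f K hf) * qm pb := by
    rintro f K hf ⟨b, hb, hlim⟩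
    obtain ⟨K', hK'⟩ := hlim.bddAbove_range
    have hbn : ∀ t, ‖b t‖ ≤ K + K' := fun t => by
      have h1 : ‖p t * f t * p t - b t‖ ≤ K' := hK' ⟨t, rfl⟩
      have h2 : ‖p t * f t * p t‖ ≤ K := by
        calc _ ≤ ‖p t‖ * ‖f t‖ * ‖p t‖ :=
              (norm_mul_le _ _).trans (mul_le_mul_of_nonneg_right (norm_mul_le _ _) (norm_nonneg _))
          _ ≤ 1 * ‖f t‖ * 1 := by gcongr <;> exact hnp t
          _ ≤ K := by linarith [hf t]
      calc ‖b t‖ = ‖p t * f t * p t - (p t * f t * p t - b t)‖ := by congr 1; abel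
        _ ≤ _ := (norm_sub_le _ _).trans (by linarith)
    refine ⟨mkb b _ hbn, fun t => ⟨b t, hb t, rfl⟩, ?_⟩
    rw [← map_mul, ← map_mul]
    refine (key (fun t => p t * f t * p t - b t) (fun t => ?_) hlim).symm
    rw [map_sub, map_mul, map_mul]; rfl
  have ps : star (qm pb) = qm pb := by
    rw [star_qm]; refine keye fun t => ?_
    show star (ι (p t)) = ι (p t)
    rw [← map_star, (hp1 t).1.star_eq]
  have pi : qm pb * qm pb = qm pb := by
    rw [← map_mul]; refine keye fun t => ?_
    show ι (p t) * ι (p t) = ι (p t)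
    rw [← map_mul, (hp1 t).2.eq]
  have es : ∀ j, star (qm (eb j)) = qm (eb j) := fun j => by
    rw [star_qm]; refine keye fun t => ?_
    show star (ι (e t j)) = ι (e t j)
    rw [← map_star, (he1 t j).1.star_eq]
  have ei : ∀ j, qm (eb j) * qm (eb j) = qm (eb j) := fun j => by
    rw [← map_mul]; refine keye fun t => ?_
    show ι (e t j) * ι (e t j) = ι (e t j)
    rw [← map_mul, (he1 t j).2.eq]
  have pe : qm (eb 0) * qm pb = qm pb * qm (eb 0) := by
    rw [← map_mul, ← map_mul]
    refine key (fun t => e t 0 * p t - p t * e t 0) (fun t => ?_) hp6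
    rw [map_sub, map_mul, map_mul]; rfl
  have hBfd : ∀ t, FiniteDimensional ℂ ((B t).map ι) := fun t => by
    have h1 : FiniteDimensional ℂ (B t).toNonUnitalSubalgebra.toSubmodule := hB1 t
    exact (inferInstance : FiniteDimensional ℂ
      (((B t).toNonUnitalSubalgebra.toSubmodule).map (ι : A →ₗ[ℂ] C)))
  -- the projection q
  have hq : ∃ q : ℕ →ᵇ C, (∀ t, IsProjection (q t)) ∧ (∀ t, q t ∈ (B t).map ι) ∧
      qm q = qm (eb 0) * qm pb := by
    obtain ⟨b, hb, hbq⟩ := hlift (fun t => e t 0) 1 (hne 0) hb3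
    have hbq' : qm b = qm (eb 0) * qm pb := by
      rw [hbq]; show qm pb * qm (eb 0) * qm pb = _
      rw [← pe, mul_assoc, pi]
    set b' : ℕ →ᵇ C := (1 / 2 : ℝ) • (b + star b) with hb'
    have hq1 : qm b' = qm (eb 0) * qm pb := by
      rw [hb', map_smul, map_add, ← star_qm, hbq', star_mul, ps, es, ← pe, ← two_smul ℝ, smul_smul]
      norm_num
    have hq2 : qm (b' * b') = qm b' := by
      rw [map_mul, hq1]
      calc _ = qm (eb 0) * (qm pb * qm (eb 0)) * qm pb := by simp only [mul_assoc]
        _ = qm (eb 0) * qm (eb 0) * (qm pb * qm pb) := by rw [← pe]; simp only [mul_assoc]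
        _ = _ := by rw [ei, pi]
    have hb's : ∀ t, IsSelfAdjoint (b' t) := fun t => by
      show star ((1 / 2 : ℝ) • (b t + star (b t))) = (1 / 2 : ℝ) • (b t + star (b t))
      rw [star_smul, star_add, star_star, add_comm]; simp
    have hb'm : ∀ t, b' t ∈ (B t).map ι := fun t => by
      show (1 / 2 : ℝ) • (b t + star (b t)) ∈ _
      rw [RCLike.real_smul_eq_coe_smul (K := ℂ)]
      exact SMulMemClass.smul_mem _ (add_mem (hb t) (star_mem (hb t)))
    have hlim := qm_eq.1 hq2
    have hex : ∀ t, ∃ q ∈ (B t).map ι, IsProjection q ∧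
        (‖b' t * b' t - b' t‖ ≤ 1 / 8 → ‖q - b' t‖ ≤ 2 * ‖b' t * b' t - b' t‖) := fun t => by
      by_cases hc : ‖b' t * b' t - b' t‖ ≤ 1 / 8
      · obtain ⟨q, h1, h2, h3⟩ := near_proj _ (hBfd t) (hb'm t) (hb's t) hc le_rfl
        exact ⟨q, h1, h2, fun _ => h3⟩
      · exact ⟨0, zero_mem _, ⟨by simp [IsSelfAdjoint], by simp [IsIdempotentElem]⟩,
          fun h => absurd h hc⟩
    choose q hqm hqp hqn using hex
    refine ⟨bs q 1 (fun t => isProj_norm_le (hqp t)), hqp, hqm, ?_⟩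
    rw [← hq1, qm_eq]
    have h2 : Tendsto (fun t => 2 * ‖(b' * b') t - b' t‖) atTop (𝓝 0) := by
      simpa using hlim.const_mul 2
    refine tendsto_of_tendsto_of_tendsto_of_le_of_le' tendsto_const_nhds h2
      (Eventually.of_forall fun i => norm_nonneg _) ?_
    filter_upwards [hlim.eventually (gt_mem_nhds (show (0:ℝ) < 1/8 by norm_num))] with t ht
    exact hqn t ht.le
  obtain ⟨q, hq1, hq2, hq3⟩ := hq
  exact ⟨{
    V := Vb, p := pb, q := q, e := eb, B := fun t => (B t).map ι
    V1 := by
      rw [star_qm, ← map_mul, ← map_one qm]; refine keye fun t => ?_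
      show star (ι (V t)) * ι (V t) = 1
      rw [← map_star, ← map_mul, Unitary.star_mul_self_of_mem (hV1 t), map_one]
    V2 := by
      rw [star_qm, ← map_mul, ← map_one qm]; refine keye fun t => ?_
      show ι (V t) * star (ι (V t)) = 1
      rw [← map_star, ← map_mul, Unitary.mul_star_self_of_mem (hV1 t), map_one]
    V3 := by
      intro a
      unfold qc
      rw [star_qm, ← map_mul, ← map_mul]
      refine (key (fun t => α^[r] a - star (V t) * a * V t) (fun t => ?_) (hV2 a)).symm
      rw [map_sub, map_mul, map_mul, map_star]; rfl
    e_star := es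
    e_idem := ei
    e_orth := by
      intro i j hij
      rw [← map_mul, ← map_zero qm]; refine keye fun t => ?_
      show ι (e t i) * ι (e t j) = 0
      rw [← map_mul, he2 t i j hij, map_zero]
    e_u := by
      intro j hj
      unfold qc
      rw [← map_mul, ← map_mul, qm_eq]
      refine (he3 j hj).congr fun t => ?_
      show _ = ‖u * ι (e t j) - ι (e t (j+1)) * u‖
      have : u * ι (e t j) = ι (α (e t j)) * u := by
        rw [← hcov, mul_assoc, Unitary.star_mul_self_of_mem hu, mul_one]
      rw [this, ← sub_mul, CStarRing.norm_mul_mem_unitary _ hu, ← map_sub, hιn]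
    e_a := by
      intro j a
      unfold qc
      rw [← map_mul, ← map_mul]
      refine key (fun t => a * e t j - e t j * a) (fun t => ?_) (he4 j a)
      rw [map_sub, map_mul, map_mul]; rfl
    e_V := by
      intro j
      rw [← map_mul, ← map_mul]
      refine key (fun t => V t * e t j - e t j * V t) (fun t => ?_) (he5 j)
      rw [map_sub, map_mul, map_mul]; rfl
    e_dom := by
      intro t
      have h1 : IsProjection (∑ j ∈ Finset.range (L + 1), e t j) := by
        refine ⟨?_, ?_⟩
        · show star _ = _
          rw [star_sum]; exact Finset.sum_congr rfl fun i _ => (he1 t i).1.star_eq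
        · show _ * _ = _
          rw [Finset.sum_mul]; refine Finset.sum_congr rfl fun i hi => ?_
          rw [Finset.mul_sum, Finset.sum_eq_single_of_mem i hi]
          · exact (he1 t i).2.eq
          · intro j _ hne; exact he2 t i j hne.symm
      have h2 := (hbAD _ (isProj_compl h1) (he6 t)).map ι
      rw [map_sub, map_one, map_sum] at h2
      exact h2
    B_fd := hBfd
    q_proj := hq1
    q_mem := hq2
    q_eq := hq3
    p_star := ps
    p_idem := pi
    p_a := by
      intro a
      unfold qc
      rw [← map_mul, ← map_mul]
      refine key (fun t => a * p t - p t * a) (fun t => ?_) (hp4 a)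
      rw [map_sub, map_mul, map_mul]; rfl
    p_V := by
      rw [← map_mul, ← map_mul]
      refine key (fun t => V t * p t - p t * V t) (fun t => ?_) hp5
      rw [map_sub, map_mul, map_mul]; rfl
    p_e := pe
    B_a := by
      intro a
      exact hlift (fun _ => a) ‖a‖ (fun _ => le_rfl) (hb1 a)
    B_V := hlift V 1 hnV hb2'
    p_dom := by
      intro t
      have h2 := (hb2D _ (isProj_compl (hp1 t)) (hp7 t)).map ι
      rw [map_sub, map_one] at h2
      exact h2 }⟩

end qsys


section alg
variable {R : Type*} [Ring R] [StarRing R] [Algebra ℝ R] [StarModule ℝ R]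

/-- basic tower data in a star ring -/
structure Tow (u v : R) (e : ℕ → R) (L : ℕ) : Prop where
  u1 : star u * u = 1
  u2 : u * star u = 1
  v1 : star v * v = 1
  v2 : v * star v = 1
  e_star : ∀ j, star (e j) = e j
  e_idem : ∀ j, e j * e j = e j
  e_orth : ∀ i j, i ≠ j → e i * e j = 0
  e_u : ∀ j < L, u * e j = e (j + 1) * u
  e_v : ∀ j, v * e j = e j * v

variable {u v : R} {e : ℕ → R} {L : ℕ}

lemma upow_star (h1 : star u * u = 1) (k : ℕ) : star (u ^ k) * u ^ k = 1 := by
  induction k with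
  | zero => simp
  | succ k ih =>
    rw [pow_succ', star_mul]
    calc star (u ^ k) * star u * (u * u ^ k) = star (u ^ k) * (star u * u) * u ^ k := by
          simp only [mul_assoc]
      _ = 1 := by rw [h1, mul_one, ih]

lemma upow_star' (h1 : u * star u = 1) (k : ℕ) : u ^ k * star (u ^ k) = 1 := by
  have := upow_star (u := star u) (by rwa [star_star]) k
  rwa [star_pow, star_star, ← star_pow] at this

namespace Tow
variable (H : Tow u v e L)
include H

lemma ue (k : ℕ) (hk : k ≤ L) : u ^ k * e 0 = e k * u ^ k := by
  induction k with
  | zero => simp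
  | succ k ih =>
    rw [pow_succ', mul_assoc, ih (by omega), ← mul_assoc, H.e_u k (by omega), mul_assoc]

lemma e_vs (j : ℕ) : star v * e j = e j * star v := by
  have := congrArg star (H.e_v j)
  rw [star_mul, star_mul, H.e_star] at this
  exact this.symm

lemma gram0 (k l : ℕ) (hk : k ≤ L) (hl : l ≤ L) :
    star (u ^ k * e 0) * (u ^ l * e 0) = if k = l then e 0 else 0 := by
  split_ifs with h
  · subst h
    rw [star_mul, mul_assoc, ← mul_assoc _ (u ^ k), upow_star H.u1, one_mul, H.e_star, H.e_idem]
  · rw [H.ue k hk, H.ue l hl, star_mul, H.e_star, mul_assoc, ← mul_assoc (e k),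
      H.e_orth k l h, zero_mul, mul_zero]

lemma zz (k : ℕ) (hk : k ≤ L) : (u ^ k * e 0) * star (u ^ k * e 0) = e k := by
  rw [star_mul, mul_assoc, ← mul_assoc (e 0), H.e_star, H.e_idem, ← mul_assoc, H.ue k hk, mul_assoc,
    upow_star' H.u2, mul_one]

lemma zz' (k : ℕ) (hk : k ≤ L) : (u ^ k * v * e 0) * star (u ^ k * v * e 0) = e k := by
  have : u ^ k * v * e 0 = u ^ k * e 0 * v := by rw [mul_assoc, H.e_v, mul_assoc]
  rw [this, star_mul, mul_assoc, ← mul_assoc v, H.v2, one_mul, H.zz k hk]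

end Tow

/-- the rotated columns -/
def xcol (u v : R) (e : ℕ → R) (n M : ℕ) (a b : ℝ) (i : ℕ) : R :=
  a • (u ^ (n + i) * e 0) + b • (u ^ (i - M) * v * e 0)

namespace Tow
variable (H : Tow u v e L)
include H

lemma xcol_e (n M : ℕ) (a b : ℝ) (i : ℕ) : xcol u v e n M a b i * e 0 = xcol u v e n M a b i := by
  unfold xcol
  rw [add_mul, smul_mul_assoc, smul_mul_assoc, mul_assoc, H.e_idem, mul_assoc (u ^ _ * v), H.e_idem]

lemma gram1 (k l : ℕ) (hk : k ≤ L) (hl : l ≤ L) (hkl : k ≠ l) :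
    star (u ^ k * e 0) * (u ^ l * v * e 0) = 0 := by
  have : u ^ l * v * e 0 = u ^ l * e 0 * v := by rw [mul_assoc, H.e_v, mul_assoc]
  rw [this, ← mul_assoc, H.gram0 k l hk hl, if_neg hkl, zero_mul]

lemma gram2 (k l : ℕ) (hk : k ≤ L) (hl : l ≤ L) :
    star (u ^ k * v * e 0) * (u ^ l * v * e 0) = if k = l then e 0 else 0 := by
  have : ∀ l, u ^ l * v * e 0 = u ^ l * e 0 * v := fun l => by rw [mul_assoc, H.e_v, mul_assoc]
  rw [this, this, star_mul, mul_assoc, ← mul_assoc (star (u ^ k * e 0)), H.gram0 k l hk hl]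
  split_ifs with h
  · rw [← mul_assoc, H.e_vs, mul_assoc, H.v1, mul_one]
  · simp

lemma gram {n M N : ℕ} (hN : N = M + n) (hL : L + 1 = N + n) {a b a' b' : ℝ} {i j : ℕ}
    (hi : i < N) (hj : j < N) (hb : i < M → b = 0) (hb' : j < M → b' = 0) (hn : 0 < n) :
    star (xcol u v e n M a b i) * xcol u v e n M a' b' j
      = if i = j then (a * a' + b * b') • e 0 else 0 := by
  have h1 := H.gram0 (n + i) (n + j) (by omega) (by omega)
  have h4 := H.gram2 (i - M) (j - M) (by omega) (by omega)
  have h2 := H.gram1 (n + i) (j - M) (by omega) (by omega) (by omega)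
  have h3 : star (u ^ (i - M) * v * e 0) * (u ^ (n + j) * e 0) = 0 := by
    have := congrArg star (H.gram1 (n + j) (i - M) (by omega) (by omega) (by omega))
    rwa [star_mul, star_star, star_zero] at this
  unfold xcol
  rw [star_add, star_smul, star_smul, add_mul, mul_add, mul_add]
  simp only [smul_mul_smul_comm, h1, h2, h3, h4, smul_zero, add_zero, zero_add, star_trivial]
  by_cases hij : i = j
  · subst hij; simp [add_smul]
  · rw [if_neg (by omega), if_neg hij, smul_zero, zero_add]
    by_cases hM : i - M = j - M
    · rw [if_pos hM]
      rcases lt_or_ge i M with h | h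
      · rw [hb h]; simp
      · rcases lt_or_ge j M with h' | h'
        · rw [hb' h']; simp
        · omega
    · rw [if_neg hM, smul_zero]

lemma gram_q {n M N : ℕ} (hN : N = M + n) (hL : L + 1 = N + n) {a b a' b' : ℝ} {i j : ℕ}
    (hi : i < N) (hj : j < N) (hb : i < M → b = 0) (hb' : j < M → b' = 0) (hn : 0 < n)
    {q : R} (hqs : star q = q) (hqi : q * q = q) (hqe : e 0 * q = q) :
    star (xcol u v e n M a b i * q) * (xcol u v e n M a' b' j * q)
      = if i = j then (a * a' + b * b') • q else 0 := by
  rw [star_mul, mul_assoc, ← mul_assoc (star (xcol u v e n M a b i)), H.gram hN hL hi hj hb hb' hn]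
  split_ifs
  · rw [smul_mul_assoc, hqe, hqs, mul_smul_comm, hqi]
  · simp

lemma xcol_comm {n M N : ℕ} (hN : N = M + n) {a b : ℝ} {i : ℕ} (hb : i < M → b = 0) {f : R} {φ : ℕ → R}
    (h1 : ∀ k, f * u ^ k = u ^ k * φ k) (h2 : ∀ l, φ l * v = v * φ (N + l))
    (h3 : ∀ k, φ k * e 0 = e 0 * φ k) :
    f * xcol u v e n M a b i = xcol u v e n M a b i * φ (n + i) := by
  unfold xcol
  rw [mul_add, add_mul, mul_smul_comm, mul_smul_comm, smul_mul_assoc, smul_mul_assoc,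
    ← mul_assoc, h1, mul_assoc, h3]
  congr 1
  · simp only [mul_assoc]
  rcases lt_or_ge i M with h | h
  · rw [hb h, zero_smul, zero_smul]
  · congr 1
    have : n + i = N + (i - M) := by omega
    rw [← mul_assoc, ← mul_assoc, h1, mul_assoc (u ^ _), h2, this]
    simp only [mul_assoc]; rw [h3]

lemma xcol_succ {n M : ℕ} {a b : ℝ} {i : ℕ} (hb : i < M → b = 0) :
    u * xcol u v e n M a b i = xcol u v e n M a b (i + 1) := by
  unfold xcol
  rw [mul_add, mul_smul_comm, mul_smul_comm, ← mul_assoc, ← pow_succ', ← add_assoc]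
  congr 1
  rcases lt_or_ge i M with h | h
  · rw [hb h, zero_smul, zero_smul]
  · rw [← mul_assoc, ← mul_assoc, ← pow_succ', Nat.succ_sub h]

end Tow

lemma xcol_sub {n M : ℕ} {a b a' b' : ℝ} {i : ℕ} :
    xcol u v e n M (a - a') (b - b') i = xcol u v e n M a b i - xcol u v e n M a' b' i := by
  unfold xcol; rw [sub_smul, sub_smul]; abel

end alg


section alg2
variable {R : Type*} [Ring R] [StarRing R] [Algebra ℝ R] [StarModule ℝ R]

/-- the rotated tower -/
structure Rot (u v : R) (e : ℕ → R) (L n M N : ℕ) (q : R) (c s : ℕ → ℝ) : Prop where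
  tow : Tow u v e L
  hN : N = M + n
  hL : L + 1 = N + n
  hn : 0 < n
  qs : star q = q
  qi : q * q = q
  qe : e 0 * q = q
  qv : v * q = q * v
  cs : ∀ i, c i * c i + s i * s i = 1
  cM : ∀ i ≤ M, c i = 1
  sM : ∀ i ≤ M, s i = 0
  cN : c N = 0
  sN : s N = 1

namespace Rot
variable {u v : R} {e : ℕ → R} {L n M N : ℕ} {q : R} {c s : ℕ → ℝ}

/-- the columns -/
def X (u v : R) (e : ℕ → R) (n M : ℕ) (q : R) (c s : ℕ → ℝ) (i : ℕ) : R :=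
  xcol u v e n M (c i) (s i) i * q

variable (H : Rot u v e L n M N q c s)
include H

local notation "XX" => X u v e n M q c s

lemma X_q (i : ℕ) : XX i * q = XX i := by
  unfold X; rw [mul_assoc, H.qi]

lemma X_gram (i j : ℕ) (hi : i < N) (hj : j < N) : star (XX i) * XX j = if i = j then q else 0 := by
  unfold X
  rw [H.tow.gram_q H.hN H.hL hi hj (fun h => H.sM i h.le) (fun h => H.sM j h.le) H.hn H.qs H.qi H.qe]
  split_ifs with h
  · subst h; rw [H.cs, one_smul]
  · rfl

lemma qsX (i : ℕ) : q * star (XX i) = star (XX i) := by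
  have := congrArg star (H.X_q i)
  rwa [star_mul, H.qs] at this

lemma X_N : XX N = XX 0 * v := by
  unfold X xcol
  rw [H.cN, H.sN, H.cM 0 (by omega), H.sM 0 (by omega), H.hN]
  simp only [one_smul, zero_smul, zero_add, add_zero, Nat.add_sub_cancel_left]
  rw [mul_assoc (u ^ n * e 0), ← H.qv, mul_assoc (u ^ n), H.tow.e_v]
  simp only [mul_assoc]

lemma X_comm {f : R} {φ : ℕ → R}
    (h1 : ∀ k, f * u ^ k = u ^ k * φ k) (h2 : ∀ l, φ l * v = v * φ (N + l))
    (h3 : ∀ k, φ k * e 0 = e 0 * φ k) (h4 : ∀ k, φ k * q = q * φ k) (i : ℕ) :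
    f * XX i = XX i * φ (n + i) := by
  unfold X
  rw [← mul_assoc, H.tow.xcol_comm H.hN (fun h => H.sM i h.le) h1 h2 h3, mul_assoc, h4, mul_assoc]

lemma D_gram (i j : ℕ) (hi : i < N) (hj : j < N) :
    star (XX (i + 1) - u * XX i) * (XX (j + 1) - u * XX j)
      = if i = j then ((c (i+1) - c i)^2 + (s (i+1) - s i)^2) • q else 0 := by
  have key : ∀ i, XX (i + 1) - u * XX i
      = u * (xcol u v e n M (c (i+1) - c i) (s (i+1) - s i) i * q) := by
    intro i
    have := xcol_sub (u := u) (v := v) (e := e) (n := n) (M := M) (a := c (i+1)) (b := s (i+1))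
      (a' := c i) (b' := s i) (i := i)
    rw [this, sub_mul, mul_sub, ← mul_assoc u, H.tow.xcol_succ (fun h => H.sM (i + 1) h)]
    rfl
  rw [key, key, star_mul, mul_assoc, ← mul_assoc (star u), H.tow.u1, one_mul,
    H.tow.gram_q H.hN H.hL hi hj _ _ H.hn H.qs H.qi H.qe]
  · split_ifs with h
    · subst h; congr 1; ring
    · rfl
  · intro h; rw [H.sM i h.le, H.sM (i + 1) h, sub_zero]
  · intro h; rw [H.sM j h.le, H.sM (j + 1) h, sub_zero]

lemma sum_frame (a b : ℕ → R) :
    (∑ i ∈ Finset.range N, a i * star (XX i)) * (∑ j ∈ Finset.range N, XX j * b j)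
      = ∑ i ∈ Finset.range N, a i * q * b i := by
  rw [Finset.sum_mul_sum]
  refine Finset.sum_congr rfl fun i hi => ?_
  rw [Finset.sum_eq_single_of_mem i hi]
  · rw [mul_assoc, ← mul_assoc (star _), H.X_gram i i (Finset.mem_range.1 hi) (Finset.mem_range.1 hi),
      if_pos rfl, mul_assoc]
  · intro j hj hij
    rw [mul_assoc, ← mul_assoc (star _), H.X_gram i j (Finset.mem_range.1 hi) (Finset.mem_range.1 hj),
      if_neg hij.symm, zero_mul, mul_zero]

lemma pD_X (b : ℕ → R) :
    (∑ i ∈ Finset.range N, XX i * star (XX i)) * (∑ j ∈ Finset.range N, XX j * b j)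
      = ∑ i ∈ Finset.range N, XX i * b i := by
  rw [H.sum_frame]
  exact Finset.sum_congr rfl fun i _ => by rw [H.X_q]

lemma X_pD (a : ℕ → R) :
    (∑ i ∈ Finset.range N, a i * star (XX i)) * (∑ j ∈ Finset.range N, XX j * star (XX j))
      = ∑ i ∈ Finset.range N, a i * star (XX i) := by
  rw [H.sum_frame]
  exact Finset.sum_congr rfl fun i _ => by rw [mul_assoc, H.qsX]

lemma star_pD : star (∑ i ∈ Finset.range N, XX i * star (XX i))
    = ∑ i ∈ Finset.range N, XX i * star (XX i) := by
  rw [star_sum]; simp only [star_mul, star_star]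

lemma comm_pD {f : R} {φ : ℕ → R}
    (h1 : ∀ k, f * u ^ k = u ^ k * φ k) (h2 : ∀ l, φ l * v = v * φ (N + l))
    (h3 : ∀ k, φ k * e 0 = e 0 * φ k) (h4 : ∀ k, φ k * q = q * φ k) :
    f * (∑ i ∈ Finset.range N, XX i * star (XX i))
      = ∑ i ∈ Finset.range N, XX i * (q * φ (n + i) * q) * star (XX i) := by
  rw [Finset.mul_sum]
  refine Finset.sum_congr rfl fun i _ => ?_
  rw [← mul_assoc, H.X_comm h1 h2 h3 h4]
  rw [← mul_assoc (XX i), ← mul_assoc (XX i), H.X_q, mul_assoc _ q, H.qsX]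

lemma pD_comm {f : R} {φ : ℕ → R}
    (h1 : ∀ k, f * u ^ k = u ^ k * φ k) (h2 : ∀ l, φ l * v = v * φ (N + l))
    (h3 : ∀ k, φ k * e 0 = e 0 * φ k) (h4 : ∀ k, φ k * q = q * φ k)
    (h1' : ∀ k, star f * u ^ k = u ^ k * star (φ k))
    (h2' : ∀ l, star (φ l) * v = v * star (φ (N + l))) :
    (∑ i ∈ Finset.range N, XX i * star (XX i)) * f
      = ∑ i ∈ Finset.range N, XX i * (q * φ (n + i) * q) * star (XX i) := by
  have := H.comm_pD (f := star f) (φ := fun k => star (φ k)) h1' h2'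
    (fun k => by
      have := congrArg star (h3 k)
      rw [star_mul, star_mul, H.tow.e_star] at this
      exact this.symm)
    (fun k => by
      have := congrArg star (h4 k)
      rw [star_mul, star_mul, H.qs] at this
      exact this.symm)
  have := congrArg star this
  rw [star_mul, star_star, H.star_pD, star_sum] at this
  rw [this]
  refine Finset.sum_congr rfl fun i _ => ?_
  simp only [star_mul, star_star, H.qs, mul_assoc]

/-- shift -/
def TT (u v : R) (e : ℕ → R) (n M N : ℕ) (q : R) (c s : ℕ → ℝ) : R :=
  ∑ i ∈ Finset.range N, X u v e n M q c s (i + 1) * star (X u v e n M q c s i)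
/-- error -/
def SS (u v : R) (e : ℕ → R) (n M N : ℕ) (q : R) (c s : ℕ → ℝ) : R :=
  ∑ i ∈ Finset.range N, (X u v e n M q c s (i + 1) - u * X u v e n M q c s i)
    * star (X u v e n M q c s i)

local notation "T" => TT u v e n M N q c s
local notation "S" => SS u v e n M N q c s
local notation "pD" => (∑ i ∈ Finset.range N, X u v e n M q c s i * star (X u v e n M q c s i))

lemma u_pD : u * pD = T - S := by
  unfold TT SS
  rw [← Finset.sum_sub_distrib, Finset.mul_sum]
  refine Finset.sum_congr rfl fun i _ => ?_
  rw [sub_mul, sub_sub_cancel, mul_assoc]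

lemma SS_sq : star S * S = ∑ i ∈ Finset.range N,
    ((c (i+1) - c i)^2 + (s (i+1) - s i)^2) • (XX i * star (XX i)) := by
  unfold SS
  rw [star_sum, Finset.sum_mul_sum]
  refine Finset.sum_congr rfl fun i hi => ?_
  rw [Finset.sum_eq_single_of_mem i hi]
  · rw [star_mul, star_star, mul_assoc, ← mul_assoc (star _),
      H.D_gram i i (Finset.mem_range.1 hi) (Finset.mem_range.1 hi), if_pos rfl, smul_mul_assoc,
      mul_smul_comm, H.qsX]
  · intro j hj hij
    rw [star_mul, star_star, mul_assoc, ← mul_assoc (star _),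
      H.D_gram i j (Finset.mem_range.1 hi) (Finset.mem_range.1 hj), if_neg hij.symm, zero_mul,
      mul_zero]

lemma sum_shift : ∑ i ∈ Finset.range N, XX (i + 1) * star (XX (i + 1)) = pD := by
  have h1 := Finset.sum_range_succ (fun i => XX i * star (XX i)) N
  have h2 := Finset.sum_range_succ' (fun i => XX i * star (XX i)) N
  rw [h1] at h2
  have : XX N * star (XX N) = XX 0 * star (XX 0) := by
    rw [H.X_N, star_mul, mul_assoc, ← mul_assoc v, H.tow.v2, one_mul]
  rw [this] at h2
  exact (add_right_cancel h2).symm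

lemma X_succ_q (i : ℕ) : XX i * q * star (XX i) = XX i * star (XX i) := by rw [H.X_q]

lemma TT_star : T * star T = pD := by
  unfold TT
  rw [star_sum]
  simp only [star_mul, star_star]
  rw [H.sum_frame, ← H.sum_shift]
  exact Finset.sum_congr rfl fun i _ => by rw [H.X_q]

lemma TT_pD : T * pD = T := H.X_pD _

lemma TT_eq : T = ∑ i ∈ Finset.range N, ∑ j ∈ Finset.range N,
    XX i * (if i = j + 1 then q else if i = 0 ∧ j + 1 = N then q * v * q else 0) * star (XX j) := by
  rw [Finset.sum_comm]
  unfold TT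
  refine Finset.sum_congr rfl fun j hj => ?_
  have hjN := Finset.mem_range.1 hj
  by_cases h : j + 1 = N
  · rw [Finset.sum_eq_single_of_mem 0 (Finset.mem_range.2 (by omega))]
    · rw [if_neg (by omega), if_pos ⟨rfl, h⟩, h, H.X_N, ← mul_assoc, ← mul_assoc, H.X_q,
        mul_assoc _ q, H.qsX]
    · intro i hi h0
      rw [if_neg (by have := Finset.mem_range.1 hi; omega), if_neg (by omega), mul_zero, zero_mul]
  · rw [Finset.sum_eq_single_of_mem (j + 1) (Finset.mem_range.2 (by omega))]
    · rw [if_pos rfl, H.X_q]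
    · intro i hi h0
      rw [if_neg h0, if_neg (by omega), mul_zero, zero_mul]

lemma pD_TT : pD * T = T := by
  rw [← H.TT_star, mul_assoc]
  have : T = ∑ i ∈ Finset.range N, XX i * ∑ j ∈ Finset.range N,
    (if i = j + 1 then q else if i = 0 ∧ j + 1 = N then q * v * q else 0) * star (XX j) := by
    rw [H.TT_eq]
    refine Finset.sum_congr rfl fun i _ => ?_
    rw [Finset.mul_sum]
    refine Finset.sum_congr rfl fun j _ => ?_
    rw [mul_assoc]
  rw [← mul_assoc, H.TT_star]
  nth_rewrite 1 [this]
  rw [H.pD_X, ← this]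

lemma comm_u : u * pD - pD * u = - S - T * star S * u := by
  have h1 := H.u_pD
  have h2 := congrArg star h1
  rw [star_mul, H.star_pD, star_sub] at h2
  have h3 : T * star u = pD - T * star S := by
    calc T * star u = T * (pD * star u) := by rw [← mul_assoc, H.TT_pD]
      _ = _ := by rw [h2, mul_sub, H.TT_star]
  have h4 : T = pD * u - T * star S * u := by
    calc T = T * star u * u := by rw [mul_assoc, H.tow.u1, mul_one]
      _ = _ := by rw [h3, sub_mul]
  have h5 : pD * u = T + T * star S * u := by
    nth_rewrite 1 [h4]; abel
  rw [h1, h5]; abel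

lemma pup : pD * u * pD = T - pD * S := by
  rw [mul_assoc, H.u_pD, mul_sub, H.pD_TT]

/-- leftover columns -/
def Yc (u v : R) (e : ℕ → R) (n M N : ℕ) (c s : ℕ → ℝ) (l : ℕ) : R :=
  (- s (M + l)) • (u ^ (N + l) * e 0) + c (M + l) • (u ^ l * v * e 0)

lemma Yc_e (l : ℕ) : Yc u v e n M N c s l * e 0 = Yc u v e n M N c s l := by
  unfold Yc
  rw [add_mul, smul_mul_assoc, smul_mul_assoc, mul_assoc, H.tow.e_idem, mul_assoc (u ^ _ * v),
    H.tow.e_idem]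

local notation "xx" => fun i => xcol u v e n M (c i) (s i) i

lemma rot_sum (a b : ℝ) (h : a * a + b * b = 1) (x y : R) :
    (a • x + b • y) * star (a • x + b • y) + ((-b) • x + a • y) * star ((-b) • x + a • y)
      = x * star x + y * star y := by
  simp only [star_add, star_smul, star_trivial, add_mul, mul_add, smul_mul_smul_comm]
  have h' : b * b + a * a = 1 := by rw [add_comm]; exact h
  calc _ = (a * a + b * b) • (x * star x) + (b * b + a * a) • (y * star y)
      + ((a * b - b * a) • (x * star y) + (b * a - a * b) • (y * star x)) := by
        simp only [add_smul, sub_smul, neg_mul, mul_neg, neg_neg, neg_smul]; abel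
    _ = _ := by rw [h, h', mul_comm a b, sub_self]; simp

lemma total : ∑ i ∈ Finset.range N, xx i * star (xx i)
    + ∑ l ∈ Finset.range n, Yc u v e n M N c s l * star (Yc u v e n M N c s l)
      = ∑ j ∈ Finset.range (L + 1), e j := by
  have hN := H.hN
  have hL := H.hL
  rw [H.hL]
  have e1 : ∑ j ∈ Finset.range (N + n), e j = ∑ j ∈ Finset.range n, e j
      + ∑ j ∈ Finset.range M, e (n + j) + ∑ j ∈ Finset.range n, e (N + j) := by
    rw [Finset.sum_range_add, hN, add_comm M n, Finset.sum_range_add]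
  have e2 : ∑ i ∈ Finset.range N, xx i * star (xx i)
      = ∑ i ∈ Finset.range M, xx i * star (xx i)
        + ∑ l ∈ Finset.range n, xx (M + l) * star (xx (M + l)) := by
    rw [hN, Finset.sum_range_add]
  rw [e1, e2, add_assoc, ← Finset.sum_add_distrib]
  have h1 : ∑ i ∈ Finset.range M, xx i * star (xx i) = ∑ j ∈ Finset.range M, e (n + j) := by
    refine Finset.sum_congr rfl fun i hi => ?_
    have := Finset.mem_range.1 hi
    show xcol u v e n M (c i) (s i) i * star (xcol u v e n M (c i) (s i) i) = _
    unfold xcol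
    rw [H.cM i this.le, H.sM i this.le, zero_smul, one_smul, add_zero, H.tow.zz _ (by omega)]
  have h2 : ∑ l ∈ Finset.range n, (xx (M + l) * star (xx (M + l))
      + Yc u v e n M N c s l * star (Yc u v e n M N c s l))
      = ∑ l ∈ Finset.range n, (e (N + l) + e l) := by
    refine Finset.sum_congr rfl fun l hl => ?_
    have := Finset.mem_range.1 hl
    rw [← H.tow.zz (N + l) (by omega), ← H.tow.zz' l (by omega)]
    have e3 : xx (M + l) = c (M + l) • (u ^ (N + l) * e 0) + s (M + l) • (u ^ l * v * e 0) := by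
      show xcol u v e n M (c (M + l)) (s (M + l)) (M + l) = _
      unfold xcol
      rw [Nat.add_sub_cancel_left, show n + (M + l) = N + l by omega]
    rw [e3]
    unfold Yc
    exact H.rot_sum _ _ (H.cs _) _ _
  rw [h1, h2, Finset.sum_add_distrib]; abel

lemma one_sub_pD {p : R} (hq : q = e 0 * p) (hp : p * p = p) (hps : star p = p)
    (hpe : e 0 * p = p * e 0) :
    1 - pD = (1 - ∑ j ∈ Finset.range (L + 1), e j)
      + ∑ l ∈ Finset.range n, Yc u v e n M N c s l * star (Yc u v e n M N c s l)
      + ∑ i ∈ Finset.range N, xx i * (1 - p) * star (xx i) := by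
  have h : ∑ i ∈ Finset.range N, xx i * (1 - p) * star (xx i)
      = ∑ i ∈ Finset.range N, xx i * star (xx i) - pD := by
    rw [← Finset.sum_sub_distrib]
    refine Finset.sum_congr rfl fun i _ => ?_
    have : X u v e n M q c s i * star (X u v e n M q c s i) = xx i * p * star (xx i) := by
      have h0 : X u v e n M q c s i = xx i * p := by
        unfold X
        rw [hq, ← mul_assoc, H.tow.xcol_e]
      rw [h0, star_mul, hps, mul_assoc, ← mul_assoc p, hp, mul_assoc]
    rw [this, mul_sub, mul_one, sub_mul]
  rw [h, ← H.total]; abel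

end Rot

/-- absorption -/
lemma absorb {m n : ℕ} {e0 h : R} {y z : ℕ → R} {c : Fin m → R}
    (hc : ∑ i, star (c i) * h * c i = 1)
    (hz : ∀ k < n * m, ∀ k' < n * m, star (z k) * z k' = if k = k' then e0 else 0)
    (hh : ∀ k, h * z k = z k * h) (hce : ∀ i, e0 * c i = c i * e0) (hhe : e0 * h = h * e0)
    (he : star e0 = e0)
    (hy : ∀ l, y l * e0 = y l) :
    star (∑ l ∈ Finset.range n, ∑ i : Fin m, z (l * m + i) * c i * star (y l)) * h *
      (∑ l ∈ Finset.range n, ∑ i : Fin m, z (l * m + i) * c i * star (y l))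
      = ∑ l ∈ Finset.range n, y l * star (y l) := by
  have hk : ∀ l < n, ∀ i : Fin m, l * m + i < n * m := fun l hl i => by
    have := i.2
    nlinarith
  have hinj : ∀ l l', ∀ i i' : Fin m, l * m + i = l' * m + (i' : ℕ) → l = l' ∧ i = i' := by
    intro l l' i i' h
    have h1 : l = l' := by
      have e1 : (l * m + i) / m = l := by
        rw [mul_comm, Nat.mul_add_div (by have := i.2; omega), Nat.div_eq_of_lt i.2, add_zero]
      have e2 : (l' * m + i') / m = l' := by
        rw [mul_comm, Nat.mul_add_div (by have := i.2; omega), Nat.div_eq_of_lt i'.2, add_zero]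
      rw [← e1, ← e2, h]
    subst h1
    exact ⟨rfl, Fin.ext (by omega)⟩
  rw [star_sum, mul_assoc, Finset.mul_sum, Finset.sum_mul_sum]
  refine Finset.sum_congr rfl fun l hl => ?_
  rw [Finset.sum_eq_single_of_mem l hl]
  · rw [star_sum, Finset.mul_sum, Finset.sum_mul_sum]
    have : ∀ i ∈ (Finset.univ : Finset (Fin m)), ∑ j : Fin m, star (z (l * m + i) * c i * star (y l)) *
        (h * (z (l * m + j) * c j * star (y l))) = y l * (star (c i) * h * c i) * star (y l) := by
      intro i hi
      rw [Finset.sum_eq_single_of_mem i hi]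
      · calc _ = y l * (star (c i) * (star (z (l * m + i)) * (h * z (l * m + i))) * c i) * star (y l) := by
              simp only [star_mul, star_star, mul_assoc]
          _ = y l * (star (c i) * (star (z (l * m + i)) * z (l * m + i)) * h * c i) * star (y l) := by
              rw [hh]; simp only [mul_assoc]
          _ = (y l * e0) * (star (c i) * h * c i) * star (y l) := by
              rw [hz _ (hk l (Finset.mem_range.1 hl) i) _ (hk l (Finset.mem_range.1 hl) i), if_pos rfl]
              have : star (c i) * e0 = e0 * star (c i) := by
                have := congrArg star (hce i)
                rwa [star_mul, star_mul, he] at this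
              rw [this]; simp only [mul_assoc]
          _ = _ := by rw [hy]
      · intro j hj hij
        calc _ = y l * (star (c i) * (star (z (l * m + i)) * (h * z (l * m + j))) * c j) * star (y l) := by
              simp only [star_mul, star_star, mul_assoc]
          _ = y l * (star (c i) * (star (z (l * m + i)) * z (l * m + j)) * h * c j) * star (y l) := by
              rw [hh]; simp only [mul_assoc]
          _ = 0 := by
              rw [hz _ (hk l (Finset.mem_range.1 hl) i) _ (hk l (Finset.mem_range.1 hl) j), if_neg]
              · simp
              · intro h; exact hij (hinj _ _ _ _ h).2.symm
    rw [Finset.sum_congr rfl this, ← Finset.sum_mul, ← Finset.mul_sum, hc, mul_one]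
  · intro l' hl' hll
    rw [star_sum, Finset.mul_sum, Finset.sum_mul_sum]
    refine Finset.sum_eq_zero fun i _ => Finset.sum_eq_zero fun j _ => ?_
    calc _ = y l * (star (c i) * (star (z (l * m + i)) * (h * z (l' * m + j))) * c j) * star (y l') := by
          simp only [star_mul, star_star, mul_assoc]
      _ = y l * (star (c i) * (star (z (l * m + i)) * z (l' * m + j)) * h * c j) * star (y l') := by
          rw [hh]; simp only [mul_assoc]
      _ = 0 := by
          rw [hz _ (hk l (Finset.mem_range.1 hl) i) _ (hk l' (Finset.mem_range.1 hl') j), if_neg]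
          · simp
          · intro h; exact hll (hinj _ _ _ _ h).1.symm

end alg2


section frame
variable {C : Type*} [CStarAlgebra C]

lemma frame_alg (B : NonUnitalStarSubalgebra ℂ C) (hB : FiniteDimensional ℂ B) {q : C}
    (hq : IsProjection q) (hqB : q ∈ B) (N : ℕ) (Y : ℕ → C) (hY : ∀ i < N, Y i * q = Y i)
    (hYY : ∀ i < N, ∀ j < N, star (Y i) * Y j = if i = j then q else 0) :
    ∃ D : NonUnitalStarSubalgebra ℂ C, FiniteDimensional ℂ D ∧
      (∀ i < N, ∀ j < N, ∀ b ∈ B, Y i * b * star (Y j) ∈ D) ∧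
      IsProjection (∑ i ∈ Finset.range N, Y i * star (Y i)) ∧
      (∑ i ∈ Finset.range N, Y i * star (Y i)) ∈ D ∧
      ∀ d ∈ D, (∑ i ∈ Finset.range N, Y i * star (Y i)) * d = d ∧
        d * (∑ i ∈ Finset.range N, Y i * star (Y i)) = d := by
  set p := ∑ i ∈ Finset.range N, Y i * star (Y i) with hp
  have hqY : ∀ i < N, q * star (Y i) = star (Y i) := fun i hi => by
    have := congrArg star (hY i hi)
    rwa [star_mul, hq.1.star_eq] at this
  have hpY : ∀ j < N, p * Y j = Y j := fun j hj => by
    rw [hp, Finset.sum_mul, Finset.sum_eq_single_of_mem j (Finset.mem_range.2 hj)]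
    · rw [mul_assoc, hYY j hj j hj, if_pos rfl, hY j hj]
    · intro i hi hij
      rw [mul_assoc, hYY i (Finset.mem_range.1 hi) j hj, if_neg hij, mul_zero]
  have hps : star p = p := by rw [hp, star_sum]; simp only [star_mul, star_star]
  have hYp : ∀ j < N, star (Y j) * p = star (Y j) := fun j hj => by
    have := congrArg star (hpY j hj)
    rwa [star_mul, hps] at this
  let S0 : Set C := {x | ∃ i < N, ∃ j < N, ∃ b ∈ B, x = Y i * b * star (Y j)}
  have hmul0 : ∀ x ∈ S0, ∀ y ∈ S0, x * y ∈ S0 := by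
    rintro _ ⟨i, hi, j, hj, b, hb, rfl⟩ _ ⟨i', hi', j', hj', b', hb', rfl⟩
    refine ⟨i, hi, j', hj', b * (if j = i' then q else 0) * b', ?_, ?_⟩
    · refine mul_mem (mul_mem hb ?_) hb'
      split_ifs
      · exact hqB
      · exact zero_mem _
    · rw [← hYY j hj i' hi']; simp only [mul_assoc]
  have hmul : ∀ x ∈ Submodule.span ℂ S0, ∀ y ∈ Submodule.span ℂ S0, x * y ∈ Submodule.span ℂ S0 := by
    intro x hx y hy
    have := Submodule.mul_mem_mul hx hy
    rw [Submodule.span_mul_span] at this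
    refine Submodule.span_mono ?_ this
    rintro _ ⟨x, hx, y, hy, rfl⟩
    exact hmul0 x hx y hy
  have hstar : ∀ x ∈ Submodule.span ℂ S0, star x ∈ Submodule.span ℂ S0 := by
    intro x hx
    induction hx using Submodule.span_induction with
    | mem x h =>
      obtain ⟨i, hi, j, hj, b, hb, rfl⟩ := h
      refine Submodule.subset_span ⟨j, hj, i, hi, star b, star_mem hb, ?_⟩
      simp only [star_mul, star_star, mul_assoc]
    | zero => rw [star_zero]; exact zero_mem _
    | add x y _ _ h1 h2 => rw [star_add]; exact add_mem h1 h2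
    | smul a x _ h => rw [star_smul]; exact Submodule.smul_mem _ _ h
  let D : NonUnitalStarSubalgebra ℂ C :=
    { carrier := Submodule.span ℂ S0
      add_mem' := fun h1 h2 => add_mem h1 h2
      zero_mem' := zero_mem _
      mul_mem' := fun h1 h2 => hmul _ h1 _ h2
      smul_mem' := fun c x h => Submodule.smul_mem _ c h
      star_mem' := fun h => hstar _ h }
  have hgen : ∀ i < N, ∀ j < N, ∀ b ∈ B, Y i * b * star (Y j) ∈ D :=
    fun i hi j hj b hb => Submodule.subset_span ⟨i, hi, j, hj, b, hb, rfl⟩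
  have hpD : p ∈ D := by
    rw [hp]
    refine sum_mem fun i hi => ?_
    have hi := Finset.mem_range.1 hi
    have := hgen i hi i hi q hqB
    rwa [hY i hi] at this
  have hunit : ∀ d ∈ D, p * d = d ∧ d * p = d := by
    intro d hd
    have hd : d ∈ Submodule.span ℂ S0 := hd
    induction hd using Submodule.span_induction with
    | mem x h =>
      obtain ⟨i, hi, j, hj, b, hb, rfl⟩ := h
      refine ⟨?_, ?_⟩
      · rw [← mul_assoc, ← mul_assoc, hpY i hi]
      · rw [mul_assoc, hYp j hj]
    | zero => simp
    | add x y _ _ h1 h2 => exact ⟨by rw [mul_add, (h1 ‹_›).1, (h2 ‹_›).1], by rw [add_mul, (h1 ‹_›).2, (h2 ‹_›).2]⟩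
    | smul a x _ h => exact ⟨by rw [mul_smul_comm, (h ‹_›).1], by rw [smul_mul_assoc, (h ‹_›).2]⟩
  refine ⟨D, ?_, hgen, ⟨hps, (hunit p hpD).1⟩, hpD, hunit⟩
  have hBf : FiniteDimensional ℂ B.toNonUnitalSubalgebra.toSubmodule := hB
  let lin : Fin N × Fin N → C →ₗ[ℂ] C := fun x =>
    (LinearMap.mulLeft ℂ (Y x.1)).comp (LinearMap.mulRight ℂ (star (Y x.2)))
  have hle : Submodule.span ℂ S0 ≤ ⨆ x, (B.toNonUnitalSubalgebra.toSubmodule).map (lin x) := by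
    rw [Submodule.span_le]
    rintro _ ⟨i, hi, j, hj, b, hb, rfl⟩
    refine Submodule.mem_iSup_of_mem (⟨i, hi⟩, ⟨j, hj⟩) ⟨b, hb, ?_⟩
    show Y i * (b * star (Y j)) = _
    rw [mul_assoc]
  exact Submodule.finiteDimensional_of_le hle

end frame


section reduction
variable {A C : Type*} [CStarAlgebra A] [CStarAlgebra C]

/-- c is almost preserved by (D,p) -/
def NearP (c : C) (D : NonUnitalStarSubalgebra ℂ C) (p : C) (δ : ℝ) : Prop :=
  ‖c * p - p * c‖ < δ ∧ ∃ b ∈ D, ‖p * c * p - b‖ < δ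

/-- c is controlled by finite data from A and u -/
def Ctrl (ι : A →⋆ₐ[ℂ] C) (u c : C) : Prop :=
  ∀ ε : ℝ, 0 < ε → ∃ (F : Finset A) (δ : ℝ), 0 < δ ∧
    ∀ (D : NonUnitalStarSubalgebra ℂ C) (p : C), IsProjection p →
      (∀ a ∈ F, NearP (ι a) D p δ) → NearP u D p δ → NearP c D p ε

lemma NearP.mono {c p : C} {D : NonUnitalStarSubalgebra ℂ C} {δ δ' : ℝ} (h : NearP c D p δ)
    (hd : δ ≤ δ') : NearP c D p δ' :=
  ⟨h.1.trans_le hd, let ⟨b, hb, hb'⟩ := h.2; ⟨b, hb, hb'.trans_le hd⟩⟩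

lemma isProj_norm_le' {p : C} (hp : IsProjection p) : ‖p‖ ≤ 1 := by
  let _ := CStarAlgebra.spectralOrder C
  let _ := CStarAlgebra.spectralOrderedRing C
  exact isProj_norm_le hp

lemma norm_ppp {p : C} (hp : IsProjection p) (x : C) : ‖p * x * p‖ ≤ ‖x‖ := by
  have h1 := isProj_norm_le' hp
  calc _ ≤ ‖p‖ * ‖x‖ * ‖p‖ :=
        (norm_mul_le _ _).trans (mul_le_mul_of_nonneg_right (norm_mul_le _ _) (norm_nonneg _))
    _ ≤ 1 * ‖x‖ * 1 := by gcongr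
    _ = ‖x‖ := by ring

variable {ι : A →⋆ₐ[ℂ] C} {u : C}

lemma Ctrl.two {x y z : C} (hx : Ctrl ι u x) (hy : Ctrl ι u y)
    (h : ∀ ε : ℝ, 0 < ε → ∃ δ > 0, ∀ (D : NonUnitalStarSubalgebra ℂ C) (p : C), IsProjection p →
      NearP x D p δ → NearP y D p δ → NearP z D p ε) : Ctrl ι u z := by
  classical
  intro ε hε
  obtain ⟨δ, hδ, h⟩ := h ε hε
  obtain ⟨F1, d1, hd1, h1⟩ := hx δ hδ
  obtain ⟨F2, d2, hd2, h2⟩ := hy δ hδ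
  refine ⟨F1 ∪ F2, min d1 d2, lt_min hd1 hd2, fun D p hp ha hu => h D p hp ?_ ?_⟩
  · exact h1 D p hp (fun a ha' => (ha a (Finset.mem_union_left _ ha')).mono (min_le_left _ _))
      (hu.mono (min_le_left _ _))
  · exact h2 D p hp (fun a ha' => (ha a (Finset.mem_union_right _ ha')).mono (min_le_right _ _))
      (hu.mono (min_le_right _ _))

lemma Ctrl.add {x y : C} (hx : Ctrl ι u x) (hy : Ctrl ι u y) : Ctrl ι u (x + y) := by
  refine hx.two hy fun ε hε => ⟨ε / 2, by positivity, fun D p hp h1 h2 => ?_⟩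
  obtain ⟨h1, b1, hb1, hb1'⟩ := h1
  obtain ⟨h2, b2, hb2, hb2'⟩ := h2
  refine ⟨?_, b1 + b2, add_mem hb1 hb2, ?_⟩
  · calc _ = ‖(x * p - p * x) + (y * p - p * y)‖ := by congr 1; noncomm_ring
      _ < ε := (norm_add_le _ _).trans_lt (by linarith)
  · calc _ = ‖(p * x * p - b1) + (p * y * p - b2)‖ := by congr 1; noncomm_ring
      _ < ε := (norm_add_le _ _).trans_lt (by linarith)

lemma Ctrl.mul {x y : C} (hx : Ctrl ι u x) (hy : Ctrl ι u y) : Ctrl ι u (x * y) := by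
  refine hx.two hy fun ε hε => ?_
  set K := ‖x‖ + ‖y‖ + 1 with hK
  have hK1 : 1 ≤ K := by rw [hK]; linarith [norm_nonneg x, norm_nonneg y]
  have hxK : ‖x‖ ≤ K := by rw [hK]; linarith [norm_nonneg y]
  have hyK : ‖y‖ ≤ K := by rw [hK]; linarith [norm_nonneg x]
  refine ⟨min 1 (ε / (4 * K)), by positivity, fun D p hp h1 h2 => ?_⟩
  set δ := min 1 (ε / (4 * K)) with hδ
  have hδ1 : δ ≤ 1 := min_le_left _ _
  have hδ0 : 0 < δ := by positivity
  have hδ2 : δ * K ≤ ε / 4 := by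
    have : δ ≤ ε / (4 * K) := min_le_right _ _
    calc δ * K ≤ ε / (4 * K) * K := by gcongr
      _ = ε / 4 := by field_simp
  obtain ⟨h1, b1, hb1, hb1'⟩ := h1
  obtain ⟨h2, b2, hb2, hb2'⟩ := h2
  have hb1n : ‖b1‖ ≤ K := by
    calc ‖b1‖ = ‖p * x * p - (p * x * p - b1)‖ := by congr 1; abel
      _ ≤ ‖p * x * p‖ + ‖p * x * p - b1‖ := norm_sub_le _ _
      _ ≤ ‖x‖ + 1 := by
        have := norm_ppp hp x
        linarith
      _ ≤ K := by rw [hK]; linarith [norm_nonneg y]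
  refine ⟨?_, b1 * b2, mul_mem hb1 hb2, ?_⟩
  · calc _ = ‖x * (y * p - p * y) + (x * p - p * x) * y‖ := by congr 1; noncomm_ring
      _ ≤ ‖x‖ * ‖y * p - p * y‖ + ‖x * p - p * x‖ * ‖y‖ :=
        (norm_add_le _ _).trans (add_le_add (norm_mul_le _ _) (norm_mul_le _ _))
      _ ≤ K * δ + δ * K := by gcongr
      _ < ε := by linarith
  · have e1 : p * (x * y) * p - b1 * b2 = p * (x * (y * p - p * y)) * p
        + ((p * x * p - b1) * (p * y * p) + b1 * (p * y * p - b2)) := by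
      have e2 := hp.2.eq
      have : p * (x * (y * p - p * y)) * p = p * x * y * (p * p) - p * x * p * y * p := by
        noncomm_ring
      rw [this]
      have : p * x * p * (p * y * p) = p * x * p * y * p := by
        calc _ = p * x * (p * p) * y * p := by noncomm_ring
          _ = _ := by rw [e2]
      rw [sub_mul, mul_sub, this, e2]
      simp only [mul_assoc]; abel
    rw [e1]
    calc _ ≤ ‖p * (x * (y * p - p * y)) * p‖ + (‖(p * x * p - b1) * (p * y * p)‖
          + ‖b1 * (p * y * p - b2)‖) :=
          (norm_add_le _ _).trans (add_le_add le_rfl (norm_add_le _ _))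
      _ ≤ ‖x‖ * ‖y * p - p * y‖ + (‖p * x * p - b1‖ * ‖y‖ + ‖b1‖ * ‖p * y * p - b2‖) := by
        refine add_le_add ((norm_ppp hp _).trans (norm_mul_le _ _)) (add_le_add ?_ (norm_mul_le _ _))
        exact (norm_mul_le _ _).trans (mul_le_mul_of_nonneg_left (norm_ppp hp _) (norm_nonneg _))
      _ ≤ K * δ + (δ * K + K * δ) := by gcongr
      _ < ε := by linarith

lemma Ctrl.star {x : C} (hx : Ctrl ι u x) : Ctrl ι u (star x) := by
  refine hx.two hx fun ε hε => ⟨ε, hε, fun D p hp h1 _ => ?_⟩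
  obtain ⟨h1, b1, hb1, hb1'⟩ := h1
  have hs := hp.1.star_eq
  refine ⟨?_, Star.star b1, star_mem hb1, ?_⟩
  · rw [← norm_star, star_sub, star_mul, star_mul, star_star, hs, norm_sub_rev]; exact h1
  · rw [← norm_star, star_sub, star_mul, star_mul, star_star, star_star, hs, ← mul_assoc]; exact hb1'

lemma Ctrl.all {α : A ≃⋆ₐ[ℂ] A} (hu : u ∈ unitary C)
    (hcov : ∀ a : A, u * ι a * Star.star u = ι (α a))
    (hgen : (StarAlgebra.adjoin ℂ (Set.range ι ∪ {u})).topologicalClosure = ⊤) (c : C) :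
    Ctrl ι u c := by
  have hι : ∀ a, Ctrl ι u (ι a) := fun a ε hε =>
    ⟨{a}, ε, hε, fun D p hp h _ => h a (Finset.mem_singleton_self a)⟩
  have hu' : Ctrl ι u u := fun ε hε => ⟨∅, ε, hε, fun D p hp _ h => h⟩
  have hpow : ∀ k : ℕ, Ctrl ι u (uz hu k) := by
    intro k
    induction k with
    | zero => have := hι 1; rw [map_one] at this; simpa [uz_zero] using this
    | succ k ih => push_cast; rw [uz_add, uz_one]; exact ih.mul hu'
  have hz : ∀ k : ℤ, Ctrl ι u (uz hu k) := by
    intro k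
    obtain ⟨n, rfl | rfl⟩ := k.eq_nat_or_neg
    · exact hpow n
    · rw [← uz_star]; exact (hpow n).star
  refine cross_induction hu hcov hgen (Ctrl ι u) (fun a k => (hι a).mul (hz k))
    (fun b c => Ctrl.add) ?_ c
  intro c h ε hε
  obtain ⟨c', hc', hP⟩ := h (ε / 4) (by positivity)
  obtain ⟨F, δ, hδ, hF⟩ := hP (ε / 4) (by positivity)
  refine ⟨F, δ, hδ, fun D p hp h1 h2 => ?_⟩
  obtain ⟨h3, b, hb, hb'⟩ := hF D p hp h1 h2
  have hpn := isProj_norm_le' hp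
  refine ⟨?_, b, hb, ?_⟩
  · calc _ = ‖(c - c') * p - p * (c - c') + (c' * p - p * c')‖ := by congr 1; noncomm_ring
      _ ≤ ‖(c - c') * p‖ + ‖p * (c - c')‖ + ‖c' * p - p * c'‖ :=
        (norm_add_le _ _).trans (add_le_add (norm_sub_le _ _) le_rfl)
      _ ≤ ‖c - c'‖ * ‖p‖ + ‖p‖ * ‖c - c'‖ + ‖c' * p - p * c'‖ := by
        gcongr <;> exact norm_mul_le _ _
      _ ≤ ‖c - c'‖ * 1 + 1 * ‖c - c'‖ + ‖c' * p - p * c'‖ := by gcongr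
      _ < ε := by linarith
  · calc _ = ‖p * (c - c') * p + (p * c' * p - b)‖ := by congr 1; noncomm_ring
      _ ≤ ‖c - c'‖ + ‖p * c' * p - b‖ := (norm_add_le _ _).trans (add_le_add (norm_ppp hp _) le_rfl)
      _ < ε := by linarith

lemma ctrl_finset {α : A ≃⋆ₐ[ℂ] A} (hu : u ∈ unitary C)
    (hcov : ∀ a : A, u * ι a * Star.star u = ι (α a))
    (hgen : (StarAlgebra.adjoin ℂ (Set.range ι ∪ {u})).topologicalClosure = ⊤) (F : Finset C)
    {ε : ℝ} (hε : 0 < ε) :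
    ∃ (F' : Finset A) (δ : ℝ), 0 < δ ∧
    ∀ (D : NonUnitalStarSubalgebra ℂ C) (p : C), IsProjection p →
      (∀ a ∈ F', NearP (ι a) D p δ) → NearP u D p δ → ∀ c ∈ F, NearP c D p ε := by
  classical
  induction F using Finset.induction_on with
  | empty => exact ⟨∅, 1, one_pos, by simp⟩
  | insert c F hc ih =>
    obtain ⟨F1, d1, hd1, h1⟩ := ih
    obtain ⟨F2, d2, hd2, h2⟩ := Ctrl.all hu hcov hgen c ε hε
    refine ⟨F1 ∪ F2, min d1 d2, lt_min hd1 hd2, fun D p hp ha hu => ?_⟩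
    intro x hx
    rcases Finset.mem_insert.1 hx with rfl | hx
    · exact h2 D p hp (fun a ha' => (ha a (Finset.mem_union_right _ ha')).mono (min_le_right _ _))
        (hu.mono (min_le_right _ _))
    · exact h1 D p hp (fun a ha' => (ha a (Finset.mem_union_left _ ha')).mono (min_le_left _ _))
        (hu.mono (min_le_left _ _)) x hx

end reduction


section sysdom
open BoundedContinuousFunction
variable {A C : Type*} [CStarAlgebra A] [CStarAlgebra C]

lemma qb_bound {x w : ℕ →ᵇ C} (h : star (qm x) * qm x = qm w) {K : ℝ} (hK : 0 ≤ K)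
    (hw : ∀ᶠ t in atTop, ‖w t‖ ≤ K ^ 2) {η : ℝ} (hη : 0 < η) :
    ∀ᶠ t in atTop, ‖x t‖ < K + η := by
  rw [star_qm, ← map_mul] at h
  filter_upwards [hw, qm_eventually h (show 0 < η ^ 2 by positivity)] with t h1 h2
  have h3 : ‖x t‖ * ‖x t‖ = ‖(star x * x) t‖ := by
    rw [← CStarRing.norm_star_mul_self]; rfl
  have h4 : ‖(star x * x) t‖ ≤ ‖(star x * x) t - w t‖ + ‖w t‖ := by
    calc _ = ‖((star x * x) t - w t) + w t‖ := by congr 1; abel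
      _ ≤ _ := norm_add_le _ _
  nlinarith [norm_nonneg (x t)]

lemma Dom.sa [PartialOrder C] [StarOrderedRing C] {a b : C} (h : Dom a b) (hb : IsSelfAdjoint b) :
    IsSelfAdjoint a := by
  obtain ⟨x, hx⟩ := h
  have h1 : IsSelfAdjoint (star x * b * x) := hb.conjugate' x
  have h2 := (sub_nonneg.2 hx).isSelfAdjoint
  have := h1.sub h2
  rwa [sub_sub_cancel] at this

lemma proj_compl' {p : C} (hp : IsProjection p) : IsProjection (1 - p) := by
  refine ⟨(IsSelfAdjoint.one C).sub hp.1, ?_⟩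
  exact IsIdempotentElem.one_sub hp.2

lemma sys_dom [PartialOrder A] [StarOrderedRing A] [PartialOrder C] [StarOrderedRing C]
    {α : A ≃⋆ₐ[ℂ] A} {ι : A →⋆ₐ[ℂ] C} {u : C} {r L : ℕ} {g2 : A} {G : ℕ → A}
    (hG : ∀ j < 3, 0 ≤ G j) (hGo : ∀ i < 3, ∀ j < 3, i ≠ j → G i * G j = 0) (hg2 : 0 ≤ g2)
    (S : QSys α ι u r L (ι (G 0 * G 0 * G 0)) (ι g2))
    {v : QS C} {n M N : ℕ} {c s : ℕ → ℝ}
    (H : Rot (qc u) v (fun j => qm (S.e j)) L n M N (qm S.q) c s)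
    {W : QS C} (hW : star W * qc (ι (G 1 * G 1 * G 1)) * W =
      ∑ l ∈ Finset.range n, Rot.Yc (qc u) v (fun j => qm (S.e j)) n M N c s l *
        star (Rot.Yc (qc u) v (fun j => qm (S.e j)) n M N c s l))
    (h3 : ∀ (p : C), Dom (1 - p) (ι g2) → ∀ x : ℕ → C,
      Dom (∑ i ∈ Finset.range N, star (x i) * (1 - p) * x i) (ι (G 2 * G 2 * G 2)))
    {pb : ℕ →ᵇ C} (hpb : qm pb = ∑ i ∈ Finset.range N,
      Rot.X (qc u) v (fun j => qm (S.e j)) n M (qm S.q) c s i *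
      star (Rot.X (qc u) v (fun j => qm (S.e j)) n M (qm S.q) c s i))
    (hp : ∀ᶠ t in atTop, IsProjection (pb t)) :
    ∀ᶠ t in atTop, Dom (1 - pb t) (ι (∑ j ∈ Finset.range 3, G j)) := by
  obtain ⟨Wb, rfl⟩ := qm_surj W
  choose xb hxb using fun i => qm_surj (xcol (qc u) v (fun j => qm (S.e j)) n M (c i) (s i) i)
  have hιp : ∀ g : A, 0 ≤ g → 0 ≤ ι g := fun g hg => by
    obtain ⟨y, rfl⟩ := CStarAlgebra.nonneg_iff_eq_star_mul_self.1 hg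
    rw [map_mul, map_star]; exact star_mul_self_nonneg _
  have hcube : ∀ j < 3, 0 ≤ G j * G j * G j := fun j hj => cube_nonneg (hG j hj)
  let P0 : ℕ →ᵇ C := 1 - ∑ j ∈ Finset.range (L + 1), S.e j
  let P1 : ℕ →ᵇ C := star Wb * BoundedContinuousFunction.const ℕ (ι (G 1 * G 1 * G 1)) * Wb
  let P2 : ℕ →ᵇ C := ∑ i ∈ Finset.range N, xb i * (1 - S.p) * star (xb i)
  have hR : qm (1 - pb) = qm (P0 + P1 + P2) := by
    rw [map_sub, map_one, hpb, H.one_sub_pD S.q_eq S.p_idem S.p_star S.p_e, map_add, map_add, ← hW]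
    congr 1
    · congr 1
      · rw [map_sub, map_one, map_sum]
      · simp only [P1]; rw [map_mul, map_mul, star_qm]; rfl
    · simp only [P2]
      rw [map_sum]
      refine Finset.sum_congr rfl fun i _ => ?_
      have e1 := map_mul (qm (C := C)) (xb i * (1 - S.p)) (star (xb i))
      have e2 := map_mul (qm (C := C)) (xb i) (1 - S.p)
      have e3 := map_sub (qm (C := C)) 1 S.p
      rw [e1, e2, e3, map_one, ← star_qm, hxb]
  filter_upwards [hp, qm_eventually hR (show (0:ℝ) < 1 / 2 by norm_num)] with t h1 h2
  have d0 : Dom (P0 t) (ι (G 0 * G 0 * G 0)) := by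
    have := S.e_dom t
    have e : P0 t = 1 - ∑ j ∈ Finset.range (L + 1), S.e j t := by
      simp only [P0]
      rw [BoundedContinuousFunction.sub_apply, BoundedContinuousFunction.sum_apply]; rfl
    rw [e]; exact this
  have d1 : Dom (P1 t) (ι (G 1 * G 1 * G 1)) := Dom.conj _ (Wb t)
  have e2 : P2 t = ∑ i ∈ Finset.range N, star (star (xb i t)) * (1 - S.p t) * star (xb i t) := by
    simp only [P2, star_star]
    rw [BoundedContinuousFunction.sum_apply]; rfl
  have d2 : Dom (P2 t) (ι (G 2 * G 2 * G 2)) := by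
    rw [e2]
    exact h3 _ (S.p_dom t) _
  have hsa : IsSelfAdjoint ((P0 + P1 + P2) t) := by
    refine IsSelfAdjoint.add (IsSelfAdjoint.add ?_ ?_) ?_
    · exact d0.sa (hιp _ (hcube 0 (by norm_num))).isSelfAdjoint
    · exact d1.sa (hιp _ (hcube 1 (by norm_num))).isSelfAdjoint
    · exact d2.sa (hιp _ (hcube 2 (by norm_num))).isSelfAdjoint
  have hd : Dom (1 - pb t) ((P0 + P1 + P2) t) := by
    refine Dom.of_norm_lt (x := 1) (proj_compl' h1) hsa ?_
    rw [star_one, one_mul, mul_one]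
    exact h2.le
  refine hd.trans ?_
  let PP : ℕ → C := fun j => if j = 0 then P0 t else if j = 1 then P1 t else P2 t
  have hs : (P0 + P1 + P2) t = ∑ j ∈ Finset.range 3, PP j := by
    simp [Finset.sum_range_succ, PP]
  rw [hs, map_sum]
  refine Dom.sum_orth _ PP (fun j => ι (G j)) (fun j hj => ?_) (fun i hi j hj hij => ?_) (fun j hj => ?_)
  · exact (hιp _ (hG j (Finset.mem_range.1 hj))).isSelfAdjoint
  · rw [← map_mul, hGo i (Finset.mem_range.1 hi) j (Finset.mem_range.1 hj) hij, map_zero]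
  · have hj := Finset.mem_range.1 hj
    rw [← map_mul, ← map_mul]
    interval_cases j
    · exact d0
    · exact d1
    · exact d2

lemma third_dom [PartialOrder A] [StarOrderedRing A] [PartialOrder C] [StarOrderedRing C]
    {ι : A →⋆ₐ[ℂ] C} {g2 g3 : A} {N : ℕ} {G : ℕ → A} (hG : ∀ j < N, 0 ≤ G j ∧ G j ≠ 0)
    (hGo : ∀ i < N, ∀ j < N, i ≠ j → G i * G j = 0) (hGd : Dom (∑ j ∈ Finset.range N, G j) g3)
    (hg2 : ∀ i ∈ Finset.range N, Dom g2 (G i * G i * G i)) (p : C) (hp : Dom (1 - p) (ι g2))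
    (x : ℕ → C) : Dom (∑ i ∈ Finset.range N, star (x i) * (1 - p) * x i) (ι g3) := by
  have hιp : ∀ g : A, 0 ≤ g → 0 ≤ ι g := fun g hg => by
    obtain ⟨y, rfl⟩ := CStarAlgebra.nonneg_iff_eq_star_mul_self.1 hg
    rw [map_mul, map_star]; exact star_mul_self_nonneg _
  refine Dom.trans ?_ (hGd.map ι)
  rw [map_sum]
  refine Dom.sum_orth _ _ (fun j => ι (G j)) (fun j hj => ?_) (fun i hi j hj hij => ?_) (fun j hj => ?_)
  · exact (hιp _ (hG j (Finset.mem_range.1 hj)).1).isSelfAdjoint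
  · rw [← map_mul, hGo i (Finset.mem_range.1 hi) j (Finset.mem_range.1 hj) hij, map_zero]
  · rw [← map_mul, ← map_mul]
    exact (hp.mono_conj _).trans ((hg2 j hj).map ι)

end sysdom


section sysrot
open BoundedContinuousFunction
variable {A C : Type*} [CStarAlgebra A] [CStarAlgebra C] [PartialOrder C]
  {α : A ≃⋆ₐ[ℂ] A} {ι : A →⋆ₐ[ℂ] C} {u : C} {r L : ℕ} {ga g2 : C}

lemma symm_iter (α : A ≃⋆ₐ[ℂ] A) (k : ℕ) (a : A) : α^[k] (α.symm^[k] a) = a :=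
  (Function.LeftInverse.iterate (g := α) (f := α.symm) (fun x => α.apply_symm_apply x) k) a

lemma qc_cov (hu : u ∈ unitary C) (hcov : ∀ a : A, u * ι a * star u = ι (α a)) (k : ℕ) (a : A) :
    qc (ι a) * qc u ^ k = qc u ^ k * qc (ι (α.symm^[k] a)) := by
  have h1 := uz_cov hu hcov k (α.symm^[k] a)
  rw [symm_iter, uz_nat] at h1
  have h2 : ∀ k, qc u ^ k = qc (u ^ k) := fun k => by
    induction k with
    | zero => simp [qc_one]
    | succ k ih => rw [pow_succ, pow_succ, qc_mul, ih]
  rw [h2, ← qc_mul, ← qc_mul, h1]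

namespace QSys
variable (S : QSys α ι u r L ga g2)

lemma V_pow (k : ℕ) (a : A) : qc (ι a) * qm S.V ^ k = qm S.V ^ k * qc (ι (α^[r * k] a)) := by
  have h1 : ∀ a, qc (ι a) * qm S.V = qm S.V * qc (ι (α^[r] a)) := fun a => by
    rw [← S.V3 a, ← mul_assoc, ← mul_assoc, S.V2, one_mul]
  induction k with
  | zero => simp
  | succ k ih =>
    rw [pow_succ, ← mul_assoc, ih, mul_assoc, h1, ← Function.iterate_add_apply, mul_assoc]
    congr 4
    ring_nf

lemma V_e (k j : ℕ) : qm S.V ^ k * qm (S.e j) = qm (S.e j) * qm S.V ^ k := by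
  induction k with
  | zero => simp
  | succ k ih => rw [pow_succ, mul_assoc, S.e_V, ← mul_assoc, ih, mul_assoc]

lemma V_p (k : ℕ) : qm S.V ^ k * qm S.p = qm S.p * qm S.V ^ k := by
  induction k with
  | zero => simp
  | succ k ih => rw [pow_succ, mul_assoc, S.p_V, ← mul_assoc, ih, mul_assoc]

lemma star_comm {x y : QS C} (h : x * y = y * x) (hy : star y = y) : star x * y = y * star x := by
  have := congrArg star h
  rw [star_mul, star_mul, hy] at this
  exact this.symm

lemma tow (hu : u ∈ unitary C) (k : ℕ) : Tow (qc u) (star (qm S.V ^ k)) (fun j => qm (S.e j)) L where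
  u1 := by rw [← qc_star, ← qc_mul, Unitary.star_mul_self_of_mem hu, qc_one]
  u2 := by rw [← qc_star, ← qc_mul, Unitary.mul_star_self_of_mem hu, qc_one]
  v1 := by rw [star_star]; exact upow_star' S.V2 k
  v2 := by rw [star_star]; exact upow_star S.V1 k
  e_star := S.e_star
  e_idem := S.e_idem
  e_orth := S.e_orth
  e_u := S.e_u
  e_v := fun j => star_comm (S.V_e k j) (S.e_star j)

lemma v_comm (k l : ℕ) (a : A) : qc (ι (α.symm^[l] a)) * star (qm S.V ^ k)
    = star (qm S.V ^ k) * qc (ι (α.symm^[r * k + l] a)) := by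
  have h := S.V_pow k (star (α.symm^[r * k + l] a))
  have h2 : α^[r * k] (star (α.symm^[r * k + l] a)) = star (α.symm^[l] a) := by
    rw [iter_map_star, Function.iterate_add_apply, symm_iter]
  rw [h2] at h
  have h3 := congrArg star h
  rw [star_mul, star_mul, ← qc_star, ← qc_star, map_star, map_star, star_star, star_star] at h3
  exact h3.symm

lemma q_star : star (qm S.q) = qm S.q := by
  rw [S.q_eq, star_mul, S.p_star, S.e_star, S.p_e]

lemma q_idem : qm S.q * qm S.q = qm S.q := by
  rw [← map_mul]; congr 1; ext t; exact (S.q_proj t).2.eq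

lemma e_q : qm (S.e 0) * qm S.q = qm S.q := by rw [S.q_eq, ← mul_assoc, S.e_idem]

lemma a_q (a : A) : qc (ι a) * qm S.q = qm S.q * qc (ι a) := by
  rw [S.q_eq, ← mul_assoc, S.e_a, mul_assoc, S.p_a, mul_assoc]

lemma V_q (k : ℕ) : qm S.V ^ k * qm S.q = qm S.q * qm S.V ^ k := by
  rw [S.q_eq, ← mul_assoc, S.V_e, mul_assoc, S.V_p, mul_assoc]

lemma p_q : qm S.p * qm S.q = qm S.q := by rw [S.q_eq, S.p_e, ← mul_assoc, S.p_idem]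
lemma q_p : qm S.q * qm S.p = qm S.q := by rw [S.q_eq, mul_assoc, S.p_idem]

lemma rot (hu : u ∈ unitary C) {n M N k : ℕ} {c s : ℕ → ℝ} (hN : N = M + n) (hL : L + 1 = N + n) (hn : 0 < n)
    (cs : ∀ i, c i * c i + s i * s i = 1) (cM : ∀ i ≤ M, c i = 1) (sM : ∀ i ≤ M, s i = 0)
    (cN : c N = 0) (sN : s N = 1) :
    Rot (qc u) (star (qm S.V ^ k)) (fun j => qm (S.e j)) L n M N (qm S.q) c s where
  tow := S.tow hu k
  hN := hN
  hL := hL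
  hn := hn
  qs := S.q_star
  qi := S.q_idem
  qe := S.e_q
  qv := star_comm (S.V_q k) S.q_star
  cs := cs
  cM := cM
  sM := sM
  cN := cN
  sN := sN

lemma absorb_W (hr : 0 < r) (hu : u ∈ unitary C) (hcov : ∀ a : A, u * ι a * star u = ι (α a)) {n M N k m : ℕ} {c s : ℕ → ℝ}
    (H : Rot (qc u) (star (qm S.V ^ k)) (fun j => qm (S.e j)) L n M N (qm S.q) c s)
    (hm : r * (n * m) ≤ L) {h : A} {d : Fin m → A} (hd : 1 = ∑ i, star (d i) * h * d i) :
    ∃ W : QS C, star W * qc (ι h) * W =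
      ∑ l ∈ Finset.range n, Rot.Yc (qc u) (star (qm S.V ^ k)) (fun j => qm (S.e j)) n M N c s l *
        star (Rot.Yc (qc u) (star (qm S.V ^ k)) (fun j => qm (S.e j)) n M N c s l) := by
  refine ⟨_, absorb (z := fun k => qm S.V ^ k * (qc u ^ (r * k) * qm (S.e 0)))
    (c := fun i => qc (ι (d i))) (e0 := qm (S.e 0)) ?_ ?_ ?_ ?_ ?_ (S.e_star 0) (H.Yc_e)⟩
  · have := congrArg (fun x => qc (ι x)) hd
    simp only [map_one, qc_one, map_sum, qc_sum, map_mul, qc_mul, map_star, qc_star] at this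
    exact this.symm
  · intro i hi j hj
    have hi' : r * i ≤ L := (Nat.mul_le_mul_left r hi.le).trans hm
    have hj' : r * j ≤ L := (Nat.mul_le_mul_left r hj.le).trans hm
    by_cases hij : i = j
    · subst hij
      rw [if_pos rfl, star_mul, mul_assoc, ← mul_assoc (star (qm S.V ^ i)), upow_star S.V1, one_mul,
        H.tow.gram0 _ _ hi' hi', if_pos rfl]
    · rw [if_neg hij, H.tow.ue _ hi', H.tow.ue _ hj']
      have e1 : ∀ i, qm S.V ^ i * (qm (S.e (r * i)) * qc u ^ (r * i))
          = qm (S.e (r * i)) * (qm S.V ^ i * qc u ^ (r * i)) := fun i => by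
        rw [← mul_assoc, S.V_e, mul_assoc]
      rw [e1, e1, star_mul, S.e_star, mul_assoc, ← mul_assoc (qm (S.e (r * i))), S.e_orth,
        zero_mul, mul_zero]
      exact fun h => hij (Nat.eq_of_mul_eq_mul_left hr h)
  · intro i
    show qc (ι h) * (qm S.V ^ i * (qc u ^ (r * i) * qm (S.e 0)))
      = qm S.V ^ i * (qc u ^ (r * i) * qm (S.e 0)) * qc (ι h)
    rw [← mul_assoc, S.V_pow, mul_assoc, ← mul_assoc _ (qc u ^ _), qc_cov hu hcov, mul_assoc, S.e_a,
      mul_assoc, mul_assoc]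
    congr 5
    exact (Function.LeftInverse.iterate (g := α.symm) (f := α) (fun x => α.symm_apply_apply x) _) h
  · intro i; exact (S.e_a 0 _).symm
  · exact (S.e_a 0 _).symm

end QSys
end sysrot


section sysgood
open BoundedContinuousFunction
variable {A C : Type*} [CStarAlgebra A] [CStarAlgebra C] [PartialOrder C] [StarOrderedRing C]
  {α : A ≃⋆ₐ[ℂ] A} {ι : A →⋆ₐ[ℂ] C} {u : C} {r L : ℕ} {ga g2 : C}

namespace QSys
variable (S : QSys α ι u r L ga g2)

/-- represented in the finite dimensional algebras -/
def InB (β : QS C) : Prop := ∃ b : ℕ →ᵇ C, (∀ t, b t ∈ S.B t) ∧ qm b = β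

lemma InB.mul {x y : QS C} (hx : S.InB x) (hy : S.InB y) : S.InB (x * y) := by
  obtain ⟨b, hb, rfl⟩ := hx
  obtain ⟨b', hb', rfl⟩ := hy
  exact ⟨b * b', fun t => mul_mem (hb t) (hb' t), map_mul _ _ _⟩

lemma InB.star {x : QS C} (hx : S.InB x) : S.InB (star x) := by
  obtain ⟨b, hb, rfl⟩ := hx
  exact ⟨Star.star b, fun t => star_mem (hb t), (star_qm _).symm⟩

lemma InB.zero : S.InB 0 := ⟨0, fun t => zero_mem _, map_zero _⟩
lemma InB.q : S.InB (qm S.q) := ⟨S.q, S.q_mem, rfl⟩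

lemma InB.a (a : A) : S.InB (qm S.q * qc (ι a) * qm S.q) := by
  have h1 : S.InB (qm S.p * qc (ι a) * qm S.p) := S.B_a a
  have h2 := InB.mul S (InB.mul S (InB.q S) h1) (InB.q S)
  convert h2 using 1
  rw [← mul_assoc, ← mul_assoc, S.q_p, mul_assoc _ (qm S.p), S.p_q]

lemma InB.V (k : ℕ) : S.InB (qm S.q * qm S.V ^ k * qm S.q) := by
  induction k with
  | zero => rw [pow_zero, mul_one, S.q_idem]; exact InB.q S
  | succ k ih =>
    have h1 : S.InB (qm S.p * qm S.V * qm S.p) := S.B_V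
    have h2 := InB.mul S (InB.mul S ih h1) (InB.q S)
    convert h2 using 1
    have h3 := S.V_q 1
    rw [pow_one] at h3
    calc _ = qm S.q * qm S.V ^ k * (qm S.V * qm S.q) * qm S.q := by
          rw [pow_succ]; simp only [mul_assoc]; rw [S.q_idem]
      _ = (qm S.q * qm S.V ^ k * qm S.q) * qm S.V * qm S.q := by
          rw [h3]; simp only [mul_assoc]
      _ = (qm S.q * qm S.V ^ k * (qm S.q * qm S.p)) * qm S.V * (qm S.p * qm S.q) := by
          rw [S.q_p, S.p_q]
      _ = _ := by simp only [mul_assoc]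

lemma InB.v (k : ℕ) : S.InB (qm S.q * Star.star (qm S.V ^ k) * qm S.q) := by
  have := InB.star S (InB.V S k)
  rw [star_mul, star_mul, S.q_star, ← mul_assoc] at this
  exact this

lemma good (hu : u ∈ unitary C) (hcov : ∀ a : A, u * ι a * star u = ι (α a)) {n M N k : ℕ} {c s : ℕ → ℝ}
    (H : Rot (qc u) (star (qm S.V ^ k)) (fun j => qm (S.e j)) L n M N (qm S.q) c s)
    (hNk : N = r * k) {κ δ : ℝ} (hκ0 : 0 ≤ κ) (hδ : 0 < δ) (hκδ : κ ≤ δ / 8)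
    (hκ : ∀ i, (c (i+1) - c i)^2 + (s (i+1) - s i)^2 ≤ κ ^ 2) (F : Finset A) :
    ∃ pb : ℕ →ᵇ C, qm pb = ∑ i ∈ Finset.range N,
      Rot.X (qc u) (star (qm S.V ^ k)) (fun j => qm (S.e j)) n M (qm S.q) c s i *
      star (Rot.X (qc u) (star (qm S.V ^ k)) (fun j => qm (S.e j)) n M (qm S.q) c s i) ∧
      ∀ᶠ t in atTop, ∃ D : NonUnitalStarSubalgebra ℂ C, FiniteDimensional ℂ D ∧
        IsProjection (pb t) ∧ pb t ∈ D ∧ (∀ d ∈ D, pb t * d = d ∧ d * pb t = d) ∧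
        (∀ a ∈ F, NearP (ι a) D (pb t) δ) ∧ NearP u D (pb t) δ := by
  classical
  set X := Rot.X (qc u) (star (qm S.V ^ k)) (fun j => qm (S.e j)) n M (qm S.q) c s with hX
  obtain ⟨Y, hYX, hY⟩ := lift_frame S.q_proj X N (fun i _ => H.X_q i)
    (fun i hi j hj => H.X_gram i j hi hj)
  let pb : ℕ →ᵇ C := ∑ i ∈ Finset.range N, Y i * star (Y i)
  have hpb : qm pb = ∑ i ∈ Finset.range N, X i * star (X i) := by
    simp only [pb]
    rw [map_sum]
    refine Finset.sum_congr rfl fun i hi => ?_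
    rw [map_mul, ← star_qm, hYX i (Finset.mem_range.1 hi)]
  have hpbt : ∀ t, pb t = ∑ i ∈ Finset.range N, Y i t * star (Y i t) := fun t => by
    simp only [pb]; rw [BoundedContinuousFunction.sum_apply]; rfl
  -- frame elements
  have hfr : ∀ β : ℕ → ℕ → QS C, (∀ i j, S.InB (β i j)) → ∃ x : ℕ →ᵇ C,
      qm x = ∑ i ∈ Finset.range N, ∑ j ∈ Finset.range N, X i * β i j * star (X j) ∧
      ∀ t, ∀ D : NonUnitalStarSubalgebra ℂ C,
        (∀ i < N, ∀ j < N, ∀ b ∈ S.B t, Y i t * b * star (Y j t) ∈ D) → x t ∈ D := by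
    intro β hβ
    choose b hb hbq using hβ
    refine ⟨∑ i ∈ Finset.range N, ∑ j ∈ Finset.range N, Y i * b i j * star (Y j), ?_, ?_⟩
    · rw [map_sum]
      refine Finset.sum_congr rfl fun i hi => ?_
      rw [map_sum]
      refine Finset.sum_congr rfl fun j hj => ?_
      rw [map_mul, map_mul, ← star_qm, hYX i (Finset.mem_range.1 hi), hYX j (Finset.mem_range.1 hj),
        hbq]
    · intro t D hD
      rw [BoundedContinuousFunction.sum_apply]
      refine sum_mem fun i hi => ?_
      rw [BoundedContinuousFunction.sum_apply]
      refine sum_mem fun j hj => ?_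
      exact hD i (Finset.mem_range.1 hi) j (Finset.mem_range.1 hj) _ (hb i j t)
  -- elements of A
  have hA : ∀ a : A, ∀ᶠ t in atTop, ∀ D : NonUnitalStarSubalgebra ℂ C,
        (∀ i < N, ∀ j < N, ∀ b ∈ S.B t, Y i t * b * star (Y j t) ∈ D) →
        NearP (ι a) D (pb t) δ := by
    intro a
    let φ : ℕ → QS C := fun k => qc (ι (α.symm^[k] a))
    have h1 : ∀ k, qc (ι a) * qc u ^ k = qc u ^ k * φ k := fun k => qc_cov hu hcov k a
    have h2 : ∀ l, φ l * star (qm S.V ^ k) = star (qm S.V ^ k) * φ (N + l) := fun l => by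
      rw [hNk]; exact S.v_comm k l a
    have hst : ∀ k, α.symm^[k] (star a) = star (α.symm^[k] a) := fun k => iter_map_star α.symm k a
    have h1' : ∀ k, star (qc (ι a)) * qc u ^ k = qc u ^ k * star (φ k) := fun k => by
      have := qc_cov hu hcov k (star a)
      rw [hst, map_star, map_star, qc_star, qc_star] at this
      exact this
    have h2' : ∀ l, star (φ l) * star (qm S.V ^ k) = star (qm S.V ^ k) * star (φ (N + l)) := fun l => by
      have := S.v_comm k l (star a)
      rw [hst, hst, map_star, map_star, qc_star, qc_star, ← hNk] at this
      exact this
    have h3 : ∀ k, φ k * qm (S.e 0) = qm (S.e 0) * φ k := fun k => S.e_a 0 _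
    have h4 : ∀ k, φ k * qm S.q = qm S.q * φ k := fun k => S.a_q _
    have c1 := H.comm_pD h1 h2 h3 h4
    have c2 := H.pD_comm h1 h2 h3 h4 h1' h2'
    rw [← hX] at c1 c2
    obtain ⟨x, hx, hxD⟩ := hfr (fun i j => if i = j then qm S.q * φ (n + i) * qm S.q else 0)
      (fun i j => by
        split_ifs
        · exact InB.a S _
        · exact InB.zero S)
    have hx' : qm x = qc (ι a) * qm pb := by
      rw [hx, hpb, c1]
      refine Finset.sum_congr rfl fun i hi => ?_
      rw [Finset.sum_eq_single_of_mem i hi, if_pos rfl]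
      intro j _ hij
      rw [if_neg hij.symm, mul_zero, zero_mul]
    have q1 : qm (BoundedContinuousFunction.const ℕ (ι a) * pb)
        = qm (pb * BoundedContinuousFunction.const ℕ (ι a)) := by
      rw [map_mul, map_mul, hpb]
      exact c1.trans c2.symm
    have q2 : qm (pb * BoundedContinuousFunction.const ℕ (ι a) * pb) = qm x := by
      rw [hx', map_mul, ← q1, map_mul, mul_assoc]
      show qc (ι a) * _ = _
      congr 1
      rw [hpb]
      exact H.X_pD _
    filter_upwards [qm_eventually q1 hδ, qm_eventually q2 hδ] with t t1 t2
    intro D hD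
    exact ⟨t1, x t, hxD t D hD, t2⟩
  -- u
  have hU : ∀ᶠ t in atTop, IsProjection (pb t) → ∀ D : NonUnitalStarSubalgebra ℂ C,
        (∀ i < N, ∀ j < N, ∀ b ∈ S.B t, Y i t * b * star (Y j t) ∈ D) →
        NearP u D (pb t) δ := by
    obtain ⟨T, hT, hTD⟩ := hfr (fun i j => if i = j + 1 then qm S.q else if i = 0 ∧ j + 1 = N then
      qm S.q * star (qm S.V ^ k) * qm S.q else 0)
      (fun i j => by
        split_ifs
        · exact InB.q S
        · exact InB.v S k
        · exact InB.zero S)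
    rw [hX, ← H.TT_eq] at hT
    obtain ⟨Sb, hS⟩ := qm_surj (Rot.SS (qc u) (star (qm S.V ^ k)) (fun j => qm (S.e j)) n M N (qm S.q) c s)
    have q1 : qm (BoundedContinuousFunction.const ℕ u * pb - pb * BoundedContinuousFunction.const ℕ u)
        = qm (- Sb - T * star Sb * BoundedContinuousFunction.const ℕ u) := by
      rw [map_sub, map_sub, map_mul, map_mul, map_mul, map_mul, map_neg, ← star_qm, hS, hT, hpb]
      exact H.comm_u
    have q2 : qm (pb * BoundedContinuousFunction.const ℕ u * pb) = qm (T - pb * Sb) := by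
      rw [map_sub, map_mul, map_mul, map_mul, hS, hT, hpb]
      exact H.pup
    let w : ℕ →ᵇ C := ∑ i ∈ Finset.range N,
      ((c (i+1) - c i)^2 + (s (i+1) - s i)^2) • (Y i * star (Y i))
    have hw : star (qm Sb) * qm Sb = qm w := by
      rw [hS, H.SS_sq, map_sum]
      refine Finset.sum_congr rfl fun i hi => ?_
      rw [map_smul, map_mul, ← star_qm, hYX i (Finset.mem_range.1 hi)]
    have hwt : ∀ t, w t = ∑ i ∈ Finset.range N,
        ((c (i+1) - c i)^2 + (s (i+1) - s i)^2) • (Y i t * star (Y i t)) := fun t => by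
      simp only [w]; rw [BoundedContinuousFunction.sum_apply]; rfl
    have hT2 : star (qm (star T)) * qm (star T) = qm pb := by
      rw [← star_qm, star_star, hT, H.TT_star, hpb]
    have hpr : ∀ᶠ t in atTop, IsProjection (pb t) := by
      filter_upwards [hY] with t ht
      obtain ⟨D, _, _, h, _⟩ := frame_alg (S.B t) (S.B_fd t) (S.q_proj t) (S.q_mem t) N (fun i => Y i t)
        ht.1 ht.2
      rw [hpbt]; exact h
    have b1 := qb_bound hw hκ0 (by
      filter_upwards [hpr] with t ht
      have h0 : w t ≤ (κ ^ 2) • pb t := by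
        rw [hwt, hpbt, Finset.smul_sum]
        refine Finset.sum_le_sum fun i _ => ?_
        exact smul_le_smul_of_nonneg_right (hκ i) (mul_star_self_nonneg _)
      have h1 : 0 ≤ w t := by
        rw [hwt]
        exact Finset.sum_nonneg fun i _ => smul_nonneg (by positivity) (mul_star_self_nonneg _)
      calc ‖w t‖ ≤ ‖(κ ^ 2) • pb t‖ := CStarAlgebra.norm_le_norm_of_nonneg_of_le h1 h0
        _ = κ ^ 2 * ‖pb t‖ := by rw [norm_smul, Real.norm_of_nonneg (by positivity)]
        _ ≤ κ ^ 2 * 1 := by gcongr; exact isProj_norm_le ht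
        _ = κ ^ 2 := mul_one _) (show 0 < δ / 8 by positivity)
    have b2 := qb_bound hT2 (zero_le_one) (by
      filter_upwards [hpr] with t ht
      rw [one_pow]; exact isProj_norm_le ht) (show (0:ℝ) < 1 by norm_num)
    filter_upwards [b1, b2, qm_eventually q1 (show 0 < δ / 8 by positivity),
      qm_eventually q2 (show 0 < δ / 8 by positivity)] with t t1 t2 t3 t4
    intro htp D hD
    have hS4 : ‖Sb t‖ ≤ δ / 4 := by linarith
    have hTn : ‖T t‖ ≤ 2 := by
      have : ‖(star T) t‖ = ‖T t‖ := norm_star (T t)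
      rw [this] at t2; linarith
    have hun : ‖u‖ ≤ 1 := by
      rcases subsingleton_or_nontrivial C with h | h
      · rw [Subsingleton.elim u 0]; simp
      · exact (CStarRing.norm_of_mem_unitary hu).le
    refine ⟨?_, T t, hTD t D hD, ?_⟩
    · have t3' : ‖(u * pb t - pb t * u) - (- Sb t - T t * star (Sb t) * u)‖ < δ / 8 := t3
      calc ‖u * pb t - pb t * u‖ = ‖((u * pb t - pb t * u) - (- Sb t - T t * star (Sb t) * u))
            - Sb t - T t * star (Sb t) * u‖ := by congr 1; abel
        _ ≤ ‖(u * pb t - pb t * u) - (- Sb t - T t * star (Sb t) * u)‖ + ‖Sb t‖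
            + ‖T t * star (Sb t) * u‖ :=
            (norm_sub_le _ _).trans (add_le_add (norm_sub_le _ _) le_rfl)
        _ ≤ δ / 8 + δ / 4 + 2 * (δ / 4) * 1 := by
            refine add_le_add (add_le_add t3'.le hS4) ?_
            calc _ ≤ ‖T t‖ * ‖star (Sb t)‖ * ‖u‖ :=
                  (norm_mul_le _ _).trans (mul_le_mul_of_nonneg_right (norm_mul_le _ _) (norm_nonneg _))
              _ ≤ _ := by rw [norm_star]; gcongr
        _ < δ := by linarith
    · have t4' : ‖pb t * u * pb t - (T t - pb t * Sb t)‖ < δ / 8 := t4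
      calc ‖pb t * u * pb t - T t‖ = ‖(pb t * u * pb t - (T t - pb t * Sb t)) - pb t * Sb t‖ := by
            congr 1; abel
        _ ≤ δ / 8 + 1 * (δ / 4) := by
            refine (norm_sub_le _ _).trans (add_le_add t4'.le ((norm_mul_le _ _).trans ?_))
            have := isProj_norm_le htp
            gcongr
        _ < δ := by linarith
  refine ⟨pb, hpb, ?_⟩
  have hAF : ∀ᶠ t in atTop, ∀ a ∈ F, ∀ D : NonUnitalStarSubalgebra ℂ C,
        (∀ i < N, ∀ j < N, ∀ b ∈ S.B t, Y i t * b * star (Y j t) ∈ D) →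
        NearP (ι a) D (pb t) δ := by
    rw [Filter.eventually_all_finset]
    exact fun a _ => hA a
  filter_upwards [hY, hAF, hU] with t ht h1 h2
  obtain ⟨D, d1, d2, d3, d4, d5⟩ := frame_alg (S.B t) (S.B_fd t) (S.q_proj t) (S.q_mem t) N
    (fun i => Y i t) ht.1 ht.2
  rw [hpbt]
  rw [hpbt] at h2
  refine ⟨D, d1, d3, d4, d5, fun a ha => ?_, h2 d3 D d2⟩
  have := h1 a ha D d2
  rwa [hpbt] at this

end QSys
end sysgood


section mainnp
variable {A C : Type*} [CStarAlgebra A] [CStarAlgebra C]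

lemma main_notPI [TopologicalSpace.SeparableSpace A]
    (hAsimple : IsSimpleCStar A) (hATR : TracialRankZero A)
    (α : A ≃⋆ₐ[ℂ] A) (hα : TracialRokhlin α)
    (r : ℕ) (hr : 1 ≤ r) (hai : ApproxInner ((⇑α)^[r]))
    (hCsimple : IsSimpleCStar C)
    (ι : A →⋆ₐ[ℂ] C) (hι : Isometry ι)
    (u : C) (hu : u ∈ unitary C)
    (hcov : ∀ a : A, u * ι a * star u = ι (α a))
    (hgen : (StarAlgebra.adjoin ℂ (Set.range ι ∪ {u})).topologicalClosure = ⊤)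
    {x0 : A} (hx : IsPos x0) (hx0 : x0 ≠ 0) (hn : ¬ CuntzLE 1 x0) : TracialRankZero C := by
  classical
  let _ := CStarAlgebra.spectralOrder A
  let _ := CStarAlgebra.spectralOrderedRing A
  let _ := CStarAlgebra.spectralOrder C
  let _ := CStarAlgebra.spectralOrderedRing C
  have : Nontrivial A := ⟨⟨x0, 0, hx0⟩⟩
  intro F ε hε a ha ha0
  have hap := isPos_nonneg ha
  obtain ⟨F', δ, hδ, hctrl⟩ := ctrl_finset hu hcov hgen F hε
  obtain ⟨g, hg, hg0, hga⟩ := step1 hα hx hx0 hn hι hu hcov hgen hCsimple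
    (a := a * a) (by
      have := star_mul_self_nonneg a
      rwa [hap.isSelfAdjoint.star_eq] at this) (sq_ne_zero' hap.isSelfAdjoint ha0)
  obtain ⟨G, hG, hGo, hGd⟩ := split_pos hα hAsimple hx hx0 hn hg hg0 3
  obtain ⟨m, d, hd⟩ := simple_sum_pos hAsimple (cube_nonneg (hG 1 (by norm_num)).1)
    (cube_ne_zero (hG 1 (by norm_num)).1 (hG 1 (by norm_num)).2)
  obtain ⟨n0, hn0⟩ := exists_nat_gt (8 * Real.pi / δ)
  set n := n0 + 1 with hndef
  have hnpos : (0:ℝ) < n := by rw [hndef]; positivity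
  have hκδ : Real.pi / n ≤ δ / 8 := by
    have h1 : 8 * Real.pi / δ < n := hn0.trans (by rw [hndef]; push_cast; linarith)
    rw [div_lt_iff₀ hδ] at h1
    rw [div_le_iff₀ hnpos]
    linarith
  set k := n * m + n with hk
  set N := r * k with hN
  set M := N - n with hM
  set L := N + n - 1 with hL
  have hNk : n * m + n ≤ N := by rw [hN, ← hk]; exact Nat.le_mul_of_pos_left _ hr
  have hrm : r * (n * m) ≤ L := by
    have : r * (n * m) ≤ N := by rw [hN, hk]; exact Nat.mul_le_mul_left _ (by omega)
    omega
  have hNM : N = M + n := by omega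
  have hLN : L + 1 = N + n := by omega
  obtain ⟨K, hK, hKo, hKd⟩ := split_pos hα hAsimple hx hx0 hn
    (cube_nonneg (hG 2 (by norm_num)).1)
    (cube_ne_zero (hG 2 (by norm_num)).1 (hG 2 (by norm_num)).2) N
  obtain ⟨g2, hg2, hg20, hg2d⟩ := exists_common_dom hAsimple (Finset.range N)
    (fun i => K i * K i * K i) (fun i hi => ⟨cube_nonneg (hK i (Finset.mem_range.1 hi)).1,
      cube_ne_zero (hK i (Finset.mem_range.1 hi)).1 (hK i (Finset.mem_range.1 hi)).2⟩)
  obtain ⟨S⟩ := exists_qsys hATR hα hai hι hu hcov (cube_nonneg (hG 0 (by norm_num)).1)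
    (cube_ne_zero (hG 0 (by norm_num)).1 (hG 0 (by norm_num)).2) hg2 hg20 L
  let θ : ℕ → ℝ := fun i => Real.pi / 2 * (((i - M : ℕ) : ℝ) / n)
  have hθM : ∀ i ≤ M, θ i = 0 := fun i hi => by
    simp only [θ]; rw [Nat.sub_eq_zero_of_le hi]; simp
  have hθN : θ N = Real.pi / 2 := by
    simp only [θ]
    rw [show N - M = n by omega, div_self hnpos.ne', mul_one]
  have hθd : ∀ i, |θ (i + 1) - θ i| ≤ Real.pi / 2 / n := fun i => by
    simp only [θ]
    rcases lt_or_ge i M with h | h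
    · rw [Nat.sub_eq_zero_of_le h.le, Nat.sub_eq_zero_of_le h]
      simp; positivity
    · rw [Nat.succ_sub h]
      push_cast
      rw [← mul_sub, ← sub_div, add_sub_cancel_left, abs_of_nonneg (by positivity)]
      apply le_of_eq; ring
  have H := S.rot hu (k := k) (c := fun i => Real.cos (θ i)) (s := fun i => Real.sin (θ i)) hNM hLN
    (by omega) (fun i => by rw [← sq, ← sq]; exact Real.cos_sq_add_sin_sq _)
    (fun i hi => by simp only [hθM i hi, Real.cos_zero]) (fun i hi => by simp only [hθM i hi, Real.sin_zero])
    (by simp only [hθN, Real.cos_pi_div_two]) (by simp only [hθN, Real.sin_pi_div_two])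
  have hκ : ∀ i, (Real.cos (θ (i+1)) - Real.cos (θ i))^2 + (Real.sin (θ (i+1)) - Real.sin (θ i))^2
      ≤ (Real.pi / n) ^ 2 := fun i => by
    have e : (Real.cos (θ (i+1)) - Real.cos (θ i))^2 + (Real.sin (θ (i+1)) - Real.sin (θ i))^2
        = 2 - 2 * Real.cos (θ (i + 1) - θ i) := by
      rw [Real.cos_sub]
      have h1 := Real.cos_sq_add_sin_sq (θ i)
      have h2 := Real.cos_sq_add_sin_sq (θ (i + 1))
      nlinarith
    rw [e]
    have h1 := Real.one_sub_sq_div_two_le_cos (x := θ (i + 1) - θ i)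
    have h2 : (θ (i + 1) - θ i) ^ 2 ≤ (Real.pi / 2 / n) ^ 2 := by
      rw [← sq_abs]; exact pow_le_pow_left₀ (abs_nonneg _) (hθd i) 2
    have h3 : (Real.pi / 2 / n) ^ 2 = (Real.pi / n) ^ 2 / 4 := by ring
    have h4 : 0 ≤ (Real.pi / n) ^ 2 := by positivity
    linarith
  obtain ⟨pb, hpb, hgood⟩ := S.good hu hcov H rfl (by positivity) hδ hκδ hκ F'
  obtain ⟨W, hW⟩ := S.absorb_W hr hu hcov H hrm hd
  have hdom := sys_dom (fun j hj => (hG j hj).1) hGo hg2 S H hW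
    (third_dom hK hKo hKd hg2d) hpb (hgood.mono fun t ⟨D, _, h, _⟩ => h)
  obtain ⟨t, ⟨D, d1, d2, d3, d4, d5, d6⟩, hdt⟩ := (hgood.and hdom).exists
  have hfin := hctrl D (pb t) d2 d5 d6
  refine ⟨D, pb t, d1, d2, d3, d4, fun x hx => (hfin x hx).1, fun x hx => (hfin x hx).2, ?_⟩
  exact Dom.cuntzLE (proj_compl' d2) hap.isSelfAdjoint ((hdt.trans (hGd.map ι)).trans hga)

end mainnp


section pisec
variable {A C : Type*} [CStarAlgebra A] [CStarAlgebra C]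

/-- images of isometries of `A` -/
def IsoA (ι : A →⋆ₐ[ℂ] C) (S : C) : Prop := ∃ s : A, star s * s = 1 ∧ S = ι s

lemma IsoA.one (ι : A →⋆ₐ[ℂ] C) : IsoA ι 1 := ⟨1, by simp, by simp⟩

lemma IsoA.star_mul {ι : A →⋆ₐ[ℂ] C} {S : C} (h : IsoA ι S) : star S * S = 1 := by
  obtain ⟨s, hs, rfl⟩ := h
  rw [← map_star, ← map_mul, hs, map_one]

lemma IsoA.mul {ι : A →⋆ₐ[ℂ] C} {S T : C} (h : IsoA ι S) (h' : IsoA ι T) : IsoA ι (S * T) := by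
  obtain ⟨s, hs, rfl⟩ := h
  obtain ⟨t, ht, rfl⟩ := h'
  refine ⟨s * t, ?_, by simp⟩
  rw [StarMul.star_mul, mul_assoc, ← mul_assoc (star s), hs, one_mul, ht]

lemma norm_le_one_of_iso {S : C} (h : star S * S = 1) : ‖S‖ ≤ 1 := by
  have h1 := CStarRing.norm_star_mul_self (x := S)
  rw [h] at h1
  by_cases hC : Nontrivial C
  · rw [norm_one] at h1
    nlinarith [norm_nonneg S]
  · rw [not_nontrivial_iff_subsingleton] at hC
    rw [Subsingleton.elim S 0, norm_zero]; exact zero_le_one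

lemma IsoA.norm_le {ι : A →⋆ₐ[ℂ] C} {S : C} (h : IsoA ι S) : ‖S‖ ≤ 1 := norm_le_one_of_iso h.star_mul

lemma norm_mul3_le {x y z : C} {κ : ℝ} (hx : ‖x‖ ≤ 1) (hy : ‖y‖ ≤ κ) (hz : ‖z‖ ≤ 1) :
    ‖x * y * z‖ ≤ κ := by
  have h1 := norm_mul_le (x * y) z
  have h2 := norm_mul_le x y
  have := norm_nonneg x
  have := norm_nonneg y
  have := norm_nonneg z
  have h3 : ‖x‖ * ‖y‖ ≤ ‖y‖ := by nlinarith
  have h4 : ‖x * y‖ * ‖z‖ ≤ ‖x * y‖ := by nlinarith [norm_nonneg (x * y)]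
  linarith

lemma norm_mul_r_le {x y : C} {κ : ℝ} (hx : ‖x‖ ≤ κ) (hy : ‖y‖ ≤ 1) : ‖x * y‖ ≤ κ := by
  have h1 := norm_mul_le x y
  nlinarith [norm_nonneg x, norm_nonneg y]

lemma norm_mul_l_le {x y : C} {κ : ℝ} (hx : ‖x‖ ≤ 1) (hy : ‖y‖ ≤ κ) : ‖x * y‖ ≤ κ := by
  have h1 := norm_mul_le x y
  nlinarith [norm_nonneg x, norm_nonneg y]

/-- the purely infinite condition in working form -/
lemma pi_lower [PartialOrder A] [StarOrderedRing A]
    (hPI : ∀ g : A, 0 ≤ g → g ≠ 0 → ∃ x, 1 = star x * g * x) {h : A} (hh : 0 ≤ h)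
    {m m' : ℝ} (h0 : 0 ≤ m') (hm : m' < m)
    (H : ∀ s : A, star s * s = 1 → m ≤ ‖star s * h * s‖) : algebraMap ℝ A m' ≤ h := by
  set k := h - algebraMap ℝ A m' with hk
  have hksa : IsSelfAdjoint k := hh.isSelfAdjoint.sub (IsSelfAdjoint.algebraMap A (IsSelfAdjoint.all m'))
  rw [← sub_nonneg, ← hk, ← CFC.negPart_eq_zero_iff k hksa]
  by_contra hne
  have hn0 := CFC.negPart_nonneg k
  have hns := hn0.isSelfAdjoint.star_eq
  have hsq : k⁻ * k⁻ ≠ 0 := sq_ne_zero' hn0.isSelfAdjoint hne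
  obtain ⟨x, hx⟩ := hPI (k⁻ * k⁻) (by
    have := star_mul_self_nonneg (k⁻); rwa [hns] at this) hsq
  have hs : star (k⁻ * x) * (k⁻ * x) = 1 := by
    rw [hx, StarMul.star_mul, hns]; simp only [mul_assoc]
  have h1 := H _ hs
  have h2 : star (k⁻ * x) * k * (k⁻ * x) ≤ 0 := by
    have e : star (k⁻ * x) * k * (k⁻ * x) = -(star x * (k⁻ * k⁻ * k⁻) * x) := by
      have e1 : k⁻ * k = -(k⁻ * k⁻) := by
        nth_rw 2 [← CFC.posPart_sub_negPart k hksa]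
        rw [mul_sub, CFC.negPart_mul_posPart, zero_sub]
      calc star (k⁻ * x) * k * (k⁻ * x) = star x * (k⁻ * k) * (k⁻ * x) := by
            rw [StarMul.star_mul, hns]; simp only [mul_assoc]
        _ = _ := by rw [e1]; simp only [mul_assoc, neg_mul, mul_neg]
    rw [e, neg_nonpos]
    exact star_left_conjugate_nonneg (cube_nonneg hn0) x
  have h3 : star (k⁻ * x) * h * (k⁻ * x) ≤ algebraMap ℝ A m' := by
    have e : star (k⁻ * x) * k * (k⁻ * x)
        = star (k⁻ * x) * h * (k⁻ * x) - algebraMap ℝ A m' := by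
      rw [hk, mul_sub, sub_mul, ← hk, Algebra.algebraMap_eq_smul_one, mul_smul_comm, mul_one,
        smul_mul_assoc, hs]
    rw [e, sub_nonpos] at h2
    exact h2
  have h4 := (CStarAlgebra.norm_le_iff_le_algebraMap _ h0 (star_left_conjugate_nonneg hh _)).2 h3
  linarith

/-- homogeneous elements -/
def HomE (ι : A →⋆ₐ[ℂ] C) {u : C} (hu : u ∈ unitary C) (c : C) : Prop :=
  ∃ (y : A) (k : ℤ), c = ι y * uz hu k

lemma HomE.compress {α : A ≃⋆ₐ[ℂ] A} {ι : A →⋆ₐ[ℂ] C} {u : C} (hu : u ∈ unitary C)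
    (hcov : ∀ a : A, u * ι a * star u = ι (α a)) {c S : C} (hc : HomE ι hu c) (hS : IsoA ι S) :
    HomE ι hu (star S * c * S) := by
  obtain ⟨y, k, rfl⟩ := hc
  obtain ⟨s, hs, rfl⟩ := hS
  obtain ⟨s', hs'⟩ := uz_cov_ex hu hcov k s
  refine ⟨star s * y * s', k, ?_⟩
  rw [mul_assoc, mul_assoc, hs']
  simp only [map_mul, map_star, mul_assoc]

lemma HomE.sq {α : A ≃⋆ₐ[ℂ] A} {ι : A →⋆ₐ[ℂ] C} {u : C} (hu : u ∈ unitary C)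
    (hcov : ∀ a : A, u * ι a * star u = ι (α a)) {c : C} (hc : HomE ι hu c) :
    ∃ y : A, star c * c = ι (star y * y) := by
  obtain ⟨y, k, rfl⟩ := hc
  obtain ⟨s', hs'⟩ := uz_cov_ex hu hcov (-k) (star y)
  refine ⟨star s', ?_⟩
  have e1 : star (ι y * uz hu k) = ι s' * uz hu (-k) := by
    rw [StarMul.star_mul, uz_star, ← map_star, hs']
  have e2 : ι y * uz hu k = star (ι s' * uz hu (-k)) := by rw [← e1, star_star]
  rw [e1, e2, StarMul.star_mul, uz_star, neg_neg, mul_assoc, ← mul_assoc (uz hu (-k)), ← uz_add]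
  simp [uz_zero, map_star]

/-- off-diagonal corner estimate -/
lemma offd [PartialOrder C] [StarOrderedRing C] {c S : C} (hS : star S * S = 1) {M m : ℝ}
    (hcM : ‖c‖ ^ 2 ≤ M) (hMm : 0 ≤ M - m)
    (h : algebraMap ℝ C m ≤ star (star S * c * S) * (star S * c * S)) :
    ‖(1 - S * star S) * c * S‖ ^ 2 ≤ M - m := by
  have hSn := norm_le_one_of_iso hS
  set R := (1 - S * star S) * c * S with hR
  have hP : (1 - S * star S) * (1 - S * star S) = 1 - S * star S := by
    have : S * star S * (S * star S) = S * star S := by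
      rw [mul_assoc, ← mul_assoc (star S), hS, one_mul]
    rw [mul_sub, sub_mul, sub_mul, this]; simp
  have e : star R * R = star (c * S) * (c * S) - star (star S * c * S) * (star S * c * S) := by
    have e1 : star R * R = star (c * S) * ((1 - S * star S) * (1 - S * star S)) * (c * S) := by
      rw [hR]; simp only [StarMul.star_mul, star_sub, star_one, star_star, mul_assoc]
    rw [e1, hP, mul_sub, sub_mul, mul_one]
    simp only [StarMul.star_mul, star_star, mul_assoc]
  have h1 : star (c * S) * (c * S) ≤ algebraMap ℝ C M := by
    rw [← CStarAlgebra.norm_le_iff_le_algebraMap _ (le_trans (sq_nonneg _) hcM) (star_mul_self_nonneg _),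
      CStarRing.norm_star_mul_self]
    have h2 : ‖c * S‖ ≤ ‖c‖ := norm_mul_r_le le_rfl hSn
    nlinarith [norm_nonneg (c * S), norm_nonneg c]
  have h3 : star R * R ≤ algebraMap ℝ C (M - m) := by
    rw [e, map_sub]; exact sub_le_sub h1 h
  rw [← CStarAlgebra.norm_le_iff_le_algebraMap _ hMm (star_mul_self_nonneg _),
      CStarRing.norm_star_mul_self] at h3
  rwa [sq]

end pisec


section pisec2
variable {A C : Type*} [CStarAlgebra A] [CStarAlgebra C]

lemma IsoA.combo {ι : A →⋆ₐ[ℂ] C} {t1 t2 : A} (h1 : star t1 * t1 = 1) (h2 : star t2 * t2 = 1)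
    (h12 : star t1 * t2 = 0) {W : C} (hW : IsoA ι W) :
    ∃ S : C, IsoA ι S ∧ (Real.sqrt 2) • S = ι t1 + ι t2 * W := by
  obtain ⟨w, hw, rfl⟩ := hW
  have h21 : star t2 * t1 = 0 := by
    rw [← star_star t1, ← StarMul.star_mul, h12, star_zero]
  have e : star (t1 + t2 * w) * (t1 + t2 * w) = (2 : ℝ) • (1 : A) := by
    have : star (t1 + t2 * w) * (t1 + t2 * w) = star t1 * t1 + star t1 * t2 * w
        + star w * (star t2 * t1) + star w * (star t2 * t2) * w := by
      rw [star_add, StarMul.star_mul]; noncomm_ring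
    rw [this, h1, h2, h12, h21, zero_mul, mul_zero, mul_one, hw, two_smul]; simp
  have hs2 : Real.sqrt 2 ≠ 0 := by positivity
  refine ⟨ι ((Real.sqrt 2)⁻¹ • (t1 + t2 * w)), ⟨_, ?_, rfl⟩, ?_⟩
  · rw [star_smul, smul_mul_smul_comm, e, smul_smul, star_trivial, ← mul_inv,
      Real.mul_self_sqrt (by norm_num), inv_mul_cancel₀ (by norm_num), one_smul]
  · have : ι ((Real.sqrt 2)⁻¹ • (t1 + t2 * w)) = (Real.sqrt 2)⁻¹ • ι (t1 + t2 * w) := by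
      rw [← Complex.coe_smul, map_smul, Complex.coe_smul]
    rw [this, smul_smul, mul_inv_cancel₀ hs2, one_smul, map_add, map_mul]

lemma rigid_core {ι : A →⋆ₐ[ℂ] C} {t1 t2 : A} (h1 : star t1 * t1 = 1) (h2 : star t2 * t2 = 1)
    (h12 : star t1 * t2 = 0) {c : C} {κ : ℝ} (hκ : 0 ≤ κ)
    (H : ∀ S, IsoA ι S → ‖(1 - S * star S) * c * S‖ ≤ κ) (W : C) (hW : IsoA ι W) :
    ‖star (ι t1) * c * ι t1 * W - W * (star (ι t1) * c * ι t1)‖ ≤ 13 * κ := by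
  have i1 : IsoA ι (ι t1) := ⟨t1, h1, rfl⟩
  have i2 : IsoA ι (ι t2) := ⟨t2, h2, rfl⟩
  set T1 := ι t1 with hT1
  set T2 := ι t2 with hT2
  have h12' : star T1 * T2 = 0 := by rw [hT1, hT2, ← map_star, ← map_mul, h12, map_zero]
  have h21' : star T2 * T1 = 0 := by
    rw [← star_star T1, ← StarMul.star_mul, h12', star_zero]
  have o1 : ‖star T2 * c * T1‖ ≤ κ := by
    have e : star T2 * c * T1 = star T2 * ((1 - T1 * star T1) * c * T1) := by
      have : star T2 * ((1 - T1 * star T1) * c * T1)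
        = star T2 * c * T1 - star T2 * T1 * (star T1 * c * T1) := by noncomm_ring
      rw [this, h21', zero_mul, sub_zero]
    rw [e]; exact norm_mul_l_le (by rw [norm_star]; exact i2.norm_le) (H _ i1)
  have o2 : ‖star T1 * c * T2‖ ≤ κ := by
    have e : star T1 * c * T2 = star T1 * ((1 - T2 * star T2) * c * T2) := by
      have : star T1 * ((1 - T2 * star T2) * c * T2)
        = star T1 * c * T2 - star T1 * T2 * (star T2 * c * T2) := by noncomm_ring
      rw [this, h12', zero_mul, sub_zero]
    rw [e]; exact norm_mul_l_le (by rw [norm_star]; exact i1.norm_le) (H _ i2)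
  have key : ∀ V, IsoA ι V → ‖star T1 * c * T1 - star V * (star T2 * c * T2) * V‖ ≤ 6 * κ := by
    intro V hV
    obtain ⟨S, hS, hSe⟩ := IsoA.combo h1 h2 h12 hV
    rw [← hT1, ← hT2] at hSe
    have hs0 : (0:ℝ) ≤ Real.sqrt 2 := Real.sqrt_nonneg 2
    have hs2 : Real.sqrt 2 ≤ 2 := by
      rw [Real.sqrt_le_left (by norm_num)]; norm_num
    have hr : star (T1 - T2 * V) * S = 0 := by
      have e : star (T1 - T2 * V) * (T1 + T2 * V) = 0 := by
        have : star (T1 - T2 * V) * (T1 + T2 * V) = star T1 * T1 + star T1 * T2 * V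
          - star V * (star T2 * T1) - star V * (star T2 * T2) * V := by
          rw [star_sub, StarMul.star_mul]; noncomm_ring
        rw [this, i1.star_mul, i2.star_mul, h12', h21', zero_mul, mul_zero, mul_one, hV.star_mul]
        simp
      rw [← hSe, mul_smul_comm] at e
      exact (smul_eq_zero.1 e).resolve_left (by positivity)
    have e1 : star (T1 - T2 * V) * c * (T1 + T2 * V)
        = Real.sqrt 2 • (star (T1 - T2 * V) * ((1 - S * star S) * c * S)) := by
      rw [← hSe, mul_smul_comm]
      congr 1
      have : star (T1 - T2 * V) * ((1 - S * star S) * c * S)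
        = star (T1 - T2 * V) * c * S - star (T1 - T2 * V) * S * (star S * c * S) := by noncomm_ring
      rw [this, hr, zero_mul, sub_zero]
    have n1 : ‖star (T1 - T2 * V)‖ ≤ 2 := by
      rw [norm_star]
      have a1 := norm_sub_le T1 (T2 * V)
      have a2 := i1.norm_le
      have a3 := (i2.mul hV).norm_le
      linarith
    have n2 : ‖star (T1 - T2 * V) * c * (T1 + T2 * V)‖ ≤ 4 * κ := by
      rw [e1, norm_smul, Real.norm_of_nonneg hs0]
      have a1 := norm_mul_le (star (T1 - T2 * V)) ((1 - S * star S) * c * S)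
      have a2 := H S hS
      have a3 : ‖star (T1 - T2 * V)‖ * ‖(1 - S * star S) * c * S‖ ≤ 2 * κ :=
        mul_le_mul n1 a2 (norm_nonneg _) (by norm_num)
      have a4 := mul_le_mul hs2 (a1.trans a3) (norm_nonneg _) (by norm_num)
      linarith
    have e2 : star T1 * c * T1 - star V * (star T2 * c * T2) * V
        = star (T1 - T2 * V) * c * (T1 + T2 * V) - star T1 * c * T2 * V
          + star V * (star T2 * c * T1) := by
      rw [star_sub, StarMul.star_mul]; noncomm_ring
    rw [e2]
    have b1 : ‖star T1 * c * T2 * V‖ ≤ κ := norm_mul_r_le o2 hV.norm_le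
    have b2 : ‖star V * (star T2 * c * T1)‖ ≤ κ :=
      norm_mul_l_le (by rw [norm_star]; exact hV.norm_le) o1
    have b3 := norm_add_le (star (T1 - T2 * V) * c * (T1 + T2 * V) - star T1 * c * T2 * V)
      (star V * (star T2 * c * T1))
    have b4 := norm_sub_le (star (T1 - T2 * V) * c * (T1 + T2 * V)) (star T1 * c * T2 * V)
    linarith
  have k1 := key 1 (IsoA.one ι)
  rw [star_one, one_mul, mul_one] at k1
  have k2 := key W hW
  have hWs : ‖star W‖ ≤ 1 := by rw [norm_star]; exact hW.norm_le
  have k3 : ‖star W * (star T1 * c * T1 - star T2 * c * T2) * W‖ ≤ 6 * κ :=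
    norm_mul3_le hWs k1 hW.norm_le
  have k4 : ‖star W * (star T1 * c * T1) * W - star T1 * c * T1‖ ≤ 12 * κ := by
    have e : star W * (star T1 * c * T1) * W - star T1 * c * T1
      = star W * (star T1 * c * T1 - star T2 * c * T2) * W
        - (star T1 * c * T1 - star W * (star T2 * c * T2) * W) := by noncomm_ring
    rw [e]
    have := norm_sub_le (star W * (star T1 * c * T1 - star T2 * c * T2) * W)
      (star T1 * c * T1 - star W * (star T2 * c * T2) * W)
    linarith
  have k5 : ‖(1 - W * star W) * (star T1 * c * T1) * W‖ ≤ κ := by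
    have e : (1 - W * star W) * (star T1 * c * T1) * W
        = star T1 * ((1 - T1 * W * star (T1 * W)) * c * (T1 * W)) := by
      have : star T1 * ((1 - T1 * W * star (T1 * W)) * c * (T1 * W))
        = star T1 * c * T1 * W - star T1 * T1 * W * star W * star T1 * c * T1 * W := by
        rw [StarMul.star_mul]; noncomm_ring
      rw [this, i1.star_mul]; noncomm_ring
    rw [e]
    exact norm_mul_l_le (by rw [norm_star]; exact i1.norm_le) (H _ (i1.mul hW))
  have k6 : ‖W * (star W * (star T1 * c * T1) * W - star T1 * c * T1)‖ ≤ 12 * κ :=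
    norm_mul_l_le hW.norm_le k4
  have e : star T1 * c * T1 * W - W * (star T1 * c * T1)
    = (1 - W * star W) * (star T1 * c * T1) * W
      + W * (star W * (star T1 * c * T1) * W - star T1 * c * T1) := by noncomm_ring
  rw [e]
  have := norm_add_le ((1 - W * star W) * (star T1 * c * T1) * W)
    (W * (star W * (star T1 * c * T1) * W - star T1 * c * T1))
  linarith

lemma rigid [PartialOrder A] [StarOrderedRing A]
    (hPI : ∀ g : A, 0 ≤ g → g ≠ 0 → ∃ x, 1 = star x * g * x)
    {α : A ≃⋆ₐ[ℂ] A} {ι : A →⋆ₐ[ℂ] C} (hι : Isometry ι) {u : C} (hu : u ∈ unitary C)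
    (hcov : ∀ a : A, u * ι a * star u = ι (α a))
    {t1 t2 : A} (h1 : star t1 * t1 = 1) (h2 : star t2 * t2 = 1)
    (h12 : star t1 * t2 = 0) {c : C} (hc : HomE ι hu c) {κ : ℝ} (hκ : 0 < κ) :
    ∃ S, IsoA ι S ∧ ∀ W, IsoA ι W → ‖star S * c * S * W - W * (star S * c * S)‖ ≤ κ := by
  let _ := CStarAlgebra.spectralOrder C
  let _ := CStarAlgebra.spectralOrderedRing C
  set Z : Set ℝ := {x | ∃ S, IsoA ι S ∧ x = ‖star S * c * S‖} with hZ
  have hZn : Z.Nonempty := ⟨_, 1, IsoA.one ι, rfl⟩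
  have hZb : BddBelow Z := ⟨0, by rintro _ ⟨S, -, rfl⟩; exact norm_nonneg _⟩
  set δ := sInf Z with hδ
  have hδ0 : 0 ≤ δ := Real.sInf_nonneg (by rintro _ ⟨S, -, rfl⟩; exact norm_nonneg _)
  have hle : ∀ S, IsoA ι S → δ ≤ ‖star S * c * S‖ := fun S hS => csInf_le hZb ⟨S, hS, rfl⟩
  set κ' := κ / 13 with hκ'
  have hκ'0 : 0 < κ' := by positivity
  rcases hδ0.eq_or_lt with h0 | hpos
  · obtain ⟨_, ⟨S, hS, rfl⟩, hlt⟩ := exists_lt_of_csInf_lt hZn (show sInf Z < κ / 2 by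
      rw [← hδ, ← h0]; positivity)
    refine ⟨S, hS, fun W hW => ?_⟩
    have a1 : ‖star S * c * S * W‖ ≤ κ / 2 := norm_mul_r_le hlt.le hW.norm_le
    have a2 : ‖W * (star S * c * S)‖ ≤ κ / 2 := norm_mul_l_le hW.norm_le hlt.le
    have := norm_sub_le (star S * c * S * W) (W * (star S * c * S))
    linarith
  set ρ := min 1 (κ' ^ 2 / (2 * (2 * δ + 1))) with hρ
  have hρ0 : 0 < ρ := lt_min one_pos (by positivity)
  have hρ1 : ρ ≤ 1 := min_le_left _ _
  have hρ2 : ρ * (2 * δ + 1) ≤ κ' ^ 2 / 2 := by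
    have : ρ ≤ κ' ^ 2 / (2 * (2 * δ + 1)) := min_le_right _ _
    rw [le_div_iff₀ (by positivity)] at this
    linarith
  obtain ⟨_, ⟨S0, hS0, rfl⟩, hlt⟩ := exists_lt_of_csInf_lt hZn (show sInf Z < δ + ρ by
    rw [← hδ]; linarith)
  set c0 := star S0 * c * S0 with hc0
  have hc0h : HomE ι hu c0 := hc.compress hu hcov hS0
  set m := max 0 (δ ^ 2 - κ' ^ 2 / 2) with hm
  have hm0 : 0 ≤ m := le_max_left _ _
  have hm1 : m < δ ^ 2 := max_lt (by positivity) (by nlinarith)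
  have hm2 : δ ^ 2 - κ' ^ 2 / 2 ≤ m := le_max_right _ _
  have hM : ‖c0‖ ^ 2 ≤ (δ + ρ) ^ 2 := pow_le_pow_left₀ (norm_nonneg _) hlt.le 2
  have H : ∀ S, IsoA ι S → ‖(1 - S * star S) * c0 * S‖ ≤ κ' := by
    intro S hS
    have hcs : HomE ι hu (star S * c0 * S) := hc0h.compress hu hcov hS
    obtain ⟨y, hy⟩ := hcs.sq hu hcov
    have hlow : algebraMap ℝ A m ≤ star y * y := by
      refine pi_lower hPI (star_mul_self_nonneg y) hm0 hm1 fun s hs => ?_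
      have hI : IsoA ι (ι s) := ⟨s, hs, rfl⟩
      have b1 := hle _ ((hS0.mul hS).mul hI)
      have e : star (S0 * S * ι s) * c * (S0 * S * ι s)
          = star (ι s) * (star S * c0 * S * ι s) := by
        rw [hc0]; simp only [StarMul.star_mul, mul_assoc]
      rw [e] at b1
      have b2 : δ ≤ ‖star S * c0 * S * ι s‖ :=
        b1.trans (norm_mul_l_le (by rw [norm_star]; exact hI.norm_le) le_rfl)
      have b3 : ‖star s * (star y * y) * s‖ = ‖star S * c0 * S * ι s‖ ^ 2 := by
        rw [← (AddMonoidHomClass.isometry_iff_norm ι).1 hι, sq, ← CStarRing.norm_star_mul_self]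
        congr 1
        rw [map_mul, map_mul, ← hy, map_star]
        simp only [StarMul.star_mul, mul_assoc]
      rw [b3]
      exact pow_le_pow_left₀ hδ0 b2 2
    have hlow' : algebraMap ℝ C m ≤ star (star S * c0 * S) * (star S * c0 * S) := by
      rw [hy, ← sub_nonneg]
      obtain ⟨b, hb⟩ := isPos_of_nonneg (sub_nonneg.2 hlow)
      have : ι (star y * y) - algebraMap ℝ C m = star (ι b) * ι b := by
        rw [← map_star, ← map_mul, ← hb, map_sub]
        congr 1
        exact (((ι : A →ₐ[ℂ] C).restrictScalars ℝ).commutes m).symm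
      rw [this]; exact star_mul_self_nonneg _
    have hMm : (δ + ρ) ^ 2 - m ≤ κ' ^ 2 := by nlinarith
    have := offd hS.star_mul hM (by nlinarith) hlow'
    exact (le_abs_self _).trans (abs_le_of_sq_le_sq (this.trans hMm) hκ'0.le)
  refine ⟨S0 * ι t1, hS0.mul ⟨t1, h1, rfl⟩, fun W hW => ?_⟩
  have := rigid_core h1 h2 h12 hκ'0.le H W hW
  have e : star (S0 * ι t1) * c * (S0 * ι t1) = star (ι t1) * c0 * ι t1 := by
    rw [hc0]; simp only [StarMul.star_mul, mul_assoc]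
  rw [e]
  have e13 : 13 * κ' = κ := by rw [hκ']; ring
  linarith

end pisec2


section pisec3
variable {A C : Type*} [CStarAlgebra A] [CStarAlgebra C]

lemma ac_persist {ι : A →⋆ₐ[ℂ] C} {c : C} {κ : ℝ}
    (H : ∀ W, IsoA ι W → ‖c * W - W * c‖ ≤ κ) {S : C} (hS : IsoA ι S) (W : C) (hW : IsoA ι W) :
    ‖star S * c * S * W - W * (star S * c * S)‖ ≤ 3 * κ := by
  have h1 : ‖star S * c * S - c‖ ≤ κ := by
    have e : star S * c * S - c = star S * (c * S - S * c) := by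
      rw [mul_sub, ← mul_assoc (star S) S, hS.star_mul, one_mul, mul_assoc]
    rw [e]; exact norm_mul_l_le (by rw [norm_star]; exact hS.norm_le) (H S hS)
  have e : star S * c * S * W - W * (star S * c * S)
      = (star S * c * S - c) * W + (c * W - W * c) - W * (star S * c * S - c) := by noncomm_ring
  rw [e]
  have a1 : ‖(star S * c * S - c) * W‖ ≤ κ := norm_mul_r_le h1 hW.norm_le
  have a2 : ‖W * (star S * c * S - c)‖ ≤ κ := norm_mul_l_le hW.norm_le h1
  have a3 := H W hW
  have a4 := norm_sub_le ((star S * c * S - c) * W + (c * W - W * c)) (W * (star S * c * S - c))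
  have a5 := norm_add_le ((star S * c * S - c) * W) (c * W - W * c)
  linarith

/-- after compression by an isometry every element becomes almost central relative to `A` -/
lemma ac_all [PartialOrder A] [StarOrderedRing A]
    (hPI : ∀ g : A, 0 ≤ g → g ≠ 0 → ∃ x, 1 = star x * g * x)
    {α : A ≃⋆ₐ[ℂ] A} {ι : A →⋆ₐ[ℂ] C} (hι : Isometry ι) {u : C} (hu : u ∈ unitary C)
    (hcov : ∀ a : A, u * ι a * star u = ι (α a))
    (hgen : (StarAlgebra.adjoin ℂ (Set.range ι ∪ {u})).topologicalClosure = ⊤)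
    {t1 t2 : A} (h1 : star t1 * t1 = 1) (h2 : star t2 * t2 = 1)
    (h12 : star t1 * t2 = 0) (c : C) : ∀ κ : ℝ, 0 < κ → ∀ S0, IsoA ι S0 →
    ∃ S, IsoA ι S ∧ ∀ W, IsoA ι W →
      ‖star (S0 * S) * c * (S0 * S) * W - W * (star (S0 * S) * c * (S0 * S))‖ ≤ κ := by
  refine cross_induction hu hcov hgen (fun c => ∀ κ : ℝ, 0 < κ → ∀ S0, IsoA ι S0 →
    ∃ S, IsoA ι S ∧ ∀ W, IsoA ι W →
      ‖star (S0 * S) * c * (S0 * S) * W - W * (star (S0 * S) * c * (S0 * S))‖ ≤ κ) ?_ ?_ ?_ c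
  · intro a k κ hκ S0 hS0
    have hh : HomE ι hu (ι a * uz hu k) := ⟨a, k, rfl⟩
    obtain ⟨S, hS, H⟩ := rigid hPI hι hu hcov h1 h2 h12 (hh.compress hu hcov hS0) hκ
    refine ⟨S, hS, fun W hW => ?_⟩
    have e : star (S0 * S) * (ι a * uz hu k) * (S0 * S)
      = star S * (star S0 * (ι a * uz hu k) * S0) * S := by
      simp only [StarMul.star_mul, mul_assoc]
    rw [e]; exact H W hW
  · intro b c hb hc κ hκ S0 hS0
    obtain ⟨S1, hS1, H1⟩ := hb (κ / 6) (by positivity) S0 hS0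
    obtain ⟨S2, hS2, H2⟩ := hc (κ / 2) (by positivity) (S0 * S1) (hS0.mul hS1)
    refine ⟨S1 * S2, hS1.mul hS2, fun W hW => ?_⟩
    have a1 := ac_persist H1 hS2 W hW
    have a2 := H2 W hW
    have e : star (S0 * (S1 * S2)) * (b + c) * (S0 * (S1 * S2)) * W
        - W * (star (S0 * (S1 * S2)) * (b + c) * (S0 * (S1 * S2)))
      = (star S2 * (star (S0 * S1) * b * (S0 * S1)) * S2 * W
          - W * (star S2 * (star (S0 * S1) * b * (S0 * S1)) * S2))
        + (star (S0 * S1 * S2) * c * (S0 * S1 * S2) * W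
          - W * (star (S0 * S1 * S2) * c * (S0 * S1 * S2))) := by
      simp only [StarMul.star_mul]; noncomm_ring
    rw [e]
    refine (norm_add_le _ _).trans ?_
    linarith
  · intro c hc κ hκ S0 hS0
    obtain ⟨c', hcc, hc'⟩ := hc (κ / 4) (by positivity)
    obtain ⟨S, hS, H⟩ := hc' (κ / 2) (by positivity) S0 hS0
    refine ⟨S, hS, fun W hW => ?_⟩
    have hI := hS0.mul hS
    have a0 : ‖star (S0 * S) * (c - c') * (S0 * S)‖ ≤ κ / 4 :=
      norm_mul3_le (by rw [norm_star]; exact hI.norm_le) hcc.le hI.norm_le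
    have a1 : ‖star (S0 * S) * (c - c') * (S0 * S) * W‖ ≤ κ / 4 := norm_mul_r_le a0 hW.norm_le
    have a2 : ‖W * (star (S0 * S) * (c - c') * (S0 * S))‖ ≤ κ / 4 := norm_mul_l_le hW.norm_le a0
    have e : star (S0 * S) * c * (S0 * S) * W - W * (star (S0 * S) * c * (S0 * S))
      = (star (S0 * S) * c' * (S0 * S) * W - W * (star (S0 * S) * c' * (S0 * S)))
        + (star (S0 * S) * (c - c') * (S0 * S) * W
        - W * (star (S0 * S) * (c - c') * (S0 * S))) := by noncomm_ring
    rw [e]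
    refine (norm_add_le _ _).trans ?_
    have := H W hW
    have := norm_sub_le (star (S0 * S) * (c - c') * (S0 * S) * W)
      (W * (star (S0 * S) * (c - c') * (S0 * S)))
    linarith

lemma ac_finset [PartialOrder A] [StarOrderedRing A]
    (hPI : ∀ g : A, 0 ≤ g → g ≠ 0 → ∃ x, 1 = star x * g * x)
    {α : A ≃⋆ₐ[ℂ] A} {ι : A →⋆ₐ[ℂ] C} (hι : Isometry ι) {u : C} (hu : u ∈ unitary C)
    (hcov : ∀ a : A, u * ι a * star u = ι (α a))
    (hgen : (StarAlgebra.adjoin ℂ (Set.range ι ∪ {u})).topologicalClosure = ⊤)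
    {t1 t2 : A} (h1 : star t1 * t1 = 1) (h2 : star t2 * t2 = 1)
    (h12 : star t1 * t2 = 0) (F : Finset C) : ∀ κ : ℝ, 0 < κ →
    ∃ S, IsoA ι S ∧ ∀ c ∈ F, ∀ W, IsoA ι W →
      ‖star S * c * S * W - W * (star S * c * S)‖ ≤ κ := by
  classical
  induction F using Finset.induction_on with
  | empty => intro κ hκ; exact ⟨1, IsoA.one ι, by simp⟩
  | insert c F hcF ih =>
    intro κ hκ
    obtain ⟨S0, hS0, H0⟩ := ih (κ / 3) (by positivity)
    obtain ⟨S, hS, H⟩ := ac_all hPI hι hu hcov hgen h1 h2 h12 c κ hκ S0 hS0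
    refine ⟨S0 * S, hS0.mul hS, fun d hd W hW => ?_⟩
    rcases Finset.mem_insert.1 hd with rfl | hd
    · exact H W hW
    · have a1 := ac_persist (H0 d hd) hS W hW
      have e : star (S0 * S) * d * (S0 * S) = star S * (star S0 * d * S0) * S := by
        simp only [StarMul.star_mul, mul_assoc]
      rw [e]; linarith

lemma orth_isos {t1 t2 : A} (h1 : star t1 * t1 = 1) (h2 : star t2 * t2 = 1)
    (h12 : star t1 * t2 = 0) (i j : ℕ) :
    star (t2 ^ i * t1) * (t2 ^ j * t1) = if i = j then 1 else 0 := by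
  have h21 : star t2 * t1 = 0 := by
    rw [← star_star t1, ← StarMul.star_mul, h12, star_zero]
  induction i generalizing j with
  | zero =>
    cases j with
    | zero => simp [h1]
    | succ j =>
      rw [pow_zero, one_mul, pow_succ', mul_assoc, ← mul_assoc, h12, zero_mul]; simp
  | succ i ih =>
    cases j with
    | zero =>
      rw [pow_zero, one_mul, pow_succ', StarMul.star_mul, StarMul.star_mul, mul_assoc, mul_assoc, h21]; simp
    | succ j =>
      have := ih j
      have e : star (t2 ^ (i + 1) * t1) * (t2 ^ (j + 1) * t1)
          = star (t2 ^ i * t1) * (star t2 * t2) * (t2 ^ j * t1) := by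
        rw [pow_succ', pow_succ']; simp only [StarMul.star_mul, mul_assoc]
      rw [e, h2, mul_one, this]; simp

lemma pi_dom [PartialOrder A] [StarOrderedRing A] [PartialOrder C] [StarOrderedRing C]
    (hPI : ∀ g : A, 0 ≤ g → g ≠ 0 → ∃ x, 1 = star x * g * x)
    {α : A ≃⋆ₐ[ℂ] A} {ι : A →⋆ₐ[ℂ] C} (hι : Isometry ι) {u : C} (hu : u ∈ unitary C)
    (hcov : ∀ a : A, u * ι a * star u = ι (α a))
    (hgen : (StarAlgebra.adjoin ℂ (Set.range ι ∪ {u})).topologicalClosure = ⊤)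
    (hC : IsSimpleCStar C)
    {t1 t2 : A} (h1 : star t1 * t1 = 1) (h2 : star t2 * t2 = 1)
    (h12 : star t1 * t2 = 0) {a : C} (ha : 0 ≤ a) (ha0 : a ≠ 0) : Dom 1 a := by
  classical
  obtain ⟨n, w, hw⟩ := simple_sum_pos hC ha ha0
  set κ : ℝ := 1 / (2 * (n * n + 1)) with hκ
  have hκ0 : 0 < κ := by positivity
  obtain ⟨S, hS, H⟩ := ac_finset hPI hι hu hcov hgen h1 h2 h12
    (Finset.univ.image (fun p : Fin n × Fin n => star (w p.1) * a * w p.2)) κ hκ0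
  set τ : Fin n → C := fun i => ι (t2 ^ (i : ℕ) * t1) with hτ
  have hττ : ∀ i j, star (τ i) * τ j = if i = j then 1 else 0 := by
    intro i j
    rw [hτ]
    simp only
    rw [← map_star, ← map_mul, orth_isos h1 h2 h12]
    by_cases hij : i = j
    · simp [hij]
    · have : (i : ℕ) ≠ j := fun h => hij (Fin.ext h)
      simp [hij, this]
  have hτI : ∀ i, IsoA ι (τ i) := fun i =>
    ⟨_, by rw [orth_isos h1 h2 h12]; simp, rfl⟩
  set d : Fin n → Fin n → C := fun i j => star S * (star (w i) * a * w j) * S with hd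
  refine Dom.of_norm_lt (x := ∑ i, w i * S * τ i) ⟨IsSelfAdjoint.one C, by simp [IsIdempotentElem]⟩
    ha.isSelfAdjoint ?_
  have e1 : star (∑ i, w i * S * τ i) * a * (∑ i, w i * S * τ i)
      = ∑ i, ∑ j, star (τ i) * (d i j * τ j) := by
    rw [star_sum, Finset.sum_mul, Finset.sum_mul]
    refine Finset.sum_congr rfl fun i _ => ?_
    rw [Finset.mul_sum]
    refine Finset.sum_congr rfl fun j _ => ?_
    rw [hd]
    simp only [StarMul.star_mul, mul_assoc]
  have e2 : (1 : C) = ∑ i, ∑ j, star (τ i) * (τ j * d i j) := by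
    have : ∀ i, ∑ j, star (τ i) * (τ j * d i j) = d i i := by
      intro i
      rw [Finset.sum_eq_single i]
      · rw [← mul_assoc, hττ]; simp
      · intro j _ hj
        rw [← mul_assoc, hττ, if_neg (Ne.symm hj), zero_mul]
      · simp
    simp only [this]
    rw [hd]
    simp only
    rw [← Finset.sum_mul, ← Finset.mul_sum, ← hw, mul_one, hS.star_mul]
  have e3 : 1 - star (∑ i, w i * S * τ i) * a * (∑ i, w i * S * τ i)
      = ∑ i, ∑ j, star (τ i) * (τ j * d i j - d i j * τ j) := by
    rw [e1]
    conv_lhs => rw [e2]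
    rw [← Finset.sum_sub_distrib]
    refine Finset.sum_congr rfl fun i _ => ?_
    rw [← Finset.sum_sub_distrib]
    refine Finset.sum_congr rfl fun j _ => ?_
    rw [mul_sub]
  rw [e3]
  have b : ∀ i j, ‖star (τ i) * (τ j * d i j - d i j * τ j)‖ ≤ κ := by
    intro i j
    refine norm_mul_l_le (by rw [norm_star]; exact (hτI i).norm_le) ?_
    rw [norm_sub_rev]
    exact H _ (Finset.mem_image.2 ⟨(i, j), Finset.mem_univ _, rfl⟩) _ (hτI j)
  have b2 : ‖∑ i, ∑ j, star (τ i) * (τ j * d i j - d i j * τ j)‖ ≤ ∑ i : Fin n, ∑ j : Fin n, κ :=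
    (norm_sum_le _ _).trans (Finset.sum_le_sum fun i _ =>
      (norm_sum_le _ _).trans (Finset.sum_le_sum fun j _ => b i j))
  refine b2.trans ?_
  simp only [Finset.sum_const, Finset.card_univ, Fintype.card_fin, nsmul_eq_mul]
  rw [hκ, ← mul_assoc, mul_one_div, div_le_div_iff₀ (by positivity) (by norm_num)]
  nlinarith

/-- two orthogonal isometries, or the algebra is scalar -/
lemma isos_or_scalar [PartialOrder A] [StarOrderedRing A] [Nontrivial A]
    (hPI : ∀ g : A, 0 ≤ g → g ≠ 0 → ∃ x, 1 = star x * g * x) :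
    (∃ t1 t2 : A, star t1 * t1 = 1 ∧ star t2 * t2 = 1 ∧ star t1 * t2 = 0) ∨
    (∀ a : A, ∃ z : ℂ, a = algebraMap ℂ A z) := by
  by_cases hsc : ∀ h : A, IsSelfAdjoint h → ∃ m : ℝ, h = algebraMap ℝ A m
  · right
    intro a
    obtain ⟨x, hx⟩ := hsc _ (realPart a).2
    obtain ⟨y, hy⟩ := hsc _ (imaginaryPart a).2
    refine ⟨x + Complex.I * y, ?_⟩
    rw [← realPart_add_I_smul_imaginaryPart a, hx, hy]
    rw [IsScalarTower.algebraMap_apply ℝ ℂ A, IsScalarTower.algebraMap_apply ℝ ℂ A, map_add, map_mul,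
      Algebra.smul_def]
    rfl
  · left
    push Not at hsc
    obtain ⟨h, hh, hne⟩ := hsc
    have key : ∀ l ∈ spectrum ℝ h, ∀ l' ∈ spectrum ℝ h, l < l' →
        ∃ t1 t2 : A, star t1 * t1 = 1 ∧ star t2 * t2 = 1 ∧ star t1 * t2 = 0 := by
      intro l hl l' hl' hlt
      set m := (l + l') / 2 with hm
      set k := h - algebraMap ℝ A m with hk
      have hksa : IsSelfAdjoint k := hh.sub (IsSelfAdjoint.algebraMap A (IsSelfAdjoint.all m))
      have hp : k⁺ ≠ 0 := by
        intro h0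
        rw [CFC.posPart_eq_zero_iff k hksa, hk, sub_nonpos, le_algebraMap_iff_spectrum_le hh] at h0
        have := h0 l' hl'
        linarith
      have hq : k⁻ ≠ 0 := by
        intro h0
        rw [CFC.negPart_eq_zero_iff k hksa, hk, sub_nonneg, algebraMap_le_iff_le_spectrum hh] at h0
        have := h0 l hl
        linarith
      have hp0 := CFC.posPart_nonneg k
      have hq0 := CFC.negPart_nonneg k
      have hps := hp0.isSelfAdjoint.star_eq
      have hqs := hq0.isSelfAdjoint.star_eq
      obtain ⟨x, hx⟩ := hPI (k⁺ * k⁺) (by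
        have := star_mul_self_nonneg (k⁺); rwa [hps] at this) (sq_ne_zero' hp0.isSelfAdjoint hp)
      obtain ⟨y, hy⟩ := hPI (k⁻ * k⁻) (by
        have := star_mul_self_nonneg (k⁻); rwa [hqs] at this) (sq_ne_zero' hq0.isSelfAdjoint hq)
      refine ⟨k⁺ * x, k⁻ * y, ?_, ?_, ?_⟩
      · rw [hx, StarMul.star_mul, hps]; simp only [mul_assoc]
      · rw [hy, StarMul.star_mul, hqs]; simp only [mul_assoc]
      · rw [StarMul.star_mul, hps, mul_assoc, ← mul_assoc k⁺, CFC.posPart_mul_negPart]; simp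
    obtain ⟨l, hl⟩ := ContinuousFunctionalCalculus.spectrum_nonempty (R := ℝ) h hh
    by_cases hex : ∃ l' ∈ spectrum ℝ h, l' ≠ l
    · obtain ⟨l', hl', hll⟩ := hex
      rcases lt_or_gt_of_ne hll with hlt | hlt
      · exact key l' hl' l hl hlt
      · exact key l hl l' hl' hlt
    · push Not at hex
      refine absurd ?_ (hne l)
      refine le_antisymm ?_ ?_
      · rw [le_algebraMap_iff_spectrum_le hh]
        exact fun x hx => (hex x hx).le
      · rw [algebraMap_le_iff_le_spectrum hh]
        exact fun x hx => (hex x hx).ge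

lemma main_PI (hPI0 : ∀ x : A, IsPos x → x ≠ 0 → CuntzLE 1 x)
    (α : A ≃⋆ₐ[ℂ] A) (hCsimple : IsSimpleCStar C)
    (ι : A →⋆ₐ[ℂ] C) (hι : Isometry ι)
    (u : C) (hu : u ∈ unitary C)
    (hcov : ∀ a : A, u * ι a * star u = ι (α a))
    (hgen : (StarAlgebra.adjoin ℂ (Set.range ι ∪ {u})).topologicalClosure = ⊤) :
    TracialRankZero C := by
  classical
  let _ := CStarAlgebra.spectralOrder A
  let _ := CStarAlgebra.spectralOrderedRing A
  let _ := CStarAlgebra.spectralOrder C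
  let _ := CStarAlgebra.spectralOrderedRing C
  have p1 : IsProjection (1 : A) := ⟨IsSelfAdjoint.one A, by simp [IsIdempotentElem]⟩
  have q1 : IsProjection (1 : C) := ⟨IsSelfAdjoint.one C, by simp [IsIdempotentElem]⟩
  have hPI : ∀ g : A, 0 ≤ g → g ≠ 0 → ∃ x, 1 = star x * g * x := by
    intro g hg hg0
    have h1 := (hPI0 g (isPos_of_nonneg hg) hg0).dom p1 hg.isSelfAdjoint
    exact (h1.trans (Dom.sq hg)).proj_eq p1
  intro F ε hε a ha ha0
  have hap := isPos_nonneg ha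
  have hCn : Nontrivial C := ⟨⟨a, 0, ha0⟩⟩
  have hAn : Nontrivial A := by
    refine ⟨⟨1, 0, fun h => ?_⟩⟩
    have := congrArg ι h
    rw [map_one, map_zero] at this
    exact one_ne_zero this
  have haa : 0 ≤ a * a := by
    have := star_mul_self_nonneg a
    rwa [hap.isSelfAdjoint.star_eq] at this
  have haa0 := sq_ne_zero' hap.isSelfAdjoint ha0
  have hdom : Dom 1 (a * a) := by
    rcases isos_or_scalar hPI with ⟨t1, t2, h1, h2, h12⟩ | hsc
    · exact pi_dom hPI hι hu hcov hgen hCsimple h1 h2 h12 haa haa0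
    · have hιc : ∀ (x : A) (d : C), Commute (ι x) d := by
        intro x d
        obtain ⟨z, rfl⟩ := hsc x
        rw [AlgHomClass.commutes]
        exact Algebra.commutes z d
      have hlimc : ∀ e : C, ∀ c : C, (∀ η : ℝ, 0 < η → ∃ c', ‖c - c'‖ < η ∧ Commute c' e) →
          Commute c e := by
        intro e c hc
        have hcl : IsClosed {x : C | x * e = e * x} :=
          isClosed_eq (by fun_prop) (by fun_prop)
        have : c ∈ closure {x : C | x * e = e * x} := by
          rw [Metric.mem_closure_iff]
          intro η hη
          obtain ⟨c', h1, h2⟩ := hc η hη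
          exact ⟨c', h2, by rwa [dist_eq_norm]⟩
        rw [hcl.closure_eq] at this
        exact this
      have huz : ∀ (k : ℤ) (d : C), Commute d (uz hu k) := by
        intro k d
        refine cross_induction hu hcov hgen (fun c => Commute c (uz hu k)) ?_ ?_ (hlimc _) d
        · intro x l
          refine (hιc x _).mul_left ?_
          show uz hu l * uz hu k = uz hu k * uz hu l
          rw [← uz_add, ← uz_add, add_comm]
        · intro b c hb hc; exact hb.add_left hc
      have hcomm : ∀ c d : C, Commute c d := by
        intro c d
        refine cross_induction hu hcov hgen (fun c => Commute c d) ?_ ?_ (hlimc _) c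
        · intro x l
          exact (hιc x _).mul_left (huz l d).symm
        · intro b c hb hc; exact hb.add_left hc
      obtain ⟨n, w, hw⟩ := simple_sum_pos hCsimple haa haa0
      have hn0 : 0 ≤ ∑ i, star (w i) * w i := Finset.sum_nonneg fun i _ => star_mul_self_nonneg _
      refine ⟨CFC.sqrt (∑ i, star (w i) * w i), le_of_eq ?_⟩
      rw [(CFC.sqrt_nonneg _).isSelfAdjoint.star_eq, mul_assoc, (hcomm (a * a) _).eq, ← mul_assoc,
        CFC.sqrt_mul_sqrt_self _ hn0, hw, Finset.sum_mul]
      refine Finset.sum_congr rfl fun i _ => ?_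
      rw [mul_assoc, (hcomm (a * a) (w i)).eq, ← mul_assoc]
  refine ⟨⊥, 0, ?_, ⟨IsSelfAdjoint.zero C, by simp [IsIdempotentElem]⟩, zero_mem _, ?_, ?_, ?_, ?_⟩
  · have : Subsingleton (⊥ : NonUnitalStarSubalgebra ℂ C) :=
      ⟨fun x y => Subtype.ext (by
        have h1 := x.2
        have h2 := y.2
        rw [NonUnitalStarAlgebra.mem_bot] at h1 h2
        rw [h1, h2])⟩
    infer_instance
  · intro b hb
    rw [NonUnitalStarAlgebra.mem_bot] at hb
    simp [hb]
  · intro x _; simpa using hε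
  · intro x _; exact ⟨0, zero_mem _, by simpa using hε⟩
  · rw [sub_zero]
    exact hdom.cuntzLE q1 hap.isSelfAdjoint

end pisec3

/-- (Tracial-rank-zero case of `TR(A ⋊_α ℤ) = 0`, with the crossed
product replaced by the properties of it that are used.) If `A` is unital separable simple
with `TR(A) = 0`, `α` has the tracial Rokhlin property and `α ^ r` is approximately inner
for some `r ≥ 1`, and `C` is a unital simple C*-algebra with the SP-property containing `A`
(via the unital isometric *-embedding `ι`) with the same unit, `u ∈ C` is a unitary
implementing `α` on `A` and `C` is generated as a C*-algebra by `A ∪ {u}`, then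
`TR(C) = 0`. -/
theorem stmt12 {A C : Type*} [CStarAlgebra A] [CStarAlgebra C]
    [TopologicalSpace.SeparableSpace A]
    (hAsimple : IsSimpleCStar A) (hATR : TracialRankZero A)
    (α : A ≃⋆ₐ[ℂ] A) (hα : TracialRokhlin α)
    (r : ℕ) (hr : 1 ≤ r) (hai : ApproxInner ((⇑α)^[r]))
    (hCsimple : IsSimpleCStar C) (hCSP : SPProperty C)
    (ι : A →⋆ₐ[ℂ] C) (hι : Isometry ι)
    (u : C) (hu : u ∈ unitary C)
    (hcov : ∀ a : A, u * ι a * star u = ι (α a))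
    (hgen : (StarAlgebra.adjoin ℂ (Set.range ι ∪ {u})).topologicalClosure = ⊤) :
    TracialRankZero C := by
  by_cases hPI : ∀ x : A, IsPos x → x ≠ 0 → CuntzLE 1 x
  · exact main_PI hPI α hCsimple ι hι u hu hcov hgen
  · push Not at hPI
    obtain ⟨x, hx, hx0, hn⟩ := hPI
    exact main_notPI hAsimple hATR α hα r hr hai hCsimple ι hι u hu hcov hgen hx hx0 hn
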